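/- arXiv:1507.01426 — 5 statements merged into one kernel-verified Lean document; each statement's English description precedes it below -/
import Mathlib

section
/- Let G be a connected graph with n vertices and minimum degree δ ≥ 2. Then pc(G) ≤ max{3, (n−1)/(δ+1)}. Moreover, if (n−1)/(δ+1) > 3 and n ≥ δ(δ+1)+1, then pc(G) = (n−1)/(δ+1) if and only if G is isomorphic to S_r^t, where t − 1 = δ and r t + 1 = n. -/
/-- A walk in an edge-colored graph is *proper* if no two consecutive edges share a color. -/
def ProperWalk {V : Type*} {G : SimpleGraph V} (c : Sym2 V → ℕ) {u v : V}
    (p : G.Walk u v) : Prop :=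
  p.edges.Chain' fun e f => c e ≠ c f

/-- `c` is a proper-path coloring of `G`: every pair of distinct vertices is joined by a
proper path. -/
def IsProperPathColoring {V : Type*} (G : SimpleGraph V) (c : Sym2 V → ℕ) : Prop :=
  ∀ u v : V, u ≠ v → ∃ p : G.Walk u v, p.IsPath ∧ ProperWalk c p

/-- The proper connection number: the least `k` such that some coloring of the edges with
colors `0, …, k-1` is a proper-path coloring. -/
noncomputable def pc {V : Type*} (G : SimpleGraph V) : ℕ :=
  sInf {k | ∃ c : Sym2 V → ℕ, (∀ e ∈ G.edgeSet, c e < k) ∧ IsProperPathColoring G c}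

/-- `G` has the strong property under `c`: any two distinct vertices are joined by two proper
paths whose first-edge colors differ and whose last-edge colors differ. -/
def HasStrongProperty {V : Type*} (G : SimpleGraph V) (c : Sym2 V → ℕ) : Prop :=
  ∀ u v : V, u ≠ v → ∃ p q : G.Walk u v, p.IsPath ∧ q.IsPath ∧
    ProperWalk c p ∧ ProperWalk c q ∧
    p.edges.head?.map c ≠ q.edges.head?.map c ∧
    p.edges.getLast?.map c ≠ q.edges.getLast?.map c

/-- `c` makes `G` 2-proper connected: any two distinct vertices are joined by two
internally vertex-disjoint proper paths. -/
def Is2ProperConnected {V : Type*} (G : SimpleGraph V) (c : Sym2 V → ℕ) : Prop :=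
  ∀ u v : V, u ≠ v → ∃ p q : G.Walk u v, p.IsPath ∧ q.IsPath ∧
    ProperWalk c p ∧ ProperWalk c q ∧ p ≠ q ∧
    ∀ x, x ∈ p.support → x ∈ q.support → x = u ∨ x = v

/-- The 2-proper connection number. -/
noncomputable def pc2 {V : Type*} (G : SimpleGraph V) : ℕ :=
  sInf {k | ∃ c : Sym2 V → ℕ, (∀ e ∈ G.edgeSet, c e < k) ∧ Is2ProperConnected G c}

/-- `Srt r t`: the graph obtained from `r` disjoint copies of `K_t` by adding an extra
vertex (`none`) joined to one vertex of each copy. -/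
def Srt (r t : ℕ) : SimpleGraph (Option (Fin r × Fin t)) :=
  SimpleGraph.fromRel fun a b =>
    (∃ (i : Fin r) (j j' : Fin t), a = some (i, j) ∧ b = some (i, j') ∧ j ≠ j') ∨
    (∃ (i : Fin r) (h : 0 < t), a = none ∧ b = some (i, ⟨0, h⟩))


/-- `PP G c Z u v s e`: a properly colored path from `u` to `v` with vertex set `Z`, first color
`s` and last color `e`. -/
inductive PP {V K : Type*} (G : SimpleGraph V) (c : Sym2 V → K) : Set V → V → V → K → K → Prop
  | edge {u v : V} (h : G.Adj u v) : PP G c {u, v} u v (c s(u, v)) (c s(u, v))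
  | cons {Z : Set V} {u v w : V} {s e : K} (h : G.Adj u v) (hp : PP G c Z v w s e)
      (hu : u ∉ Z) (hc : c s(u, v) ≠ s) : PP G c (insert u Z) u w (c s(u, v)) e

namespace PP

variable {V K : Type*} {G : SimpleGraph V} {c : Sym2 V → K} {Z Z₁ Z₂ S : Set V}
  {u v w x y z : V} {s e s' e' : K}

theorem left_mem (h : PP G c Z u v s e) : u ∈ Z := by
  cases h <;> simp

theorem right_mem (h : PP G c Z u v s e) : v ∈ Z := by
  induction h <;> simp_all

theorem ne (h : PP G c Z u v s e) : u ≠ v := by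
  cases h with
  | edge h => exact h.ne
  | cons h hp hu hc => rintro rfl; exact hu hp.right_mem

theorem edge' (h : G.Adj u v) (hs : c s(u, v) = s) : PP G c {u, v} u v s s := by
  subst hs; exact edge h

theorem cons' (h : G.Adj u v) (hp : PP G c Z v w s e) (hu : u ∉ Z) (hs : c s(u, v) = s')
    (hc : s' ≠ s) : PP G c (insert u Z) u w s' e := by
  subst hs; exact cons h hp hu hc

theorem snoc (hp : PP G c Z u v s e) (h : G.Adj v w) (hw : w ∉ Z) (hc : e ≠ c s(v, w)) :
    PP G c (insert w Z) u w s (c s(v, w)) := by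
  induction hp with
  | edge h' =>
    rename_i a b
    have : (insert w {a, b} : Set V) = insert a {b, w} := by ext; simp; tauto
    rw [this]
    refine cons h' (edge h) ?_ hc
    simp at hw ⊢
    exact ⟨h'.ne, fun h => hw.1 h.symm⟩
  | cons h' hp hu hc' ih =>
    rw [Set.insert_comm]
    simp at hw
    refine cons h' (ih h hw.2 hc) ?_ hc'
    simp
    exact ⟨fun h => hw.1 h.symm, hu⟩

theorem snoc' (hp : PP G c Z u v s e) (h : G.Adj v w) (hw : w ∉ Z) (hs : c s(v, w) = e')
    (hc : e ≠ e') : PP G c (insert w Z) u w s e' := by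
  subst hs; exact snoc hp h hw hc

theorem symm (hp : PP G c Z u v s e) : PP G c Z v u e s := by
  induction hp with
  | edge h => rw [Set.pair_comm, Sym2.eq_swap]; exact edge h.symm
  | cons h hp hu hc ih =>
    rw [Sym2.eq_swap] at hc ⊢
    exact snoc ih h.symm hu hc.symm

theorem append (h1 : PP G c Z₁ u v s e) (h2 : PP G c Z₂ v w s' e') (hne : e ≠ s')
    (hd : ∀ z, z ∈ Z₁ → z ∈ Z₂ → z = v) : PP G c (Z₁ ∪ Z₂) u w s e' := by
  induction h1 with
  | edge h =>
    rename_i a b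
    have : ({a, b} ∪ Z₂ : Set V) = insert a Z₂ := by
      have := h2.left_mem
      ext t; simp
      grind
    rw [this]
    refine cons h h2 ?_ hne
    intro ha
    exact h.ne (hd _ (by simp) ha)
  | cons h hp hu hc ih =>
    rw [Set.insert_union]
    refine cons h (ih h2 hne fun z hz hz' => hd z (by simp [hz]) hz') ?_ hc
    rintro (h' | h')
    · exact hu h'
    · have := hd _ (by simp) h'
      subst this
      exact hu hp.right_mem

theorem congr {c' : Sym2 V → K} (hp : PP G c Z u v s e)
    (hcc : ∀ a ∈ Z, ∀ b ∈ Z, G.Adj a b → c' s(a, b) = c s(a, b)) : PP G c' Z u v s e := by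
  induction hp with
  | edge h => exact edge' h (hcc _ (by simp) _ (by simp) h)
  | cons h hp hu hc ih =>
    refine cons' h (ih fun a ha b hb => hcc a (by simp [ha]) b (by simp [hb])) hu ?_ hc
    exact hcc _ (by simp) _ (by simp [hp.left_mem]) h

theorem map {K' : Type*} (f : K → K') (hf : Function.Injective f) (hp : PP G c Z u v s e) :
    PP G (fun a => f (c a)) Z u v (f s) (f e) := by
  induction hp with
  | edge h => exact edge (c := fun a => f (c a)) h
  | cons h hp hu hc ih => exact cons (c := fun a => f (c a)) h ih hu (fun h => hc (hf h))

theorem firstHit {T : Set V} (hp : PP G c Z u x s e) (hu : u ∉ T) (hx : x ∈ T) :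
    ∃ z ∈ T, ∃ Z' ⊆ Z, (∀ t ∈ Z', t ∈ T → t = z) ∧ ∃ e', PP G c Z' u z s e' := by
  induction hp with
  | edge h =>
    refine ⟨_, hx, _, subset_rfl, ?_, _, edge h⟩
    rintro t (rfl | rfl) ht
    · exact absurd ht hu
    · rfl
  | cons h hp hu' hc ih =>
    rename_i Z a b d s e
    by_cases hb : b ∈ T
    · refine ⟨b, hb, {a, b}, ?_, ?_, _, edge h⟩
      · rintro t (rfl | rfl)
        · simp
        · simp [hp.left_mem]
      · rintro t (rfl | rfl) ht
        · exact absurd ht hu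
        · rfl
    · obtain ⟨z, hz, Z', hZ', hd, e', hp'⟩ := ih hb hx
      refine ⟨z, hz, insert a Z', Set.insert_subset_insert hZ', ?_, e',
        cons h hp' (fun h => hu' (hZ' h)) hc⟩
      rintro t (rfl | ht) htT
      · exact absurd htT hu
      · exact hd t ht htT

theorem split (hp : PP G c Z x y s e) (hz : z ∈ Z) (hzx : z ≠ x) (hzy : z ≠ y) :
    ∃ Z₁ Z₂ k k', Z₁ ∪ Z₂ = Z ∧ (∀ t ∈ Z₁, t ∈ Z₂ → t = z) ∧ PP G c Z₁ x z s k ∧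
      PP G c Z₂ z y k' e ∧ k ≠ k' := by
  induction hp with
  | edge h => simp at hz; tauto
  | cons h hp hu' hc ih =>
    rename_i Z a b d s e
    have hzZ : z ∈ Z := by
      rcases hz with h | h
      · exact absurd h hzx
      · exact h
    by_cases hb : z = b
    · subst hb
      refine ⟨{a, z}, Z, _, _, ?_, ?_, edge h, hp, hc⟩
      · ext t; simp; grind
      · rintro t (rfl | rfl) ht
        · exact absurd ht hu'
        · rfl
    · obtain ⟨Z₁, Z₂, k, k', hU, hd, h1, h2, hk⟩ := ih hzZ hb hzy
      refine ⟨insert a Z₁, Z₂, k, k', ?_, ?_, cons h h1 ?_ hc, h2, hk⟩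
      · rw [Set.insert_union, hU]
      · rintro t (rfl | ht) ht2
        · exact absurd (hU ▸ Or.inr ht2) hu'
        · exact hd t ht ht2
      · intro h; exact hu' (hU ▸ Or.inl h)

theorem reach (hp : PP G c Z u v s e) (f : Sym2 V) (hf : ∃ z ∈ f, z ∉ Z) :
    (G.deleteEdges {f}).Reachable u v := by
  induction hp with
  | edge h =>
    apply SimpleGraph.Adj.reachable
    rw [SimpleGraph.deleteEdges_adj]
    refine ⟨h, ?_⟩
    obtain ⟨z, hz, hz'⟩ := hf
    rintro rfl
    simp at hz hz'; tauto
  | cons h hp hu hc ih =>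
    obtain ⟨z, hz, hz'⟩ := hf
    simp at hz'
    refine SimpleGraph.Reachable.trans (SimpleGraph.Adj.reachable ?_) (ih ⟨z, hz, hz'.2⟩)
    rw [SimpleGraph.deleteEdges_adj]
    refine ⟨h, ?_⟩
    rintro rfl
    have := hp.left_mem
    simp at hz; rcases hz with rfl | rfl <;> simp_all

theorem toWalk (hp : PP G c Z u v s e) : ∃ p : G.Walk u v, p.IsPath ∧
    (∀ z ∈ p.support, z ∈ Z) ∧ (p.edges.map c).IsChain (· ≠ ·) ∧
    (p.edges.map c).head? = some s := by
  induction hp with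
  | edge h => 
    refine ⟨SimpleGraph.Walk.cons h .nil, ?_, ?_, ?_, ?_⟩ <;> simp [h.ne]
  | cons h hp hu hc ih =>
    obtain ⟨p, h1, h2, h3, h4⟩ := ih
    refine ⟨SimpleGraph.Walk.cons h p, ?_, ?_, ?_, ?_⟩
    · rw [SimpleGraph.Walk.cons_isPath_iff]
      exact ⟨h1, fun h => hu (h2 _ h)⟩
    · intro z hz
      simp at hz
      rcases hz with rfl | hz
      · simp
      · simp [h2 z hz]
    · rw [SimpleGraph.Walk.edges_cons, List.map_cons, List.isChain_cons]
      refine ⟨?_, h3⟩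
      rw [h4]; simpa using hc
    · simp

end PP

/-- A path can be freshly colored. -/
theorem colorPath {V : Type*} [DecidableEq V] {G : SimpleGraph V} {u v : V} (p : G.Walk u v)
    (hp : p.IsPath) (huv : u ≠ v) (c : Sym2 V → Fin 3) (a : Fin 3) :
    ∃ (c' : Sym2 V → Fin 3) (s e : Fin 3), PP G c' {z | z ∈ p.support} u v s e ∧ s ≠ a ∧
      ∀ f : Sym2 V, (∃ z ∈ f, z ∉ p.support) → c' f = c f := by
  have third : ∀ a b : Fin 3, ∃ d, d ≠ a ∧ d ≠ b := by decide
  induction p generalizing a with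
  | nil => exact absurd rfl huv
  | cons h p ih =>
    rename_i u v w
    rw [SimpleGraph.Walk.cons_isPath_iff] at hp
    by_cases hvw : v = w
    · subst hvw
      have hnil : p = .nil := SimpleGraph.Walk.eq_nil_iff_nil.2 (SimpleGraph.Walk.isPath_iff_nil.1 hp.1)
      subst hnil
      obtain ⟨d, hd, -⟩ := third a a
      refine ⟨Function.update c s(u, v) d, d, d, ?_, hd, ?_⟩
      · have : {z | z ∈ (SimpleGraph.Walk.cons h SimpleGraph.Walk.nil).support} = ({u, v} : Set V) := by
          ext; simp
        rw [this]
        exact PP.edge' h (by simp)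
      · rintro f ⟨z, hz, hz'⟩
        rw [Function.update_of_ne]
        rintro rfl
        simp at hz hz'; tauto
    · obtain ⟨c', s, e, h1, h2, h3⟩ := ih hp.1 hvw 0
      obtain ⟨d, hd, hds⟩ := third a s
      refine ⟨Function.update c' s(u, v) d, d, e, ?_, hd, ?_⟩
      · have : {z | z ∈ (SimpleGraph.Walk.cons h p).support} = insert u {z | z ∈ p.support} := by
          ext; simp
        rw [this]
        refine PP.cons' h (h1.congr ?_) hp.2 (by simp) hds
        intro x hx y hy hxy
        rw [Function.update_of_ne]
        intro heq
        have : u ∈ s(x, y) := by rw [heq]; simp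
        simp at this
        rcases this with rfl | rfl
        · exact hp.2 hx
        · exact hp.2 hy
      · rintro f ⟨z, hz, hz'⟩
        simp at hz'
        rw [Function.update_of_ne, h3 f ⟨z, hz, hz'.2⟩]
        rintro rfl
        simp at hz
        rcases hz with rfl | rfl
        · exact hz'.1 rfl
        · exact hz'.2 (by simp)


/-- Strong property inside a vertex set. -/
def StrongOn {V K : Type*} (G : SimpleGraph V) (c : Sym2 V → K) (S : Set V) : Prop :=
  ∀ u ∈ S, ∀ v ∈ S, u ≠ v → ∃ Z₁ Z₂ s₁ e₁ s₂ e₂, Z₁ ⊆ S ∧ Z₂ ⊆ S ∧ PP G c Z₁ u v s₁ e₁ ∧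
    PP G c Z₂ u v s₂ e₂ ∧ s₁ ≠ s₂ ∧ e₁ ≠ e₂

/-- The order of two vertices on an ear. -/
def EarOrd {V K : Type*} (G : SimpleGraph V) (c : Sym2 V → K) (I : Set V) (x y : V) (α β : K)
    (v v' : V) : Prop :=
  ∃ A B C k k' m m', A ⊆ I ∧ B ⊆ I ∧ C ⊆ I ∧ (∀ t ∈ A, t ∉ C) ∧ PP G c (insert x A) x v α k ∧
    PP G c B v v' k' m ∧ PP G c (insert y C) v' y m' β ∧ k ≠ k' ∧ m ≠ m'

theorem mixed_ext {V K : Type*} {G : SimpleGraph V} {c : Sym2 V → K} {S I : Set V} {x y : V}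
    {α β : K} (hS : StrongOn G c S) (hI : ∀ t ∈ I, t ∉ S) (hx : x ∈ S) (hy : y ∈ S)
    (hxy : (x = y ∧ α ≠ β) ∨ ∃ Z ⊆ S, ∃ s₁ e₁, PP G c Z x y s₁ e₁ ∧ α ≠ s₁ ∧ β ≠ e₁)
    {u v : V} (hu : u ∈ S) (Z₁ Z₂ : Set V) (a a' : K) (hZ₁ : Z₁ ⊆ I) (hZ₂ : Z₂ ⊆ I)
    (h1 : PP G c (insert x Z₁) x v α a) (h2 : PP G c (insert y Z₂) v y a' β) :
    ∃ f f', f ≠ f' ∧ (∃ Z ⊆ S ∪ I, PP G c Z u v f a) ∧ (∃ Z ⊆ S ∪ I, PP G c Z u v f' a') := by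
  have sub1 : insert x Z₁ ⊆ S ∪ I := by
    rintro t (rfl | ht)
    · exact Or.inl hx
    · exact Or.inr (hZ₁ ht)
  have sub2 : insert y Z₂ ⊆ S ∪ I := by
    rintro t (rfl | ht)
    · exact Or.inl hy
    · exact Or.inr (hZ₂ ht)
  have hA0 : u = x → ∃ Z ⊆ S ∪ I, PP G c Z u v α a := by
    rintro rfl; exact ⟨_, sub1, h1⟩
  have hB0 : u = y → ∃ Z ⊆ S ∪ I, PP G c Z u v β a' := by
    rintro rfl; exact ⟨_, sub2, h2.symm⟩
  have hA : ∀ Z ⊆ S, ∀ f g, PP G c Z u x f g → g ≠ α → ∃ Z ⊆ S ∪ I, PP G c Z u v f a := by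
    intro Z hZ f g hp hg
    refine ⟨Z ∪ insert x Z₁, Set.union_subset (fun t ht => Or.inl (hZ ht)) sub1,
      hp.append h1 hg ?_⟩
    rintro t ht (rfl | ht')
    · rfl
    · exact absurd (hZ ht) (hI t (hZ₁ ht'))
  have hB : ∀ Z ⊆ S, ∀ f g, PP G c Z u y f g → g ≠ β → ∃ Z ⊆ S ∪ I, PP G c Z u v f a' := by
    intro Z hZ f g hp hg
    refine ⟨Z ∪ insert y Z₂, Set.union_subset (fun t ht => Or.inl (hZ ht)) sub2,
      hp.append h2.symm hg ?_⟩
    rintro t ht (rfl | ht')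
    · rfl
    · exact absurd (hZ ht) (hI t (hZ₂ ht'))
  generalize hAd : (fun f => ∃ Z ⊆ S ∪ I, PP G c Z u v f a) = A at *
  generalize hBd : (fun f => ∃ Z ⊆ S ∪ I, PP G c Z u v f a') = B at *
  have eA : ∀ f, (∃ Z ⊆ S ∪ I, PP G c Z u v f a) ↔ A f := by subst hAd; simp
  have eB : ∀ f, (∃ Z ⊆ S ∪ I, PP G c Z u v f a') ↔ B f := by subst hBd; simp
  simp only [eA, eB] at *
  clear eA eB hAd hBd
  rcases hxy with ⟨rfl, hαβ⟩ | ⟨P, hP, s₁, e₁, hp, hα, hβ⟩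
  · by_cases hux : u = x
    · exact ⟨α, β, hαβ, hA0 hux, hB0 hux⟩
    · obtain ⟨X₁, X₂, f1, g1, f2, g2, hX₁, hX₂, q1, q2, hf, hg⟩ := hS u hu x hx hux
      have a1 := hA X₁ hX₁ _ _ q1
      have a2 := hA X₂ hX₂ _ _ q2
      have b1 := hB X₁ hX₁ _ _ q1
      have b2 := hB X₂ hX₂ _ _ q2
      by_cases h1 : g1 = α
      · subst h1
        exact ⟨f2, f1, hf.symm, a2 hg.symm, b1 hαβ⟩
      · by_cases h2 : g2 = β
        · subst h2
          exact ⟨f2, f1, hf.symm, a2 hαβ.symm, b1 hg⟩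
        · exact ⟨f1, f2, hf, a1 h1, b2 h2⟩
  · by_cases hux : u = x
    · subst hux
      exact ⟨α, s₁, hα, hA0 rfl, hB _ hP _ _ hp hβ.symm⟩
    by_cases huy : u = y
    · subst huy
      exact ⟨e₁, β, hβ.symm, hA _ hP _ _ hp.symm hα.symm, hB0 rfl⟩
    by_cases huP : u ∈ P
    · obtain ⟨P₁, P₂, k, k', hU, hd, p1, p2, hk⟩ := hp.split huP hux huy
      refine ⟨k, k', hk, hA P₁ ?_ _ _ p1.symm hα.symm, hB P₂ ?_ _ _ p2 hβ.symm⟩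
      · exact fun t ht => hP (hU ▸ Or.inl ht)
      · exact fun t ht => hP (hU ▸ Or.inr ht)
    · obtain ⟨X₁, X₂, f1, g1, f2, g2, hX₁, hX₂, q1, q2, hf, hg⟩ := hS u hu x hx hux
      obtain ⟨Y₁, Y₂, f1', g1', f2', g2', hY₁, hY₂, r1, r2, hf', hg'⟩ := hS u hu y hy huy
      have exA : ∃ f, A f := by
        by_cases h1 : g1 = α
        · exact ⟨f2, hA _ hX₂ _ _ q2 (h1 ▸ hg.symm)⟩
        · exact ⟨f1, hA _ hX₁ _ _ q1 h1⟩
      have exB : ∃ f, B f := by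
        by_cases h1 : g1' = β
        · exact ⟨f2', hB _ hY₂ _ _ r2 (h1 ▸ hg'.symm)⟩
        · exact ⟨f1', hB _ hY₁ _ _ r1 h1⟩
      obtain ⟨f, hAf⟩ := exA
      obtain ⟨f', hBf⟩ := exB
      by_cases hff : f = f'
      swap
      · exact ⟨f, f', hff, hAf, hBf⟩
      subst hff
      suffices h : ∃ h, h ≠ f ∧ (A h ∨ B h) by
        obtain ⟨h, hne, hh | hh⟩ := h
        · exact ⟨h, f, hne, hh, hBf⟩
        · exact ⟨f, h, hne.symm, hAf, hh⟩
      have : ∃ X ⊆ S, ∃ h g, h ≠ f ∧ PP G c X u x h g := by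
        by_cases h1 : f1 = f
        · exact ⟨X₂, hX₂, f2, g2, h1 ▸ hf.symm, q2⟩
        · exact ⟨X₁, hX₁, f1, g1, h1, q1⟩
      obtain ⟨X, hX, h, g, hne, q⟩ := this
      refine ⟨h, hne, ?_⟩
      obtain ⟨z, hz, X', hX', hd, g', q'⟩ := q.firstHit (T := P) huP hp.left_mem
      have hX'S : X' ⊆ S := hX'.trans hX
      by_cases hzx : z = x
      · subst hzx
        by_cases hg : g' = α
        · subst hg
          exact Or.inr (hB (X' ∪ P) (Set.union_subset hX'S hP) _ _
            (q'.append hp hα hd) hβ.symm)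
        · exact Or.inl (hA X' hX'S _ _ q' hg)
      by_cases hzy : z = y
      · subst hzy
        by_cases hg : g' = β
        · subst hg
          exact Or.inl (hA (X' ∪ P) (Set.union_subset hX'S hP) _ _
            (q'.append hp.symm hβ hd) hα.symm)
        · exact Or.inr (hB X' hX'S _ _ q' hg)
      obtain ⟨P₁, P₂, k, k', hU, hd', p1, p2, hk⟩ := hp.split hz hzx hzy
      have hP₁ : P₁ ⊆ P := fun t ht => hU ▸ Or.inl ht
      have hP₂ : P₂ ⊆ P := fun t ht => hU ▸ Or.inr ht
      by_cases hg : g' = k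
      · have hg' : g' ≠ k' := hg ▸ hk
        exact Or.inr (hB (X' ∪ P₂) (Set.union_subset hX'S (hP₂.trans hP)) _ _
            (q'.append p2 hg' fun t ht ht' => hd t ht (hP₂ ht')) hβ.symm)
      · exact Or.inl (hA (X' ∪ P₁) (Set.union_subset hX'S (hP₁.trans hP)) _ _
            (q'.append p1.symm hg fun t ht ht' => hd t ht (hP₁ ht')) hα.symm)

theorem ord_ext {V K : Type*} {G : SimpleGraph V} {c : Sym2 V → K} {S I : Set V} {x y : V}
    {α β : K} (hI : ∀ t ∈ I, t ∉ S) (hx : x ∈ S) (hy : y ∈ S)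
    (hxy : (x = y ∧ α ≠ β) ∨ ∃ Z ⊆ S, ∃ s₁ e₁, PP G c Z x y s₁ e₁ ∧ α ≠ s₁ ∧ β ≠ e₁)
    {v v' : V} (ho : EarOrd G c I x y α β v v') :
    ∃ Z₁ Z₂ s₁ e₁ s₂ e₂, Z₁ ⊆ S ∪ I ∧ Z₂ ⊆ S ∪ I ∧ PP G c Z₁ v v' s₁ e₁ ∧
    PP G c Z₂ v v' s₂ e₂ ∧ s₁ ≠ s₂ ∧ e₁ ≠ e₂ := by
  obtain ⟨A, B, C, k, k', m, m', hA, hB, hC, hAC, p1, p2, p3, hk, hm⟩ := ho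
  have sub1 : insert x A ⊆ S ∪ I := by
    rintro t (rfl | ht)
    · exact Or.inl hx
    · exact Or.inr (hA ht)
  have sub2 : insert y C ⊆ S ∪ I := by
    rintro t (rfl | ht)
    · exact Or.inl hy
    · exact Or.inr (hC ht)
  have key : ∃ Z ⊆ S ∪ I, PP G c Z v v' k m' := by
    rcases hxy with ⟨rfl, hαβ⟩ | ⟨P, hP, s₁, e₁, hp, hα, hβ⟩
    · refine ⟨_, Set.union_subset sub1 sub2, p1.symm.append p3.symm hαβ ?_⟩
      rintro t (rfl | ht) (h | ht')
      · rfl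
      · exact absurd hx (hI _ (hC ht'))
      · exact h
      · exact absurd ht' (hAC t ht)
    · have q : PP G c (insert x A ∪ P) v y k e₁ := by
        refine p1.symm.append hp hα ?_
        rintro t (rfl | ht) ht'
        · rfl
        · exact absurd (hP ht') (hI _ (hA ht))
      refine ⟨_, Set.union_subset (Set.union_subset sub1 fun t ht => Or.inl (hP ht)) sub2,
        q.append p3.symm hβ.symm ?_⟩
      rintro t ((rfl | ht) | ht) (h | ht')
      · exact h
      · exact absurd hx (hI _ (hC ht'))
      · exact h
      · exact absurd ht' (hAC t ht)
      · exact h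
      · exact absurd (hP ht) (hI _ (hC ht'))
  obtain ⟨Z, hZ, q⟩ := key
  exact ⟨B, Z, k', m, k, m', fun t ht => Or.inr (hB ht), hZ, p2, q, hk.symm, hm⟩

theorem strong_ext {V K : Type*} {G : SimpleGraph V} {c : Sym2 V → K} {S I : Set V} {x y : V}
    {α β : K} (hS : StrongOn G c S) (hI : ∀ t ∈ I, t ∉ S) (hx : x ∈ S) (hy : y ∈ S)
    (hxy : (x = y ∧ α ≠ β) ∨ ∃ Z ⊆ S, ∃ s₁ e₁, PP G c Z x y s₁ e₁ ∧ α ≠ s₁ ∧ β ≠ e₁)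
    (hE1 : ∀ v ∈ I, ∃ Z₁ Z₂ a a', Z₁ ⊆ I ∧ Z₂ ⊆ I ∧ a ≠ a' ∧ PP G c (insert x Z₁) x v α a ∧
      PP G c (insert y Z₂) v y a' β)
    (hE2 : ∀ v ∈ I, ∀ v' ∈ I, v ≠ v' → EarOrd G c I x y α β v v' ∨ EarOrd G c I x y α β v' v) :
    StrongOn G c (S ∪ I) := by
  rintro u (hu | hu) v (hv | hv) huv
  · obtain ⟨Z₁, Z₂, s₁, e₁, s₂, e₂, h1, h2, h⟩ := hS u hu v hv huv
    exact ⟨Z₁, Z₂, s₁, e₁, s₂, e₂, fun t ht => Or.inl (h1 ht), fun t ht => Or.inl (h2 ht), h⟩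
  · obtain ⟨Z₁, Z₂, a, a', h1, h2, ha, p1, p2⟩ := hE1 v hv
    obtain ⟨f, f', hf, ⟨Y₁, hY₁, q1⟩, Y₂, hY₂, q2⟩ :=
      mixed_ext hS hI hx hy hxy hu Z₁ Z₂ a a' h1 h2 p1 p2
    exact ⟨Y₁, Y₂, f, a, f', a', hY₁, hY₂, q1, q2, hf, ha⟩
  · obtain ⟨Z₁, Z₂, a, a', h1, h2, ha, p1, p2⟩ := hE1 u hu
    obtain ⟨f, f', hf, ⟨Y₁, hY₁, q1⟩, Y₂, hY₂, q2⟩ :=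
      mixed_ext hS hI hx hy hxy hv Z₁ Z₂ a a' h1 h2 p1 p2
    exact ⟨Y₁, Y₂, a, f, a', f', hY₁, hY₂, q1.symm, q2.symm, ha, hf⟩
  · rcases hE2 u hu v hv huv with h | h
    · exact ord_ext hI hx hy hxy h
    · obtain ⟨Z₁, Z₂, s₁, e₁, s₂, e₂, h1, h2, p1, p2, h3, h4⟩ := ord_ext hI hx hy hxy h
      exact ⟨Z₁, Z₂, e₁, s₁, e₂, s₂, h1, h2, p1.symm, p2.symm, h4, h3⟩

/-- Ear data coming from a path with at least one edge. -/
theorem ear_data {V K : Type*} {G : SimpleGraph V} {c : Sym2 V → K} {I : Set V} {x y w w' : V}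
    {α β l e : K} (hxI : x ∉ I) (hyI : y ∉ I) (hR : PP G c I w w' l e) (hxw : G.Adj x w)
    (hwy : G.Adj w' y) (hα : c s(x, w) = α) (hβ : c s(w', y) = β) (hαl : α ≠ l) (hβe : e ≠ β) :
    (∀ v ∈ I, ∃ Z₁ Z₂ a a', Z₁ ⊆ I ∧ Z₂ ⊆ I ∧ a ≠ a' ∧ PP G c (insert x Z₁) x v α a ∧
      PP G c (insert y Z₂) v y a' β) ∧
    (∀ v ∈ I, ∀ v' ∈ I, v ≠ v' → EarOrd G c I x y α β v v' ∨ EarOrd G c I x y α β v' v) := by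
  have hE : PP G c (insert x I) x w' α e := PP.cons' hxw hR hxI hα hαl
  have hend : PP G c (insert y {w'}) w' y β β := by
    rw [Set.pair_comm]; exact PP.edge' hwy hβ
  have hw'I := hR.right_mem
  -- splitting
  have hsp : ∀ v ∈ I, v ≠ w' → ∃ A B k k', A ∪ B = I ∧ (∀ t ∈ A, t ∈ B → t = v) ∧
      PP G c (insert x A) x v α k ∧ PP G c B v w' k' e ∧ k ≠ k' := by
    intro v hv hvw
    obtain ⟨Z₁, Z₂, k, k', hU, hd, p1, p2, hk⟩ :=
      hE.split (Or.inr hv) (fun h => hxI (h ▸ hv)) hvw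
    have hx1 := p1.left_mem
    have hx2 : x ∉ Z₂ := fun h => p1.ne (hd x hx1 h)
    refine ⟨Z₁ \ {x}, Z₂, k, k', ?_, fun t ht => hd t ht.1, ?_, p2, hk⟩
    · ext t
      have : t ∈ Z₁ ∪ Z₂ ↔ t ∈ insert x I := by rw [hU]
      simp at this ⊢
      grind
    · rw [Set.insert_sdiff_singleton, Set.insert_eq_of_mem hx1]; exact p1
  have hsn : ∀ v B k', B ⊆ I → PP G c B v w' k' e → PP G c (insert y B) v y k' β :=
    fun v B k' hB p => p.snoc' hwy (fun h => hyI (hB h)) hβ hβe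
  constructor
  · intro v hv
    by_cases hvw : v = w'
    · subst hvw
      exact ⟨I, {v}, e, β, subset_rfl, by simpa using hv, hβe, hE, hend⟩
    · obtain ⟨A, B, k, k', hU, hd, p1, p2, hk⟩ := hsp v hv hvw
      have hB : B ⊆ I := fun t ht => hU ▸ Or.inr ht
      exact ⟨A, B, k, k', fun t ht => hU ▸ Or.inl ht, hB, hk, p1, hsn _ _ _ hB p2⟩
  · have last : ∀ v ∈ I, v ≠ w' → EarOrd G c I x y α β v w' := by
      intro v hv hvw
      obtain ⟨A, B, k, k', hU, hd, p1, p2, hk⟩ := hsp v hv hvw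
      have hB : B ⊆ I := fun t ht => hU ▸ Or.inr ht
      refine ⟨A, B, {w'}, k, k', e, β, fun t ht => hU ▸ Or.inl ht, hB, by simpa using hw'I, ?_,
        p1, p2, hend, hk, hβe⟩
      rintro t ht rfl
      exact hvw (hd _ ht p2.right_mem).symm
    intro v hv v' hv' hvv
    by_cases hvw : v = w'
    · subst hvw; exact Or.inr (last v' hv' hvv.symm)
    by_cases hvw' : v' = w'
    · subst hvw'; exact Or.inl (last v hv hvv)
    obtain ⟨A, B, k, k', hU, hd, p1, p2, hk⟩ := hsp v hv hvw
    have hA : A ⊆ I := fun t ht => hU ▸ Or.inl ht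
    have hB : B ⊆ I := fun t ht => hU ▸ Or.inr ht
    have : v' ∈ A ∪ B := hU ▸ hv'
    rcases this with hA' | hB'
    · right
      obtain ⟨Z₁, Z₂, m, m', hU', hd', q1, q2, hm⟩ :=
        p1.split (Or.inr hA') (fun h => hxI (h ▸ hv')) hvv.symm
      have hx1 := q1.left_mem
      have hx2 : x ∉ Z₂ := fun h => q1.ne (hd' x hx1 h)
      have h1 : Z₁ \ {x} ⊆ A := by
        intro t ht
        have : t ∈ insert x A := hU' ▸ Or.inl ht.1
        exact this.resolve_left ht.2
      have h2 : Z₂ ⊆ A := by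
        intro t ht
        have : t ∈ insert x A := hU' ▸ Or.inr ht
        exact this.resolve_left (fun h => hx2 (h ▸ ht))
      refine ⟨Z₁ \ {x}, Z₂, B, m, m', k, k', h1.trans hA, h2.trans hA, hB, ?_, ?_, q2,
        hsn _ _ _ hB p2, hm, hk⟩
      · intro t ht htB
        have := hd t (h1 ht) htB
        subst this
        exact hvv (hd' _ ht.1 q2.right_mem)
      · rw [Set.insert_sdiff_singleton, Set.insert_eq_of_mem hx1]; exact q1
    · left
      obtain ⟨Z₁, Z₂, m, m', hU', hd', q1, q2, hm⟩ := p2.split hB' hvv.symm hvw'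
      have h1 : Z₁ ⊆ B := fun t ht => hU' ▸ Or.inl ht
      have h2 : Z₂ ⊆ B := fun t ht => hU' ▸ Or.inr ht
      refine ⟨A, Z₁, Z₂, k, k', m, m', hA, h1.trans hB, h2.trans hB, ?_, p1, q1,
        hsn _ _ _ (h2.trans hB) q2, hk, hm⟩
      intro t ht htB
      have := hd t ht (h2 htB)
      subst this
      exact hvv (hd' _ q1.left_mem htB)


theorem StrongOn.congr {V K : Type*} {G : SimpleGraph V} {c c' : Sym2 V → K} {S : Set V}
    (hS : StrongOn G c S) (h : ∀ a ∈ S, ∀ b ∈ S, c' s(a, b) = c s(a, b)) : StrongOn G c' S := by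
  intro u hu v hv huv
  obtain ⟨Z₁, Z₂, s₁, e₁, s₂, e₂, h1, h2, p1, p2, h3, h4⟩ := hS u hu v hv huv
  exact ⟨Z₁, Z₂, s₁, e₁, s₂, e₂, h1, h2,
    p1.congr fun a ha b hb _ => h a (h1 ha) b (h1 hb),
    p2.congr fun a ha b hb _ => h a (h2 ha) b (h2 hb), h3, h4⟩

theorem exit_walk {V : Type*} {H : SimpleGraph V} {S : Set V} {w x : V} (p : H.Walk w x)
    (hw : w ∉ S) (hx : x ∈ S) : ∃ w' y, w' ∉ S ∧ y ∈ S ∧ H.Adj w' y ∧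
      ∃ q : H.Walk w w', ∀ z ∈ q.support, z ∉ S := by
  induction p with
  | nil => exact absurd hx hw
  | cons h p ih =>
    rename_i a b d
    by_cases hb : b ∈ S
    · exact ⟨a, b, hw, hb, h, .nil, by simpa using hw⟩
    · obtain ⟨w', y, h1, h2, h3, q, hq⟩ := ih hb hx
      refine ⟨w', y, h1, h2, h3, .cons h q, ?_⟩
      intro z hz
      simp at hz
      rcases hz with rfl | hz
      · exact hw
      · exact hq z hz

theorem good_ext {V : Type*} [DecidableEq V] {G : SimpleGraph V} {c : Sym2 V → Fin 3} {S : Set V}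
    (hS : StrongOn G c S) {x w : V} (hx : x ∈ S) (hw : w ∉ S) (hxw : G.Adj x w)
    (hr : (G.deleteEdges {s(x, w)}).Reachable w x) :
    ∃ S', S ⊆ S' ∧ w ∈ S' ∧ ∃ c' : Sym2 V → Fin 3, StrongOn G c' S' := by
  have third : ∀ a b : Fin 3, ∃ d, d ≠ a ∧ d ≠ b := by decide
  obtain ⟨p⟩ := hr
  obtain ⟨w', y, hw', hy, hadj, q, hq⟩ := exit_walk p hw hx
  rw [SimpleGraph.deleteEdges_adj] at hadj
  obtain ⟨hwy, hne⟩ := hadj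
  have hne' : s(w', y) ≠ s(x, w) := hne
  have hxne : ¬ (x = y ∧ w = w') := by
    rintro ⟨rfl, rfl⟩; exact hne' Sym2.eq_swap
  by_cases hww : w = w'
  · subst hww
    have hxy : x ≠ y := fun h => hxne ⟨h, rfl⟩
    obtain ⟨Z, -, s₁, e₁, -, -, hZ, -, hp, -⟩ := hS x hx y hy hxy
    obtain ⟨α, hα, -⟩ := third s₁ s₁
    obtain ⟨β, hβ, hβα⟩ := third e₁ α
    let c' := Function.update (Function.update c s(x, w) α) s(w, y) β
    have c1 : c' s(x, w) = α := by
      simp only [c']; rw [Function.update_of_ne hne'.symm]; simp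
    have c2 : c' s(w, y) = β := by simp [c']
    have c3 : ∀ a ∈ S, ∀ b ∈ S, c' s(a, b) = c s(a, b) := by
      intro a ha b hb
      have : ∀ f : Sym2 V, w ∈ f → s(a, b) ≠ f := by
        rintro f hf rfl
        simp at hf
        rcases hf with rfl | rfl
        · exact hw ha
        · exact hw hb
      simp only [c']
      rw [Function.update_of_ne (this _ (by simp)), Function.update_of_ne (this _ (by simp))]
    refine ⟨S ∪ {w}, Set.subset_union_left, by simp, c', ?_⟩
    refine strong_ext (x := x) (y := y) (α := α) (β := β) (hS.congr c3) (by simpa using hw) hx hy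
      (Or.inr ⟨Z, hZ, s₁, e₁, hp.congr fun a ha b hb _ => c3 a (hZ ha) b (hZ hb), hα, hβ⟩) ?_ ?_
    · rintro v rfl
      refine ⟨{v}, {v}, α, β, subset_rfl, subset_rfl, hβα.symm, PP.edge' hxw c1, ?_⟩
      rw [Set.pair_comm]; exact PP.edge' hwy c2
    · rintro v rfl v' rfl h; exact absurd rfl h
  · have hle : G.deleteEdges {s(x, w)} ≤ G := SimpleGraph.deleteEdges_le _
    let r := (q.mapLe hle).bypass
    have hr : r.IsPath := SimpleGraph.Walk.bypass_isPath _
    have hrS : ∀ z ∈ r.support, z ∉ S := by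
      intro z hz
      have := SimpleGraph.Walk.support_bypass_subset_support _ hz
      rw [SimpleGraph.Walk.support_mapLe_eq_support] at this
      exact hq z this
    have hab : ∃ α e₁ : Fin 3, (x = y ∧ e₁ = α) ∨
        (∃ Z ⊆ S, ∃ s₁, PP G c Z x y s₁ e₁ ∧ α ≠ s₁) := by
      by_cases hxy : x = y
      · exact ⟨0, 0, Or.inl ⟨hxy, rfl⟩⟩
      · obtain ⟨Z, -, s₁, e₁, -, -, hZ, -, hp, -⟩ := hS x hx y hy hxy
        obtain ⟨α, hα, -⟩ := third s₁ s₁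
        exact ⟨α, e₁, Or.inr ⟨Z, hZ, s₁, hp, hα⟩⟩
    obtain ⟨α, e₁, hab⟩ := hab
    obtain ⟨c₁, l, e, hR, hl, hagree⟩ := colorPath r hr hww c α
    obtain ⟨β, hβ, hβe⟩ := third e₁ e
    set I : Set V := {z | z ∈ r.support} with hI
    have hIS : ∀ t ∈ I, t ∉ S := hrS
    let c' := Function.update (Function.update c₁ s(x, w) α) s(w', y) β
    have c1 : c' s(x, w) = α := by
      simp only [c']; rw [Function.update_of_ne hne'.symm]; simp
    have c2 : c' s(w', y) = β := by simp [c']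
    have c0 : ∀ a b, s(a, b) ≠ s(x, w) → s(a, b) ≠ s(w', y) → c' s(a, b) = c₁ s(a, b) := by
      intro a b h1 h2
      simp only [c']
      rw [Function.update_of_ne h2, Function.update_of_ne h1]
    have c3 : ∀ a ∈ S, ∀ b ∈ S, c' s(a, b) = c s(a, b) := by
      intro a ha b hb
      have : ∀ z, z ∉ S → ∀ f : Sym2 V, z ∈ f → s(a, b) ≠ f := by
        rintro z hz f hf rfl
        simp at hf
        rcases hf with rfl | rfl
        · exact hz ha
        · exact hz hb
      rw [c0 _ _ (this w hw _ (by simp)) (this w' hw' _ (by simp))]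
      exact hagree _ ⟨a, by simp, fun h => hrS a h ha⟩
    have c4 : ∀ a ∈ I, ∀ b ∈ I, c' s(a, b) = c₁ s(a, b) := by
      intro a ha b hb
      have : ∀ z, z ∈ S → ∀ f : Sym2 V, z ∈ f → s(a, b) ≠ f := by
        rintro z hz f hf rfl
        simp at hf
        rcases hf with rfl | rfl
        · exact hIS _ ha hz
        · exact hIS _ hb hz
      exact c0 _ _ (this x hx _ (by simp)) (this y hy _ (by simp))
    obtain ⟨hE1, hE2⟩ := ear_data (c := c') (x := x) (y := y) (fun h => hIS x h hx)
      (fun h => hIS y h hy) (hR.congr fun a ha b hb _ => c4 a ha b hb) hxw hwy c1 c2 hl.symm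
      hβe.symm
    refine ⟨S ∪ I, Set.subset_union_left, Or.inr (by simp [hI]), c', ?_⟩
    refine strong_ext (hS.congr c3) hIS hx hy ?_ hE1 hE2
    rcases hab with ⟨h1, h2⟩ | ⟨Z, hZ, s₁, hp, hα⟩
    · subst h2; exact Or.inl ⟨h1, hβ.symm⟩
    · exact Or.inr ⟨Z, hZ, s₁, e₁, hp.congr fun a ha b hb _ => c3 a (hZ ha) b (hZ hb), hα, hβ⟩

/-- All edges leaving `S` are bridges. -/
def BridgeBd {V : Type*} (G : SimpleGraph V) (S : Set V) : Prop :=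
  ∀ x ∈ S, ∀ w ∉ S, G.Adj x w → ¬ (G.deleteEdges {s(x, w)}).Reachable x w

/-- `S` is connected inside itself (robust formulation). -/
def ConnOn {V : Type*} (G : SimpleGraph V) (S : Set V) : Prop :=
  ∀ u ∈ S, ∀ v ∈ S, ∀ f : Sym2 V, (∃ z ∈ f, z ∉ S) → (G.deleteEdges {f}).Reachable u v

theorem StrongOn.connOn {V K : Type*} {G : SimpleGraph V} {c : Sym2 V → K} {S : Set V}
    (hS : StrongOn G c S) : ConnOn G S := by
  rintro u hu v hv f ⟨z, hz, hzS⟩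
  by_cases h : u = v
  · subst h; exact SimpleGraph.Reachable.refl _
  · obtain ⟨Z, -, s₁, e₁, -, -, hZ, -, hp, -⟩ := hS u hu v hv h
    exact hp.reach f ⟨z, hz, fun h => hzS (hZ h)⟩

theorem exists_good {V : Type*} [Fintype V] [DecidableEq V] (G : SimpleGraph V) (w : V) :
    ∃ C : Set V, w ∈ C ∧ BridgeBd G C ∧ ∃ c : Sym2 V → Fin 3, StrongOn G c C := by
  let F : Set (Set V) := {C | w ∈ C ∧ ∃ c : Sym2 V → Fin 3, StrongOn G c C}
  have hne : F.Nonempty := ⟨{w}, rfl, fun _ => 0, by rintro u rfl v rfl h; exact absurd rfl h⟩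
  obtain ⟨C, hC⟩ := (Set.toFinite F).exists_maximal hne
  obtain ⟨⟨hwC, c, hc⟩, hmax⟩ := hC
  refine ⟨C, hwC, ?_, c, hc⟩
  intro x hx v hv hadj hr
  obtain ⟨S', h1, h2, c', hc'⟩ := good_ext hc hx hv hadj hr.symm
  exact hv (hmax (y := S') ⟨h1 hwC, c', hc'⟩ h1 h2)

/-- closed neighborhood of a set -/
def clN {V : Type*} (G : SimpleGraph V) (S : Set V) : Set V := {v | v ∈ S ∨ ∃ x ∈ S, G.Adj x v}

/-- proper-path connected inside a set -/
def PConn {V K : Type*} (G : SimpleGraph V) (c : Sym2 V → K) (A : Set V) : Prop :=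
  ∀ u ∈ A, ∀ v ∈ A, u ≠ v → ∃ Z ⊆ A, ∃ s e, PP G c Z u v s e

theorem PP.last_edge {V K : Type*} {G : SimpleGraph V} {c : Sym2 V → K} {Z : Set V} {u v : V}
    {s e : K} (hp : PP G c Z u v s e) : ∃ y ∈ Z, G.Adj y v ∧ c s(y, v) = e ∧
      (u ≠ y → ∃ Z' e', Z = insert v Z' ∧ v ∉ Z' ∧ PP G c Z' u y s e' ∧ e' ≠ e) := by
  have h := hp.symm
  cases h with
  | edge h => exact ⟨u, by simp, h.symm, by rw [Sym2.eq_swap], fun h => absurd rfl h⟩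
  | cons h hp' hu hc =>
    rename_i Z y s'
    exact ⟨y, by simp [hp'.left_mem], h.symm, by rw [Sym2.eq_swap], fun _ =>
      ⟨Z, s', rfl, hu, hp'.symm, hc.symm⟩⟩

theorem glue {V K : Type*} {G : SimpleGraph V} {c : Sym2 V → K} {A₁ A₂ : Set V} {x w : V}
    (h1 : PConn G c A₁) (h2 : PConn G c A₂) (hx1 : x ∈ A₁) (hw1 : w ∈ A₁) (hx2 : x ∈ A₂)
    (hw2 : w ∈ A₂) (hint : ∀ t ∈ A₁, t ∈ A₂ → t = x ∨ t = w)
    (hl1 : ∀ t ∈ A₁, G.Adj t w → t = x) (hl2 : ∀ t ∈ A₂, G.Adj x t → t = w) :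
    PConn G c (A₁ ∪ A₂) := by
  have key : ∀ u ∈ A₁, u ∉ A₂ → ∀ v ∈ A₂, v ∉ A₁ → ∃ Z ⊆ A₁ ∪ A₂, ∃ s e, PP G c Z u v s e := by
    intro u hu hu2 v hv hv1
    obtain ⟨Z, hZ, s, e, p⟩ := h1 u hu w hw1 (fun h => hu2 (h ▸ hw2))
    obtain ⟨Y, hY, s', e', q⟩ := h2 v hv x hx2 (fun h => hv1 (h ▸ hx1))
    obtain ⟨y, hyZ, hadj, hce, hcut⟩ := p.last_edge
    have hyx := hl1 y (hZ hyZ) hadj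
    subst hyx
    obtain ⟨t, htY, htadj, hce', -⟩ := q.last_edge
    have htw := hl2 t (hY htY) htadj.symm
    subst htw
    obtain ⟨Z', e'', hZ', hwZ', p', hne⟩ := hcut (fun h => hu2 (h ▸ hx2))
    refine ⟨Z' ∪ Y, ?_, s, s', p'.append q.symm ?_ ?_⟩
    · rintro a (ha | ha)
      · exact Or.inl (hZ (hZ' ▸ Or.inr ha))
      · exact Or.inr (hY ha)
    · rw [← hce', Sym2.eq_swap, hce]; exact hne
    · intro a ha ha'
      rcases hint a (hZ (hZ' ▸ Or.inr ha)) (hY ha') with h | h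
      · exact h
      · subst h; exact absurd ha hwZ'
  intro u hu v hv huv
  by_cases hu1 : u ∈ A₁ <;> by_cases hv1 : v ∈ A₁
  · obtain ⟨Z, hZ, h⟩ := h1 u hu1 v hv1 huv
    exact ⟨Z, fun t ht => Or.inl (hZ ht), h⟩
  · have hv2 := hv.resolve_left hv1
    by_cases hu2 : u ∈ A₂
    · obtain ⟨Z, hZ, h⟩ := h2 u hu2 v hv2 huv
      exact ⟨Z, fun t ht => Or.inr (hZ ht), h⟩
    · exact key u hu1 hu2 v hv2 hv1
  · have hu2 := hu.resolve_left hu1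
    by_cases hv2 : v ∈ A₂
    · obtain ⟨Z, hZ, h⟩ := h2 u hu2 v hv2 huv
      exact ⟨Z, fun t ht => Or.inr (hZ ht), h⟩
    · obtain ⟨Z, hZ, s, e, h⟩ := key v hv1 hv2 u hu2 hu1
      exact ⟨Z, hZ, e, s, h.symm⟩
  · obtain ⟨Z, hZ, h⟩ := h2 u (hu.resolve_left hu1) v (hv.resolve_left hv1) huv
    exact ⟨Z, fun t ht => Or.inr (hZ ht), h⟩


/-- compatibility of two pendant colors -/
def PRel {V K : Type*} (G : SimpleGraph V) (c : Sym2 V → K) (S : Set V) (x : V) (a : K) (y : V)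
    (b : K) : Prop :=
  (x = y ∧ a ≠ b) ∨ ∃ Z ⊆ S, ∃ s e, PP G c Z x y s e ∧ s ≠ a ∧ e ≠ b

theorem PRel.symm {V K : Type*} {G : SimpleGraph V} {c : Sym2 V → K} {S : Set V} {x y : V}
    {a b : K} (h : PRel G c S x a y b) : PRel G c S y b x a := by
  rcases h with ⟨rfl, h⟩ | ⟨Z, hZ, s, e, p, h1, h2⟩
  · exact Or.inl ⟨rfl, h.symm⟩
  · exact Or.inr ⟨Z, hZ, e, s, p.symm, h2, h1⟩

theorem rel_triple {V : Type*} {G : SimpleGraph V} {c : Sym2 V → Fin 3} {S : Set V}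
    (hS : StrongOn G c S) {x y z : V} (hx : x ∈ S) (hy : y ∈ S) (hz : z ∈ S) :
    ∃ a b d, PRel G c S x a y b ∧ PRel G c S y b z d ∧ PRel G c S x a z d := by
  have third : ∀ a b : Fin 3, ∃ d, d ≠ a ∧ d ≠ b := by decide
  have F1 : ∀ x ∈ S, ∀ y ∈ S, x ≠ y → ∃ a, ∀ b, PRel G c S x a y b := by
    intro x hx y hy hxy
    obtain ⟨Z₁, Z₂, s₁, e₁, s₂, e₂, h1, h2, p1, p2, h3, h4⟩ := hS x hx y hy hxy
    obtain ⟨a, ha1, ha2⟩ := third s₁ s₂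
    refine ⟨a, fun b => Or.inr ?_⟩
    by_cases hb : e₁ = b
    · exact ⟨Z₂, h2, s₂, e₂, p2, ha2.symm, hb ▸ h4.symm⟩
    · exact ⟨Z₁, h1, s₁, e₁, p1, ha1.symm, hb⟩
  have F2 : ∀ x ∈ S, ∀ y ∈ S, ∀ a, ∃ g, ∀ b, b ≠ g → PRel G c S x a y b := by
    intro x hx y hy a
    by_cases hxy : x = y
    · exact ⟨a, fun b hb => Or.inl ⟨hxy, hb.symm⟩⟩
    obtain ⟨Z₁, Z₂, s₁, e₁, s₂, e₂, h1, h2, p1, p2, h3, h4⟩ := hS x hx y hy hxy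
    by_cases ha : s₁ = a
    · exact ⟨e₂, fun b hb => Or.inr ⟨Z₂, h2, s₂, e₂, p2, ha ▸ h3.symm, hb.symm⟩⟩
    · exact ⟨e₁, fun b hb => Or.inr ⟨Z₁, h1, s₁, e₁, p1, ha, hb.symm⟩⟩
  by_cases hxy : x = y
  · subst hxy
    by_cases hxz : x = z
    · subst hxz
      exact ⟨0, 1, 2, Or.inl ⟨rfl, by decide⟩, Or.inl ⟨rfl, by decide⟩, Or.inl ⟨rfl, by decide⟩⟩
    · obtain ⟨d, hd⟩ := F1 z hz x hx (Ne.symm hxz)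
      exact ⟨0, 1, d, Or.inl ⟨rfl, by decide⟩, (hd _).symm, (hd _).symm⟩
  · by_cases hyz : y = z
    · subst hyz
      obtain ⟨a, ha⟩ := F1 x hx y hy hxy
      exact ⟨a, 0, 1, ha _, Or.inl ⟨rfl, by decide⟩, ha _⟩
    by_cases hxz : x = z
    · subst hxz
      obtain ⟨b, hb⟩ := F1 y hy x hx hyz
      exact ⟨0, b, 1, (hb _).symm, hb _, Or.inl ⟨rfl, by decide⟩⟩
    obtain ⟨a, ha⟩ := F1 x hx y hy hxy
    obtain ⟨b, hb⟩ := F1 y hy z hz hyz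
    obtain ⟨g, hg⟩ := F2 x hx z hz a
    obtain ⟨d, hd, -⟩ := third g g
    exact ⟨a, b, d, ha _, hb _, hg _ hd⟩

theorem star {V : Type*} [Fintype V] {G : SimpleGraph V} {c₀ : Sym2 V → Fin 3} {C : Set V}
    (hS : StrongOn G c₀ C) (hne : C.Nonempty) {k : ℕ} (hk : 3 ≤ k)
    (hN : (clN G C \ C).ncard ≤ k) : ∃ c : Sym2 V → Fin k, PConn G c (clN G C) := by
  classical
  obtain ⟨x₀, hx₀⟩ := hne
  set N := clN G C \ C with hNdef
  have hpi : ∀ w, ∃ x ∈ C, w ∈ N → G.Adj x w := by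
    intro w
    by_cases hw : w ∈ N
    · obtain ⟨h1 | ⟨x, hx, hxw⟩, h2⟩ := hw
      · exact absurd h1 h2
      · exact ⟨x, hx, fun _ => hxw⟩
    · exact ⟨x₀, hx₀, fun h => absurd h hw⟩
  choose π hπC hπ using hpi
  obtain ⟨g, hg⟩ : ∃ g : V → Fin k, Set.InjOn g N := by
    have : Fintype.card N ≤ Fintype.card (Fin k) := by
      rw [← Nat.card_eq_fintype_card, Fintype.card_fin]; exact hN
    obtain ⟨g⟩ := Function.Embedding.nonempty_of_card_le this
    refine ⟨fun w => if h : w ∈ N then g ⟨w, h⟩ else ⟨0, by omega⟩, ?_⟩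
    intro a ha b hb hab
    simp only [ha, hb, dif_pos] at hab
    simpa using g.injective hab
  -- anchors of the three special colors
  let X : Fin 3 → V := fun i => if h : ∃ w ∈ N, (g w).val = i.val then π h.choose else x₀
  have hXC : ∀ i, X i ∈ C := by
    intro i; simp only [X]; split_ifs
    · exact hπC _
    · exact hx₀
  have hX : ∀ w ∈ N, ∀ i : Fin 3, (g w).val = i.val → X i = π w := by
    intro w hw i hi
    have h : ∃ w ∈ N, (g w).val = i.val := ⟨w, hw, hi⟩
    simp only [X, dif_pos h]
    congr 1
    exact hg h.choose_spec.1 hw (Fin.ext (h.choose_spec.2.trans hi.symm))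
  obtain ⟨b, hb⟩ : ∃ b : Fin 3 → Fin 3, ∀ i j, i ≠ j → PRel G c₀ C (X i) (b i) (X j) (b j) := by
    obtain ⟨a0, a1, a2, h01, h12, h02⟩ := rel_triple hS (hXC 0) (hXC 1) (hXC 2)
    refine ⟨![a0, a1, a2], ?_⟩
    intro i j hij
    fin_cases i <;> fin_cases j
    · exact absurd rfl hij
    · exact h01
    · exact h02
    · exact h01.symm
    · exact absurd rfl hij
    · exact h12
    · exact h02.symm
    · exact h12.symm
    · exact absurd rfl hij
  let ι : Fin 3 → Fin k := Fin.castLE hk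
  have hι : Function.Injective ι := Fin.castLE_injective hk
  let f : V → Fin k := fun w => if h : (g w).val < 3 then ι (b ⟨g w, h⟩) else g w
  have fsmall : ∀ w (h : (g w).val < 3), f w = ι (b ⟨g w, h⟩) := fun w h => by simp only [f, dif_pos h]
  have fbig : ∀ w, ¬ (g w).val < 3 → f w = g w := fun w h => by simp only [f, dif_neg h]
  have ιlt : ∀ i, (ι i).val < 3 := fun i => i.2
  have bigne : ∀ w, ¬ (g w).val < 3 → ∀ i, ι i ≠ f w := by
    intro w h i heq
    rw [fbig w h] at heq
    exact h (heq ▸ ιlt i)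
  have pend : ∀ x ∈ C, ∀ y ∈ C, x ≠ y → ∀ a : Fin k, ∃ Z ⊆ C, ∃ s e, PP G c₀ Z x y s e ∧
      ι e ≠ a := by
    intro x hx y hy hxy a
    obtain ⟨Z₁, Z₂, s₁, e₁, s₂, e₂, h1, h2, p1, p2, h3, h4⟩ := hS x hx y hy hxy
    by_cases h : ι e₁ = a
    · exact ⟨Z₂, h2, s₂, e₂, p2, fun h' => h4 (hι (h.trans h'.symm))⟩
    · exact ⟨Z₁, h1, s₁, e₁, p1, h⟩
  have main : ∀ w₁ ∈ N, ∀ w₂ ∈ N, w₁ ≠ w₂ → (π w₁ = π w₂ ∧ f w₁ ≠ f w₂) ∨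
      ∃ Z ⊆ C, ∃ s e, PP G c₀ Z (π w₁) (π w₂) s e ∧ ι s ≠ f w₁ ∧ ι e ≠ f w₂ := by
    intro w₁ h₁ w₂ h₂ hne
    by_cases s1 : (g w₁).val < 3 <;> by_cases s2 : (g w₂).val < 3
    · have hij : (⟨g w₁, s1⟩ : Fin 3) ≠ ⟨g w₂, s2⟩ := by
        intro h
        exact hne (hg h₁ h₂ (Fin.ext (by simpa using h)))
      have := hb _ _ hij
      rw [hX w₁ h₁ ⟨g w₁, s1⟩ rfl, hX w₂ h₂ ⟨g w₂, s2⟩ rfl] at this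
      rw [fsmall _ s1, fsmall _ s2]
      rcases this with ⟨h, h'⟩ | ⟨Z, hZ, s, e, p, h, h'⟩
      · exact Or.inl ⟨h, fun h => h' (hι h)⟩
      · exact Or.inr ⟨Z, hZ, s, e, p, fun q => h (hι q), fun q => h' (hι q)⟩
    · by_cases hpp : π w₁ = π w₂
      · left
        refine ⟨hpp, ?_⟩
        rw [fsmall _ s1]; exact bigne w₂ s2 _
      · right
        obtain ⟨Z, hZ, s, e, p, h⟩ := pend _ (hπC w₂) _ (hπC w₁) (Ne.symm hpp) (f w₁)
        exact ⟨Z, hZ, e, s, p.symm, h, bigne w₂ s2 _⟩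
    · by_cases hpp : π w₁ = π w₂
      · left
        refine ⟨hpp, ?_⟩
        rw [fsmall _ s2]; exact (bigne w₁ s1 _).symm
      · right
        obtain ⟨Z, hZ, s, e, p, h⟩ := pend _ (hπC w₁) _ (hπC w₂) hpp (f w₂)
        exact ⟨Z, hZ, s, e, p, bigne w₁ s1 _, h⟩
    · by_cases hpp : π w₁ = π w₂
      · left
        refine ⟨hpp, ?_⟩
        rw [fbig _ s1, fbig _ s2]
        exact fun h => hne (hg h₁ h₂ h)
      · right
        obtain ⟨Z, hZ, s, e, p, h⟩ := pend _ (hπC w₁) _ (hπC w₂) hpp (f w₂)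
        exact ⟨Z, hZ, s, e, p, bigne w₁ s1 _, h⟩
  let c : Sym2 V → Fin k := fun e => if h : ∃ w ∈ e, w ∉ C then f h.choose else ι (c₀ e)
  have cin : ∀ a ∈ C, ∀ b ∈ C, c s(a, b) = ι (c₀ s(a, b)) := by
    intro a ha b hb
    have : ¬ ∃ w ∈ s(a, b), w ∉ C := by
      rintro ⟨w, hw, hwC⟩
      simp at hw
      rcases hw with rfl | rfl
      · exact hwC ha
      · exact hwC hb
    simp only [c, dif_neg this]
  have cout : ∀ a ∈ C, ∀ w ∉ C, c s(a, w) = f w := by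
    intro a ha w hw
    have h : ∃ w' ∈ s(a, w), w' ∉ C := ⟨w, by simp, hw⟩
    simp only [c, dif_pos h]
    congr 1
    have h1 := h.choose_spec.1
    have h2 := h.choose_spec.2
    rcases Sym2.mem_iff.1 h1 with h3 | h3
    · rw [h3] at h2; exact absurd ha h2
    · exact h3
  have lift : ∀ Z ⊆ C, ∀ u v s e, PP G c₀ Z u v s e → PP G c Z u v (ι s) (ι e) := by
    intro Z hZ u v s e p
    exact (p.map ι hι).congr fun a ha b hb _ => cin a (hZ ha) b (hZ hb)
  have hCA : C ⊆ clN G C := fun t ht => Or.inl ht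
  have caseCN : ∀ u ∈ C, ∀ w ∈ N, ∃ Z ⊆ clN G C, ∃ s e, PP G c Z u w s e := by
    intro u hu w hw
    by_cases huw : u = π w
    · refine ⟨{u, w}, ?_, _, _, PP.edge (huw ▸ hπ w hw)⟩
      rintro t (rfl | rfl)
      · exact hCA hu
      · exact hw.1
    · obtain ⟨Z, hZ, s, e, p, he⟩ := pend u hu _ (hπC w) huw (f w)
      refine ⟨insert w Z, Set.insert_subset hw.1 (hZ.trans hCA), _, _,
        (lift Z hZ _ _ _ _ p).snoc' (hπ w hw) (fun h => hw.2 (hZ h)) (cout _ (hπC w) _ hw.2) he⟩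
  refine ⟨c, ?_⟩
  intro u hu v hv huv
  by_cases huC : u ∈ C <;> by_cases hvC : v ∈ C
  · obtain ⟨Z, -, s₁, e₁, -, -, hZ, -, hp, -⟩ := hS u huC v hvC huv
    exact ⟨Z, hZ.trans hCA, _, _, lift Z hZ _ _ _ _ hp⟩
  · exact caseCN u huC v ⟨hv, hvC⟩
  · obtain ⟨Z, hZ, s, e, p⟩ := caseCN v hvC u ⟨hu, huC⟩
    exact ⟨Z, hZ, _, _, p.symm⟩
  · have huN : u ∈ N := ⟨hu, huC⟩
    have hvN : v ∈ N := ⟨hv, hvC⟩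
    have e1 : PP G c {u, π u} u (π u) (f u) (f u) :=
      PP.edge' (hπ u huN).symm (by rw [Sym2.eq_swap]; exact cout _ (hπC u) _ huC)
    have s1 : ({u, π u} : Set V) ⊆ clN G C := by
      rintro t (rfl | rfl)
      · exact hu
      · exact hCA (hπC _)
    rcases main u huN v hvN huv with ⟨h1, h2⟩ | ⟨Z, hZ, s, e, p, h1, h2⟩
    · refine ⟨insert v {u, π u}, Set.insert_subset hv s1, _, _,
        e1.snoc' (e' := f v) (h1 ▸ hπ v hvN) ?_ (cout _ (hπC u) _ hvC) h2⟩
      simp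
      exact ⟨huv.symm, fun h => hvC (h ▸ hπC u)⟩
    · have q := e1.append (lift Z hZ _ _ _ _ p) h1.symm (by
        rintro t (rfl | rfl) ht
        · exact absurd (hZ ht) huC
        · rfl)
      refine ⟨insert v ({u, π u} ∪ Z), Set.insert_subset hv (Set.union_subset s1 (hZ.trans hCA)),
        _, _, q.snoc' (hπ v hvN) ?_ (cout _ (hπC v) _ hvC) h2⟩
      rintro ((h | h) | h)
      · exact huv h.symm
      · exact hvC (h ▸ hπC u)
      · exact hvC (hZ h)

theorem side {V : Type*} {G : SimpleGraph V} {T : Set V} (hT : ConnOn G T) {x w : V} (hx : x ∈ T)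
    (hw : w ∉ T) : ∀ y ∈ clN G T, y = w ∨ (G.deleteEdges {s(x, w)}).Reachable x y := by
  rintro y (hy | ⟨t, ht, hty⟩)
  · exact Or.inr (hT x hx y hy _ ⟨w, by simp, hw⟩)
  · by_cases hyw : y = w
    · exact Or.inl hyw
    · right
      refine (hT x hx t ht _ ⟨w, by simp, hw⟩).trans (SimpleGraph.Adj.reachable ?_)
      rw [SimpleGraph.deleteEdges_adj]
      refine ⟨hty, ?_⟩
      intro h
      have h' : w ∈ s(t, y) := by rw [show s(t, y) = s(x, w) from h]; simp
      simp at h'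
      rcases h' with rfl | rfl
      · exact hw ht
      · exact hyw rfl

theorem PP.reach_of_ne {V K : Type*} {G : SimpleGraph V} {c : Sym2 V → K} {Z : Set V} {x w : V}
    {s e : K} (hp : PP G c Z x w s e) (hs : s ≠ c s(x, w)) :
    (G.deleteEdges {s(x, w)}).Reachable x w := by
  cases hp with
  | edge h => exact absurd rfl hs
  | cons h hp hu hc =>
    rename_i Z v s'
    refine (SimpleGraph.Adj.reachable ?_).trans (hp.reach _ ⟨x, by simp, hu⟩)
    rw [SimpleGraph.deleteEdges_adj]
    refine ⟨h, fun heq => hs ?_⟩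
    rw [show s(x, v) = s(x, w) from heq]

theorem leaf_aux {V : Type*} {G : SimpleGraph V} {T : Set V} (hT : ConnOn G T) {x w : V}
    (hx : x ∈ T) (hw : w ∉ T) (hbr : ¬ (G.deleteEdges {s(x, w)}).Reachable x w) :
    ∀ t ∈ clN G T, G.Adj t w → t = x := by
  intro t ht htw
  by_contra hne
  rcases side hT hx hw t ht with rfl | h
  · exact htw.ne rfl
  · refine hbr (h.trans (SimpleGraph.Adj.reachable ?_))
    rw [SimpleGraph.deleteEdges_adj]
    refine ⟨htw, fun heq => ?_⟩
    have h' : t ∈ s(x, w) := by rw [← show s(t, w) = s(x, w) from heq]; simp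
    simp at h'
    rcases h' with rfl | rfl
    · exact hne rfl
    · exact htw.ne rfl

theorem exists_coloring {V : Type*} [Fintype V] [DecidableEq V] {G : SimpleGraph V}
    (hconn : G.Connected) {k : ℕ} (hk : 3 ≤ k)
    (H : ∀ C : Set V, C.Nonempty → ConnOn G C → BridgeBd G C → (clN G C \ C).ncard ≤ k) :
    ∃ c : Sym2 V → Fin k, PConn G c Set.univ := by
  classical
  let F : Set (Set V) := {T | T.Nonempty ∧ ConnOn G T ∧ BridgeBd G T ∧
    ∃ c : Sym2 V → Fin k, PConn G c (clN G T)}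
  have good : ∀ w, ∃ C ∈ F, w ∈ C ∧ ∃ c : Sym2 V → Fin 3, StrongOn G c C := by
    intro w
    obtain ⟨C, hw, hb, c, hc⟩ := exists_good G w
    exact ⟨C, ⟨⟨w, hw⟩, hc.connOn, hb, star hc ⟨w, hw⟩ hk (H C ⟨w, hw⟩ hc.connOn hb)⟩, hw, c, hc⟩
  obtain ⟨v₀⟩ := hconn.nonempty
  have hne : F.Nonempty := by
    obtain ⟨C, hC, -⟩ := good v₀; exact ⟨C, hC⟩
  obtain ⟨T, hTF, hmax⟩ := (Set.toFinite F).exists_maximal hne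
  obtain ⟨⟨t, ht⟩, hTc, hTb, c, hc⟩ := hTF
  have hTuniv : ∀ v, v ∈ T := by
    by_contra hcon
    push Not at hcon
    obtain ⟨v, hv⟩ := hcon
    obtain ⟨p⟩ := hconn.preconnected v t
    obtain ⟨w, x, hw, hx, hwx, -⟩ := exit_walk p hv ht
    have hxw := hwx.symm
    have hbr := hTb x hx w hw hxw
    obtain ⟨C, ⟨-, hCc, hCb, c₂, hc₂⟩, hwC, c₃, hc₃⟩ := good w
    have hxC : x ∉ C := by
      intro hxC
      obtain ⟨Z₁, Z₂, s₁, e₁, s₂, e₂, h1, h2, p1, p2, h3, h4⟩ := hc₃ x hxC w hwC hxw.ne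
      by_cases h : s₁ = c₃ s(x, w)
      · exact hbr (p2.reach_of_ne (h ▸ h3.symm))
      · exact hbr (p1.reach_of_ne h)
    have hbr' : ¬ (G.deleteEdges {s(w, x)}).Reachable w x := by
      rw [Sym2.eq_swap]; exact fun h => hbr h.symm
    have hx1 : x ∈ clN G T := Or.inl hx
    have hw1 : w ∈ clN G T := Or.inr ⟨x, hx, hxw⟩
    have hx2 : x ∈ clN G C := Or.inr ⟨w, hwC, hwx⟩
    have hw2 : w ∈ clN G C := Or.inl hwC
    have hint : ∀ t ∈ clN G T, t ∈ clN G C → t = x ∨ t = w := by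
      intro t ht ht'
      rcases side hTc hx hw t ht with h | h
      · exact Or.inr h
      rcases side hCc hwC hxC t ht' with h' | h'
      · exact Or.inl h'
      rw [Sym2.eq_swap] at h'
      exact absurd (h.trans h'.symm) hbr
    let σ := Equiv.swap (c₂ s(x, w)) (c s(x, w))
    let d : Sym2 V → Fin k := fun e => if ∀ z ∈ e, z ∈ clN G T then c e else σ (c₂ e)
    have hd1 : PConn G d (clN G T) := by
      intro u hu v hv huv
      obtain ⟨Z, hZ, s, e, p⟩ := hc u hu v hv huv
      refine ⟨Z, hZ, s, e, p.congr ?_⟩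
      intro a ha b hb _
      have : ∀ z ∈ s(a, b), z ∈ clN G T := by
        intro z hz
        simp at hz
        rcases hz with rfl | rfl
        · exact hZ ha
        · exact hZ hb
      simp only [d, if_pos this]
    have hd2 : PConn G d (clN G C) := by
      intro u hu v hv huv
      obtain ⟨Z, hZ, s, e, p⟩ := hc₂ u hu v hv huv
      refine ⟨Z, hZ, σ s, σ e, (p.map σ σ.injective).congr ?_⟩
      intro a ha b hb hab
      by_cases h : ∀ z ∈ s(a, b), z ∈ clN G T
      · simp only [d, if_pos h]
        have h1 := hint a (h a (by simp)) (hZ ha)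
        have h2 := hint b (h b (by simp)) (hZ hb)
        have : s(a, b) = s(x, w) := by
          rcases h1 with rfl | rfl <;> rcases h2 with rfl | rfl
          · exact absurd rfl hab.ne
          · rfl
          · exact Sym2.eq_swap
          · exact absurd rfl hab.ne
        rw [this]; simp [σ]
      · simp only [d, if_neg h]
    have hg := glue hd1 hd2 hx1 hw1 hx2 hw2 hint (leaf_aux hTc hx hw hbr)
      (fun t ht hxt => leaf_aux hCc hwC hxC hbr' t ht hxt.symm)
    have hU : clN G (T ∪ C) = clN G T ∪ clN G C := by
      ext t; simp only [clN, Set.mem_union, Set.mem_ofPred_eq]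
      constructor
      · rintro ((h | h) | ⟨x, h | h, h'⟩)
        · exact Or.inl (Or.inl h)
        · exact Or.inr (Or.inl h)
        · exact Or.inl (Or.inr ⟨x, h, h'⟩)
        · exact Or.inr (Or.inr ⟨x, h, h'⟩)
      · rintro ((h | ⟨x, h, h'⟩) | (h | ⟨x, h, h'⟩))
        · exact Or.inl (Or.inl h)
        · exact Or.inr ⟨x, Or.inl h, h'⟩
        · exact Or.inl (Or.inr h)
        · exact Or.inr ⟨x, Or.inr h, h'⟩
    have hTC : T ∪ C ∈ F := by
      refine ⟨⟨t, Or.inl ht⟩, ?_, ?_, d, hU ▸ hg⟩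
      · rintro u hu v hv f ⟨z, hz, hzn⟩
        have hzT : z ∉ T := fun h => hzn (Or.inl h)
        have hzC : z ∉ C := fun h => hzn (Or.inr h)
        have toX : ∀ u ∈ T ∪ C, (G.deleteEdges {f}).Reachable u x := by
          rintro u (hu | hu)
          · exact hTc u hu x hx f ⟨z, hz, hzT⟩
          · refine (hCc u hu w hwC f ⟨z, hz, hzC⟩).trans (SimpleGraph.Adj.reachable ?_)
            rw [SimpleGraph.deleteEdges_adj]
            refine ⟨hwx, ?_⟩
            rintro rfl
            simp at hz
            rcases hz with rfl | rfl
            · exact hzC hwC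
            · exact hzT hx
        exact (toX u hu).trans (toX v hv).symm
      · rintro a (ha | ha) b hb hab
        · exact hTb a ha b (fun h => hb (Or.inl h)) hab
        · exact hCb a ha b (fun h => hb (Or.inr h)) hab
    exact hw (hmax hTC Set.subset_union_left (Or.inr hwC))
  have : clN G T = Set.univ := by ext t; simp [clN, hTuniv]
  exact ⟨c, this ▸ hc⟩


theorem branches {V : Type*} [Fintype V] [DecidableEq V] (G : SimpleGraph V)
    [DecidableRel G.Adj] {δ : ℕ} (hδ2 : 2 ≤ δ) (hdeg : ∀ v, δ ≤ G.degree v) {C : Set V}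
    (hCc : ConnOn G C) (hCb : BridgeBd G C) :
    ∃ B : V → Set V, ∀ w ∈ clN G C \ C, w ∈ B w ∧ (∀ w' ∈ clN G C \ C, ∀ v ∈ B w, v ∈ B w' → w = w') ∧
      (∀ v ∈ B w, v ∉ C) ∧ (∀ z ∈ B w, z ≠ w → ∀ b, G.Adj z b → b ∈ B w) ∧
      (∀ b, G.Adj w b → b ∈ B w ∨ b ∈ C) ∧ (∃ x ∈ C, G.Adj x w) ∧ δ + 1 ≤ (B w).ncard := by
  let H := G.deleteEdges {e | ∃ z ∈ e, z ∈ C}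
  have hH : ∀ a b, H.Adj a b ↔ G.Adj a b ∧ a ∉ C ∧ b ∉ C := by
    intro a b
    simp only [H, SimpleGraph.deleteEdges_adj]
    simp
  have hHe : ∀ x ∈ C, ∀ w, H ≤ G.deleteEdges {s(x, w)} := by
    intro x hx w a b hab
    rw [hH] at hab
    rw [SimpleGraph.deleteEdges_adj]
    refine ⟨hab.1, fun h => ?_⟩
    have h' : x ∈ s(a, b) := by rw [show s(a, b) = s(x, w) from h]; simp
    simp at h'
    rcases h' with rfl | rfl
    · exact hab.2.1 hx
    · exact hab.2.2 hx
  have hout : ∀ w v, H.Reachable w v → w ∉ C → v ∉ C := by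
    rintro w v ⟨p⟩ hw
    induction p with
    | nil => exact hw
    | cons h p ih => exact ih ((hH _ _).1 h).2.2
  have K : ∀ w₁ ∉ C, ∀ w₂ ∉ C, ∀ x₁ ∈ C, ∀ x₂ ∈ C, G.Adj x₁ w₁ → G.Adj x₂ w₂ → H.Reachable w₁ w₂ →
      w₁ = w₂ ∧ x₁ = x₂ := by
    intro w₁ h₁ w₂ h₂ x₁ hx₁ x₂ hx₂ a₁ a₂ hr
    by_contra hcon
    refine hCb x₁ hx₁ w₁ h₁ a₁ ?_
    refine ((hCc x₁ hx₁ x₂ hx₂ _ ⟨w₁, by simp, h₁⟩).trans (SimpleGraph.Adj.reachable ?_)).trans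
      (hr.mono (hHe x₁ hx₁ w₁)).symm
    rw [SimpleGraph.deleteEdges_adj]
    refine ⟨a₂, fun h => hcon ?_⟩
    have h' : s(x₂, w₂) = s(x₁, w₁) := h
    rw [Sym2.eq_iff] at h'
    rcases h' with ⟨h, h'⟩ | ⟨h, h'⟩
    · exact ⟨h'.symm, h.symm⟩
    · exact absurd hx₂ (h ▸ h₁)
  refine ⟨fun w => {v | H.Reachable w v}, ?_⟩
  rintro w ⟨hwN, hwC⟩
  have hx : ∃ x ∈ C, G.Adj x w := hwN.resolve_left hwC
  obtain ⟨x, hxC, hxw⟩ := hx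
  have hclosed : ∀ z, H.Reachable w z → z ≠ w → ∀ b, G.Adj z b → H.Reachable w b := by
    intro z hz hzw b hzb
    have hzC := hout _ _ hz hwC
    have hbC : b ∉ C := fun hb => hzw (K w hwC z hzC x hxC b hb hxw hzb.symm hz).1.symm
    exact hz.trans (SimpleGraph.Adj.reachable ((hH _ _).2 ⟨hzb, hzC, hbC⟩))
  have hwn : ∀ b, G.Adj w b → H.Reachable w b ∨ b ∈ C := by
    intro b hb
    by_cases hbC : b ∈ C
    · exact Or.inr hbC
    · exact Or.inl (SimpleGraph.Adj.reachable ((hH _ _).2 ⟨hb, hwC, hbC⟩))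
  refine ⟨SimpleGraph.Reachable.refl _, ?_, fun v hv => hout _ _ hv hwC, hclosed, hwn,
    ⟨x, hxC, hxw⟩, ?_⟩
  · rintro w' ⟨hwN', hwC'⟩ v hv hv'
    obtain ⟨x', hxC', hxw'⟩ : ∃ x ∈ C, G.Adj x w' := hwN'.resolve_left hwC'
    exact (K w hwC w' hwC' x hxC x' hxC' hxw hxw' (SimpleGraph.Reachable.trans hv (SimpleGraph.Reachable.symm hv'))).1
  · have h2 : 1 < (G.neighborFinset w).card := by
      rw [SimpleGraph.card_neighborFinset_eq_degree]; have := hdeg w; omega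
    obtain ⟨a, ha, b, hb, hab⟩ := Finset.one_lt_card.1 h2
    rw [SimpleGraph.mem_neighborFinset] at ha hb
    have : ∃ z, G.Adj w z ∧ z ∉ C := by
      by_contra hcon
      push Not at hcon
      exact hab (K w hwC w hwC a (hcon a ha) b (hcon b hb) ha.symm hb.symm
        (SimpleGraph.Reachable.refl _)).2
    obtain ⟨z, hwz, hzC⟩ := this
    have hz := (hwn z hwz).resolve_right hzC
    have hsub : (↑(insert z (G.neighborFinset z)) : Set V) ⊆ {v | H.Reachable w v} := by
      intro t ht
      simp at ht
      rcases ht with rfl | ht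
      · exact hz
      · exact hclosed z hz hwz.ne' t ht
    have := Set.ncard_le_ncard hsub (Set.toFinite _)
    rw [Set.ncard_coe_finset, Finset.card_insert_of_notMem (by simp),
      SimpleGraph.card_neighborFinset_eq_degree] at this
    have := hdeg z
    show δ + 1 ≤ ({v | H.Reachable w v} : Set V).ncard
    omega

theorem enum_set {V : Type*} [Fintype V] [DecidableEq V] {B : Set V} {w : V} {δ : ℕ} (hw : w ∈ B)
    (hB : δ + 1 ≤ B.ncard) : ∃ e : Fin (δ + 1) → V, Function.Injective e ∧ (∀ j, e j ∈ B) ∧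
      e 0 = w := by
  classical
  have : Fintype.card (Fin (δ + 1)) ≤ Fintype.card B := by
    rw [← Nat.card_eq_fintype_card (α := B), Fintype.card_fin]; exact hB
  obtain ⟨g⟩ := Function.Embedding.nonempty_of_card_le this
  let σ := Equiv.swap (g 0) ⟨w, hw⟩
  refine ⟨fun j => (σ (g j)).1, ?_, fun j => (σ (g j)).2, ?_⟩
  · intro a b h
    exact g.injective (σ.injective (Subtype.ext h))
  · simp [σ]

theorem srt_adj_none {r t : ℕ} (i : Fin r) (j : Fin t) :
    (Srt r t).Adj none (some (i, j)) ↔ j.val = 0 := by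
  simp only [Srt, SimpleGraph.fromRel_adj]
  constructor
  · rintro ⟨-, (⟨_, _, _, h, _⟩ | ⟨i', h, _, h'⟩) | (⟨_, _, _, _, h, _⟩ | ⟨_, _, h, _⟩)⟩
    · simp at h
    · simp at h'; simp [h']
    · simp at h
    · simp at h
  · intro h
    refine ⟨by simp, Or.inl (Or.inr ⟨i, by omega, trivial, ?_⟩)⟩
    simp only [Option.some.injEq, Prod.mk.injEq, true_and]
    exact Fin.ext h

theorem srt_adj_some {r t : ℕ} (i i' : Fin r) (j j' : Fin t) :
    (Srt r t).Adj (some (i, j)) (some (i', j')) ↔ i = i' ∧ j ≠ j' := by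
  simp only [Srt, SimpleGraph.fromRel_adj]
  constructor
  · rintro ⟨-, (⟨_, _, _, h, h', h''⟩ | ⟨_, _, h, _⟩) | (⟨_, _, _, h, h', h''⟩ | ⟨_, _, h, _⟩)⟩
    · simp at h h'; grind
    · simp at h
    · simp at h h'; grind
    · simp at h
  · rintro ⟨rfl, h⟩
    exact ⟨by simpa using h, Or.inl (Or.inl ⟨i, j, j', rfl, rfl, h⟩)⟩

theorem embed {V : Type*} [Fintype V] [DecidableEq V] (G : SimpleGraph V)
    [DecidableRel G.Adj] {δ : ℕ} (hδ2 : 2 ≤ δ) (hdeg : ∀ v, δ ≤ G.degree v) {C : Set V}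
    (hne : C.Nonempty) (hCc : ConnOn G C) (hCb : BridgeBd G C) {m : ℕ}
    (hm : m ≤ (clN G C \ C).ncard) :
    m * (δ + 1) + 1 ≤ Fintype.card V ∧
      (m * (δ + 1) + 1 = Fintype.card V → Nonempty (G ≃g Srt m (δ + 1))) := by
  classical
  obtain ⟨x, hx⟩ := hne
  obtain ⟨B, hB⟩ := branches G hδ2 hdeg hCc hCb
  have hW : ∃ W : Fin m → V, Function.Injective W ∧ ∀ i, W i ∈ clN G C \ C := by
    have : Fintype.card (Fin m) ≤ Fintype.card ↑(clN G C \ C) := by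
      rw [← Nat.card_eq_fintype_card (α := ↑(clN G C \ C)), Fintype.card_fin]; exact hm
    obtain ⟨g⟩ := Function.Embedding.nonempty_of_card_le this
    exact ⟨fun i => (g i).1, fun a b h => g.injective (Subtype.ext h), fun i => (g i).2⟩
  obtain ⟨W, hWi, hWN⟩ := hW
  have hBd : ∀ i i' v, v ∈ B (W i) → v ∈ B (W i') → i = i' := fun i i' v h h' =>
    hWi ((hB _ (hWN i)).2.1 _ (hWN i') v h h')
  have hBC : ∀ i, ∀ v ∈ B (W i), v ∉ C := fun i => (hB _ (hWN i)).2.2.1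
  have he : ∀ i, ∃ e : Fin (δ + 1) → V, Function.Injective e ∧ (∀ j, e j ∈ B (W i)) ∧
      e 0 = W i := fun i => enum_set (hB _ (hWN i)).1 (hB _ (hWN i)).2.2.2.2.2.2
  choose e hei heB he0 using he
  let φ : Option (Fin m × Fin (δ + 1)) → V := fun o => o.elim x (fun p => e p.1 p.2)
  have hφi : Function.Injective φ := by
    rintro (_ | ⟨i, j⟩) (_ | ⟨i', j'⟩) h
    · rfl
    · exact absurd (show e i' j' ∈ C from (show x = e i' j' from h) ▸ hx) (hBC _ _ (heB _ _))
    · exact absurd (show e i j ∈ C from (show e i j = x from h) ▸ hx) (hBC _ _ (heB _ _))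
    · have h' : e i j = e i' j' := h
      have hi := hBd i i' _ (heB i j) (h' ▸ heB i' j')
      subst hi
      rw [hei i h']
  have hcard : Fintype.card (Option (Fin m × Fin (δ + 1))) = m * (δ + 1) + 1 := by simp
  refine ⟨hcard ▸ Fintype.card_le_of_injective φ hφi, fun heq => ?_⟩
  have hbij : Function.Bijective φ :=
    (Fintype.bijective_iff_injective_and_card φ).2 ⟨hφi, hcard.trans heq⟩
  have hCx : ∀ y ∈ C, y = x := by
    intro y hy
    obtain ⟨_ | ⟨i, j⟩, h⟩ := hbij.2 y
    · exact h.symm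
    · exact absurd hy (hBC i y (h ▸ heB i j))
  have hBe : ∀ i, ∀ v ∈ B (W i), ∃ j, e i j = v := by
    intro i v hv
    obtain ⟨_ | ⟨i', j⟩, h⟩ := hbij.2 v
    · exact absurd ((show x = v from h) ▸ hx) (hBC i v hv)
    · have h' : e i' j = v := h
      have hi := hBd i' i v (h' ▸ heB i' j) hv
      subst hi
      exact ⟨j, h'⟩
  have hBset : ∀ i, B (W i) = ↑(Finset.univ.image (e i)) := by
    intro i; ext v
    simp
    constructor
    · exact hBe i v
    · rintro ⟨j, rfl⟩; exact heB i j
  have hfull : ∀ i j, e i j ≠ W i → ∀ j', j ≠ j' → G.Adj (e i j) (e i j') := by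
    intro i j hne j' hjj
    have hsub : G.neighborFinset (e i j) ⊆ (Finset.univ.image (e i)).erase (e i j) := by
      intro b hb
      rw [SimpleGraph.mem_neighborFinset] at hb
      have := (hB _ (hWN i)).2.2.2.1 _ (heB i j) hne b hb
      rw [hBset] at this
      exact Finset.mem_erase.2 ⟨hb.ne', by simpa using this⟩
    have hc : ((Finset.univ.image (e i)).erase (e i j)).card = δ := by
      rw [Finset.card_erase_of_mem (by simp), Finset.card_image_of_injective _ (hei i)]; simp
    have := Finset.eq_of_subset_of_card_le hsub (by
      rw [hc, SimpleGraph.card_neighborFinset_eq_degree]; exact hdeg _)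
    have h' : e i j' ∈ (Finset.univ.image (e i)).erase (e i j) :=
      Finset.mem_erase.2 ⟨fun h => hjj (hei i h).symm, by simp⟩
    rw [← this] at h'
    simpa using h'
  have hnb : ∀ i j b, G.Adj (e i j) b → b ∈ B (W i) ∨ (b ∈ C ∧ e i j = W i) := by
    intro i j b hb
    by_cases h : e i j = W i
    · rcases (hB _ (hWN i)).2.2.2.2.1 b (h ▸ hb) with h' | h'
      · exact Or.inl h'
      · exact Or.inr ⟨h', h⟩
    · exact Or.inl ((hB _ (hWN i)).2.2.2.1 _ (heB i j) h b hb)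
  have hnone : ∀ i j, G.Adj x (e i j) ↔ j.val = 0 := by
    intro i j
    constructor
    · intro h
      rcases hnb i j x h.symm with h' | ⟨-, h'⟩
      · exact absurd hx (hBC i x h')
      · rw [← he0 i] at h'
        simp [hei i h']
    · intro h
      obtain ⟨x', hx', ha⟩ := (hB _ (hWN i)).2.2.2.2.2.1
      have : j = 0 := Fin.ext h
      rw [this, he0, ← hCx x' hx']; exact ha
  have hsome : ∀ i j i' j', G.Adj (e i j) (e i' j') ↔ i = i' ∧ j ≠ j' := by
    intro i j i' j'
    constructor
    · intro h
      rcases hnb i j _ h with h' | ⟨h', -⟩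
      · have hi := hBd i i' _ h' (heB i' j')
        subst hi
        exact ⟨rfl, fun hj => h.ne (by rw [hj])⟩
      · exact absurd h' (hBC _ _ (heB i' j'))
    · rintro ⟨rfl, hj⟩
      by_cases h : e i j = W i
      · refine (hfull i j' (fun h' => hj (hei i (h.trans h'.symm))) j (Ne.symm hj)).symm
      · exact hfull i j h j' hj
  refine ⟨RelIso.symm ⟨Equiv.ofBijective φ hbij, ?_⟩⟩
  rintro (_ | ⟨i, j⟩) (_ | ⟨i', j'⟩)
  · simp
  · rw [srt_adj_none]; exact hnone i' j'
  · rw [SimpleGraph.adj_comm, SimpleGraph.adj_comm (Srt _ _), srt_adj_none]; exact hnone i j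
  · rw [srt_adj_some]; exact hsome i j i' j'

theorem pc_le {V : Type*} [Fintype V] [DecidableEq V] {G : SimpleGraph V}
    (hconn : G.Connected) {k : ℕ} (hk : 3 ≤ k)
    (H : ∀ C : Set V, C.Nonempty → ConnOn G C → BridgeBd G C → (clN G C \ C).ncard ≤ k) :
    (∃ c : Sym2 V → ℕ, (∀ e ∈ G.edgeSet, c e < k) ∧ IsProperPathColoring G c) ∧ pc G ≤ k := by
  obtain ⟨c, hc⟩ := exists_coloring hconn hk H
  have : ∃ c : Sym2 V → ℕ, (∀ e ∈ G.edgeSet, c e < k) ∧ IsProperPathColoring G c := by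
    refine ⟨fun e => (c e).val, fun e _ => (c e).2, ?_⟩
    intro u v huv
    obtain ⟨Z, -, s, e, p⟩ := hc u trivial v trivial huv
    obtain ⟨q, h1, -, h3, -⟩ := (p.map Fin.val Fin.val_injective).toWalk
    refine ⟨q, h1, ?_⟩
    rw [List.isChain_map] at h3
    exact h3
  exact ⟨this, Nat.sInf_le this⟩

theorem srt_stay {r t : ℕ} {a b : Option (Fin r × Fin t)} (p : (Srt r t).Walk a b) (i : Fin r)
    (h : none ∉ p.support) (j : Fin t) (ha : a = some (i, j)) : ∃ j', b = some (i, j') := by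
  induction p generalizing j with
  | nil => exact ⟨j, ha⟩
  | cons h' p ih =>
    rename_i a b d
    simp at h
    subst ha
    rcases b with _ | ⟨i', j'⟩
    · exact absurd p.start_mem_support h.2
    · rw [srt_adj_some] at h'
      obtain ⟨rfl, -⟩ := h'
      exact ih h.2 j' rfl

theorem srt_stay' {r t : ℕ} (ht : 0 < t) {a b : Option (Fin r × Fin t)} (p : (Srt r t).Walk a b)
    (i : Fin r) (h : some (i, ⟨0, ht⟩) ∉ p.support) (j : Fin t) (ha : a = some (i, j)) :
    ∃ j', b = some (i, j') := by
  induction p generalizing j with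
  | nil => exact ⟨j, ha⟩
  | cons h' p ih =>
    rename_i a b d
    simp at h
    subst ha
    rcases b with _ | ⟨i', j'⟩
    · rw [SimpleGraph.adj_comm, srt_adj_none] at h'
      exact absurd (congrArg (fun z => some (i, z)) (Fin.ext h'.symm)) h.1
    · rw [srt_adj_some] at h'
      obtain ⟨rfl, -⟩ := h'
      exact ih h.2 j' rfl

theorem srt_color_ne {r t : ℕ} (ht : 0 < t) (c : Sym2 (Option (Fin r × Fin t)) → ℕ)
    {i i' : Fin r} (hii : i ≠ i')
    (p : (Srt r t).Walk (some (i, ⟨0, ht⟩)) (some (i', ⟨0, ht⟩))) (hp : p.IsPath)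
    (hc : ProperWalk c p) :
    c s(none, some (i, ⟨0, ht⟩)) ≠ c s(none, some (i', ⟨0, ht⟩)) := by
  cases p with
  | nil => exact absurd rfl hii
  | cons h p =>
    rename_i b
    rw [SimpleGraph.Walk.cons_isPath_iff] at hp
    rcases b with _ | ⟨l, j⟩
    · cases p with
      | cons h2 p =>
        rename_i b
        rw [SimpleGraph.Walk.cons_isPath_iff] at hp
        rcases b with _ | ⟨l, j⟩
        · exact absurd rfl h2.ne
        · have h2' := (srt_adj_none _ _).1 h2
          obtain ⟨j', hj'⟩ := srt_stay p l hp.1.2 j rfl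
          simp at hj'
          obtain ⟨rfl, -⟩ := hj'
          have : j = ⟨0, ht⟩ := Fin.ext h2'
          subst this
          unfold ProperWalk at hc
          simp only [SimpleGraph.Walk.edges_cons] at hc
          have := (List.isChain_cons_cons.1 hc).1
          rwa [Sym2.eq_swap] at this
    · rw [srt_adj_some] at h
      obtain ⟨rfl, -⟩ := h
      obtain ⟨j', hj'⟩ := srt_stay' ht p i hp.2 j rfl
      simp at hj'
      exact absurd hj'.1.symm hii

theorem le_of_srt {V : Type*} {G : SimpleGraph V} {r t k : ℕ} (ht : 0 < t)
    (φ : G ≃g Srt r t) (c : Sym2 V → ℕ) (hck : ∀ e ∈ G.edgeSet, c e < k)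
    (hc : IsProperPathColoring G c) : r ≤ k := by
  let ψ := φ.symm
  let c' : Sym2 (Option (Fin r × Fin t)) → ℕ := fun e => c (e.map ψ)
  have hadj : ∀ i : Fin r, G.Adj (ψ none) (ψ (some (i, ⟨0, ht⟩))) := fun i =>
    ψ.map_rel_iff.2 ((srt_adj_none i ⟨0, ht⟩).2 rfl)
  let f : Fin r → Fin k := fun i => ⟨c' s(none, some (i, ⟨0, ht⟩)), hck _ (hadj i)⟩
  have hf : Function.Injective f := by
    intro i i' h
    by_contra hii
    obtain ⟨p, hp, hpc⟩ := hc (ψ (some (i, ⟨0, ht⟩))) (ψ (some (i', ⟨0, ht⟩)))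
      (fun h => hii (by simpa using ψ.injective h))
    let q := (p.map φ.toHom).copy (φ.apply_symm_apply (some (i, ⟨0, ht⟩)))
      (φ.apply_symm_apply (some (i', ⟨0, ht⟩)))
    have hq : q.IsPath := by
      simp only [q, SimpleGraph.Walk.isPath_copy]
      exact SimpleGraph.Walk.map_isPath_of_injective φ.injective hp
    have hqc : ProperWalk c' q := by
      unfold ProperWalk at hpc ⊢
      simp only [q, SimpleGraph.Walk.edges_copy, SimpleGraph.Walk.edges_map]
      refine (List.isChain_map _).2 (hpc.imp ?_)
      intro a b hab
      have : ∀ e : Sym2 V, c' (Sym2.map φ.toHom e) = c e := by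
        intro e
        induction e using Sym2.ind with
        | _ a b => simp [c', ψ]
      rw [this, this]; exact hab
    exact srt_color_ne ht c' hii q hq hqc (by simpa [f] using h)
  simpa using Fintype.card_le_of_injective f hf


theorem stmt7 {V : Type*} [Fintype V] [DecidableEq V] (G : SimpleGraph V)
    [DecidableRel G.Adj] (hconn : G.Connected) (n δ : ℕ)
    (hn : n = Fintype.card V) (hδ : δ = G.minDegree) (hδ2 : 2 ≤ δ) :
    (pc G : ℝ) ≤ max 3 (((n : ℝ) - 1) / ((δ : ℝ) + 1)) ∧
    (3 < ((n : ℝ) - 1) / ((δ : ℝ) + 1) → δ * (δ + 1) + 1 ≤ n →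
      ((pc G : ℝ) = ((n : ℝ) - 1) / ((δ : ℝ) + 1) ↔
        ∃ r t : ℕ, t - 1 = δ ∧ r * t + 1 = n ∧ Nonempty (G ≃g Srt r t))) := by
  have hdeg : ∀ v, δ ≤ G.degree v := fun v => hδ ▸ G.minDegree_le_degree v
  have : Nonempty V := hconn.nonempty
  have hn1 : 1 ≤ n := by rw [hn]; exact Fintype.card_pos
  have hd0 : (0 : ℝ) < (δ : ℝ) + 1 := by positivity
  have key : ∀ k : ℕ, 3 ≤ k → (n - 1) / (δ + 1) ≤ k →
      (∃ c : Sym2 V → ℕ, (∀ e ∈ G.edgeSet, c e < k) ∧ IsProperPathColoring G c) ∧ pc G ≤ k := by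
    intro k hk hnk
    refine pc_le hconn hk ?_
    intro C hC h1 h2
    by_contra hcon
    have h3 := (embed G hδ2 hdeg hC h1 h2 (m := k + 1) (by omega)).1
    have h4 : k + 1 ≤ (n - 1) / (δ + 1) := by
      rw [Nat.le_div_iff_mul_le (by omega)]
      omega
    omega
  have hfl : (((n - 1) / (δ + 1) : ℕ) : ℝ) ≤ ((n : ℝ) - 1) / ((δ : ℝ) + 1) := by
    rw [le_div_iff₀ hd0]
    have h := Nat.div_mul_le_self (n - 1) (δ + 1)
    have h' : (n - 1) / (δ + 1) * (δ + 1) + 1 ≤ n := by omega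
    have h'' : ((((n - 1) / (δ + 1) * (δ + 1) + 1 : ℕ)) : ℝ) ≤ n := by exact_mod_cast h'
    rw [Nat.cast_add, Nat.cast_mul, Nat.cast_add] at h''
    simp only [Nat.cast_one] at h''
    linarith
  refine ⟨?_, ?_⟩
  · have h := (key (max 3 ((n - 1) / (δ + 1))) (le_max_left _ _) (le_max_right _ _)).2
    rcases le_max_iff.1 h with h | h
    · exact le_max_of_le_left (by exact_mod_cast h)
    · exact le_max_of_le_right (le_trans (by exact_mod_cast h) hfl)
  · intro h3 _
    constructor
    · intro heq
      have hr : 3 < pc G := by rw [← heq] at h3; exact_mod_cast h3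
      have hrn : pc G * (δ + 1) + 1 = n := by
        rw [eq_div_iff hd0.ne'] at heq
        have : (pc G : ℝ) * ((δ : ℝ) + 1) + 1 = n := by linarith
        exact_mod_cast this
      refine ⟨pc G, δ + 1, by omega, hrn, ?_⟩
      by_contra hno
      have h := (pc_le hconn (k := pc G - 1) (by omega) ?_).2
      · omega
      · intro C hC h1 h2
        by_contra hcon
        exact hno ((embed G hδ2 hdeg hC h1 h2 (m := pc G) (by omega)).2 (hrn.trans hn))
    · rintro ⟨r, t, ht, hrt, ⟨φ⟩⟩
      obtain rfl : t = δ + 1 := by omega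
      have hq : ((n : ℝ) - 1) / ((δ : ℝ) + 1) = r := by
        rw [div_eq_iff hd0.ne', ← hrt]
        push_cast
        ring
      have hq' : (n - 1) / (δ + 1) = r := by
        rw [← hrt, Nat.add_sub_cancel, Nat.mul_div_cancel _ (by omega)]
      rw [hq] at h3 ⊢
      have hr3 : 3 < r := by exact_mod_cast h3
      obtain ⟨hex, hle⟩ := key r hr3.le hq'.le
      have hmem := Nat.sInf_mem (s := {k | ∃ c : Sym2 V → ℕ, (∀ e ∈ G.edgeSet, c e < k) ∧
        IsProperPathColoring G c}) ⟨r, hex⟩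
      obtain ⟨c, hc1, hc2⟩ := hmem
      have hge : r ≤ pc G := le_of_srt (by omega) φ c hc1 hc2
      exact_mod_cast le_antisymm hle hge
end

section
/- Let G be a simple noncomplete graph on n ≥ 3 vertices with minimum degree δ(G) ≥ n/2. Then pc(G) = 2. -/
theorem ham_list {V : Type*} [Fintype V] [DecidableEq V] (G : SimpleGraph V)
    [DecidableRel G.Adj] [Nonempty V]
    (hδ : ∀ v, Fintype.card V ≤ 2 * G.degree v) :
    ∃ l : List V, l.Nodup ∧ l.IsChain G.Adj ∧ ∀ v, v ∈ l := by
  classical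
  let P : ℕ → Prop := fun m => ∃ l : List V, l.Nodup ∧ l.IsChain G.Adj ∧ l.length = m
  have hb : ∀ m, P m → m ≤ Fintype.card V := by
    rintro m ⟨l, h1, -, rfl⟩
    exact h1.length_le_card
  have hP1 : P 1 := ⟨[Classical.arbitrary V], by simp, by simp, rfl⟩
  have hm := Nat.findGreatest_spec (hb 1 hP1) hP1
  have hmax : ∀ k, P k → k ≤ Nat.findGreatest P (Fintype.card V) := fun k hk =>
    Nat.le_findGreatest (hb k hk) hk
  have h1m := hmax 1 hP1
  obtain ⟨l, hnd, hch, hl⟩ := hm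
  rw [← hl] at hmax h1m
  refine ⟨l, hnd, hch, ?_⟩
  by_contra! hw
  obtain ⟨w, hw⟩ := hw
  obtain ⟨v0, t, rfl⟩ : ∃ v0 t, l = v0 :: t := by
    cases l with
    | nil => simp at h1m
    | cons a t => exact ⟨a, t, rfl⟩
  have key : ∀ x, G.Adj v0 x → ∃ y, ∃ i, (v0 :: t)[i]? = some y ∧ (v0 :: t)[i+1]? = some x ∧
      ¬ G.Adj w y := by
    intro x hx
    have hxt : x ∈ v0 :: t := by
      by_contra hxl
      have := hmax ((v0 :: t).length + 1) ⟨x :: v0 :: t, by simp_all, by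
        simp only [List.isChain_cons_cons]
        exact ⟨hx.symm, hch⟩, by simp⟩
      omega
    have hxt : x ∈ t := by
      rcases List.mem_cons.1 hxt with h | h
      · exact absurd h.symm hx.ne
      · exact h
    obtain ⟨a, b, rfl⟩ := List.append_of_mem hxt
    refine ⟨(v0 :: a).getLast (by simp), a.length, ?_, ?_, ?_⟩
    · rw [← List.cons_append, List.getElem?_append_left (by simp), List.getLast_eq_getElem]
      simp
    · simp
    · intro hadj
      have := hmax ((v0 :: (a ++ x :: b)).length + 1)
        ⟨w :: ((v0 :: a).reverse ++ x :: b), ?_, ?_, ?_⟩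
      · omega
      · rw [List.nodup_cons]
        constructor
        · intro h; apply hw
          simp only [List.mem_append, List.mem_reverse, List.mem_cons] at h ⊢
          tauto
        · have hp : ((v0 :: a).reverse ++ x :: b).Perm (v0 :: (a ++ x :: b)) :=
            (List.reverse_perm (v0 :: a)).append_right _
          exact hp.nodup_iff.2 hnd
      · rw [← List.cons_append, List.isChain_append] at hch
        rw [List.isChain_cons, List.isChain_append]
        refine ⟨?_, ?_, hch.2.1, ?_⟩
        · intro y hy
          rw [List.head?_append_of_ne_nil _ (by simp), List.head?_reverse,
            List.getLast?_eq_some_getLast (by simp)] at hy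
          simp only [Option.mem_def, Option.some.injEq] at hy
          exact hy ▸ hadj
        · rw [List.isChain_reverse]
          exact hch.1.imp fun _ _ h => h.symm
        · intro y hy z hz
          simp at hy hz
          subst hy; subst hz; exact hx
      · simp; omega
  choose! φ hφ using key
  have hinj : Set.InjOn φ (G.neighborFinset v0 : Set V) := by
    intro x hx x' hx' h
    simp only [SimpleGraph.coe_neighborFinset, SimpleGraph.mem_neighborSet] at hx hx'
    obtain ⟨i, h1, h2, -⟩ := hφ x hx
    obtain ⟨j, h3, h4, -⟩ := hφ x' hx'
    have hi : i < (v0 :: t).length := (List.getElem?_eq_some_iff.1 h1).1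
    have : i = j := (List.getElem?_inj hi hnd).1 (by rw [h1, h3, h])
    subst this
    rw [h2] at h4
    exact Option.some.inj h4
  have hdisj : Disjoint (G.neighborFinset w) ((G.neighborFinset v0).image φ) := by
    rw [Finset.disjoint_left]
    intro y hy hy'
    simp only [Finset.mem_image, SimpleGraph.mem_neighborFinset] at hy hy'
    obtain ⟨x, hx, rfl⟩ := hy'
    obtain ⟨i, -, -, h⟩ := hφ x hx
    exact h hy
  have hsub : G.neighborFinset w ∪ (G.neighborFinset v0).image φ ⊆ Finset.univ.erase w := by
    intro y hy
    simp only [Finset.mem_union, Finset.mem_image, SimpleGraph.mem_neighborFinset,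
      Finset.mem_erase, Finset.mem_univ, and_true] at hy ⊢
    rcases hy with hy | ⟨x, hx, rfl⟩
    · exact hy.ne'
    · obtain ⟨i, h, -, -⟩ := hφ x hx
      intro he
      rw [he] at h
      exact hw (List.mem_of_getElem? h)
  have hc := Finset.card_le_card hsub
  rw [Finset.card_union_of_disjoint hdisj, Finset.card_image_of_injOn hinj,
    Finset.card_erase_of_mem (Finset.mem_univ _), Finset.card_univ,
    SimpleGraph.card_neighborFinset_eq_degree, SimpleGraph.card_neighborFinset_eq_degree] at hc
  have := hδ w
  have := hδ v0
  have : 0 < Fintype.card V := Fintype.card_pos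
  omega

theorem seg_walk {V : Type*} (G : SimpleGraph V) (n : ℕ) (f : ℕ → V) (g : V → ℕ)
    (hgf : ∀ i < n, g (f i) = i) (hadj : ∀ i, i + 1 < n → G.Adj (f i) (f (i+1)))
    (c : Sym2 V → ℕ) (hc : ∀ x y, c s(x, y) = min (g x) (g y) % 2) (d : ℕ) :
    ∀ i, i + d < n → ∃ p : G.Walk (f i) (f (i + d)), p.IsPath ∧ ProperWalk c p ∧
      (∀ x ∈ p.support, i ≤ g x) ∧ ∀ e ∈ p.edges.head?, c e = i % 2 := by
  induction d with
  | zero =>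
    intro i hi
    refine ⟨SimpleGraph.Walk.nil, by simp, List.IsChain.nil, ?_, by simp⟩
    simp [hgf i hi]
  | succ d ih =>
    intro i hi
    have ih' := ih (i + 1) (by omega)
    rw [show i + 1 + d = i + (d + 1) by omega] at ih'
    obtain ⟨p, h1, h2, h3, h4⟩ := ih'
    have hci : c s(f i, f (i+1)) = i % 2 := by
      rw [hc, hgf i (by omega), hgf (i+1) (by omega)]; simp
    refine ⟨SimpleGraph.Walk.cons (hadj i (by omega)) p, ?_, ?_, ?_, ?_⟩
    · rw [SimpleGraph.Walk.cons_isPath_iff]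
      refine ⟨h1, fun h => ?_⟩
      have := h3 _ h
      rw [hgf i (by omega)] at this
      omega
    · unfold ProperWalk at h2 ⊢
      rw [SimpleGraph.Walk.edges_cons]
      refine List.isChain_cons.2 ⟨?_, h2⟩
      intro e he
      rw [hci, h4 e he]; omega
    · intro x hx
      rw [SimpleGraph.Walk.support_cons, List.mem_cons] at hx
      rcases hx with rfl | hx
      · rw [hgf i (by omega)]
      · have := h3 x hx; omega
    · simp [hci]

theorem stmt8 {V : Type*} [Fintype V] [DecidableEq V] (G : SimpleGraph V)
    [DecidableRel G.Adj] [Nonempty V]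
    (hn : 3 ≤ Fintype.card V) (hnoncomplete : G ≠ ⊤)
    (hδ : (Fintype.card V : ℝ) / 2 ≤ (G.minDegree : ℝ)) :
    pc G = 2 := by
  have hd : ∀ v, Fintype.card V ≤ 2 * G.degree v := by
    intro v
    have h1 := G.minDegree_le_degree v
    have h2 : (Fintype.card V : ℝ) ≤ ((2 * G.minDegree : ℕ) : ℝ) := by push_cast; linarith
    have h3 : Fintype.card V ≤ 2 * G.minDegree := by exact_mod_cast h2
    omega
  have hmem : 2 ∈ {k | ∃ c : Sym2 V → ℕ, (∀ e ∈ G.edgeSet, c e < k) ∧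
      IsProperPathColoring G c} := by
    obtain ⟨l, hnd, hch, hall⟩ := ham_list G hd
    let f : ℕ → V := fun i => l.getD i (Classical.arbitrary V)
    let g : V → ℕ := fun v => l.idxOf v
    have hf : ∀ i (h : i < l.length), f i = l[i] := fun i h => by simp [f, h]
    have hg : ∀ v, g v < l.length := fun v => List.idxOf_lt_length_of_mem (hall v)
    have hfg : ∀ v, f (g v) = v := fun v => by rw [hf _ (hg v)]; simp [g]
    have hgf : ∀ i < l.length, g (f i) = i := fun i h => by
      rw [hf i h]; exact hnd.idxOf_getElem i h
    have hadj : ∀ i, i + 1 < l.length → G.Adj (f i) (f (i+1)) := fun i h => by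
      rw [hf i (by omega), hf (i+1) h]; exact List.isChain_iff_getElem.1 hch i h
    let c : Sym2 V → ℕ := Sym2.lift ⟨fun x y => min (g x) (g y) % 2, fun x y => by
      simp only [min_comm]⟩
    have hc : ∀ x y, c s(x, y) = min (g x) (g y) % 2 := fun x y => rfl
    have main : ∀ u v, g u ≤ g v → ∃ p : G.Walk u v, p.IsPath ∧ ProperWalk c p := by
      intro u v h
      have hs := seg_walk G l.length f g hgf hadj c hc (g v - g u) (g u)
        (by have := hg v; omega)
      have e : g u + (g v - g u) = g v := by omega
      rw [e, hfg, hfg] at hs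
      obtain ⟨p, h1, h2, -⟩ := hs
      exact ⟨p, h1, h2⟩
    refine ⟨c, ?_, ?_⟩
    · intro e _
      induction e with
      | _ x y => rw [hc]; omega
    · intro u v _
      rcases le_total (g u) (g v) with h | h
      · exact main u v h
      · obtain ⟨p, h1, h2⟩ := main v u h
        refine ⟨p.reverse, h1.reverse, ?_⟩
        unfold ProperWalk at h2 ⊢
        rw [SimpleGraph.Walk.edges_reverse]
        exact List.isChain_reverse.2 (List.IsChain.imp (fun _ _ h => Ne.symm h) h2)
  refine le_antisymm (Nat.sInf_le hmem) (le_csInf ⟨2, hmem⟩ ?_)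
  rintro k ⟨c, hck, hpc⟩
  by_contra! hk
  apply hnoncomplete
  ext u v
  rw [SimpleGraph.top_adj]
  refine ⟨fun h => h.ne, fun huv => ?_⟩
  obtain ⟨p, -, hp⟩ := hpc u v huv
  have hz : ∀ e ∈ p.edges, c e = 0 := fun e he => by
    have := hck e (p.edges_subset_edgeSet he); omega
  cases p with
  | nil => exact absurd rfl huv
  | cons h q =>
    cases q with
    | nil => exact h
    | cons h' r =>
      exfalso
      unfold ProperWalk at hp
      rw [SimpleGraph.Walk.edges_cons, SimpleGraph.Walk.edges_cons] at hp
      have := (List.isChain_cons_cons.1 hp).1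
      apply this
      rw [hz _ (by simp), hz _ (by simp)]
end

section
/- Let G be a connected graph with n ≥ 4 vertices and minimum degree δ(G) ≥ n/2. Then pc_2(G) = 2. -/
namespace Ore

variable {V : Type*} (G : SimpleGraph V) [DecidableRel G.Adj]

/-- number of non-adjacent consecutive pairs -/
def gap : List V → ℕ
  | [] => 0
  | [_] => 0
  | a :: b :: t => (if G.Adj a b then 0 else 1) + gap (b :: t)

theorem gap_split (A : List V) (x : V) (B : List V) :
    gap G (A ++ x :: B) = gap G (A ++ [x]) + gap G (x :: B) := by
  induction A with
  | nil => simp [gap]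
  | cons a A ih =>
    cases A with
    | nil => simp [gap]
    | cons b A => simp only [List.cons_append, gap] at ih ⊢; omega

theorem gap_split2 (A : List V) (x y : V) (B : List V) :
    gap G (A ++ x :: y :: B) =
      gap G (A ++ [x]) + (if G.Adj x y then 0 else 1) + gap G (y :: B) := by
  rw [gap_split]; simp only [gap]; omega

theorem gap_reverse (l : List V) : gap G l.reverse = gap G l := by
  induction l with
  | nil => rfl
  | cons a l ih =>
    cases l with
    | nil => rfl
    | cons b l =>
      have := gap_split2 G l.reverse b a []
      simp only [List.reverse_cons, List.append_assoc, List.cons_append, List.nil_append] at ih ⊢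
      rw [this, ih]
      simp only [gap, G.adj_comm b a]; omega

/-- cyclic gap number -/
def cg (l : List V) : ℕ := gap G (l ++ l.head?.toList)

theorem cg_comm (P Q : List V) : cg G (P ++ Q) = cg G (Q ++ P) := by
  cases P with
  | nil => simp
  | cons p P =>
    cases Q with
    | nil => simp
    | cons q Q =>
      have h1 := gap_split G (p :: P) q (Q ++ [p])
      have h2 := gap_split G (q :: Q) p (P ++ [q])
      simp only [cg, List.cons_append, List.head?_cons, Option.toList_some, List.append_assoc]
        at h1 h2 ⊢
      omega

theorem gap_pos (l : List V) (h : gap G l ≠ 0) :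
    ∃ P x y Q, l = P ++ x :: y :: Q ∧ ¬ G.Adj x y := by
  induction l with
  | nil => simp [gap] at h
  | cons a l ih =>
    cases l with
    | nil => simp [gap] at h
    | cons b l =>
      by_cases hab : G.Adj a b
      · simp only [gap, hab, if_true, zero_add] at h
        obtain ⟨P, x, y, Q, h1, h2⟩ := ih h
        exact ⟨a :: P, x, y, Q, by simp [h1], h2⟩
      · exact ⟨[], a, b, l, rfl, hab⟩

theorem cg_pos (l : List V) (hl : 2 ≤ l.length) (h : cg G l ≠ 0) :
    ∃ x y T, l.Perm (y :: (T ++ [x])) ∧ cg G (y :: (T ++ [x])) = cg G l ∧ ¬ G.Adj x y := by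
  obtain ⟨P, x, y, Q, h1, h2⟩ := gap_pos G _ h
  match l, hl with
  | a :: b :: l, _ =>
    simp only [List.head?_cons, Option.toList_some] at h1
    rcases List.eq_nil_or_concat Q with rfl | ⟨Q, q, rfl⟩
    · have h3 : (a :: b :: l) ++ [a] = (P ++ [x]) ++ [y] := by simpa using h1
      obtain ⟨h4, h5⟩ := List.append_inj' h3 rfl
      simp only [List.cons.injEq, and_true] at h5
      subst h5
      cases P with
      | nil => simp at h4
      | cons p P =>
        simp only [List.cons_append, List.cons.injEq] at h4
        obtain ⟨rfl, h4⟩ := h4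
        refine ⟨x, a, P, ?_, ?_, h2⟩ <;> rw [h4]
    · have h3 : (a :: b :: l) ++ [a] = (P ++ x :: y :: Q) ++ [q] := by simpa using h1
      obtain ⟨h4, h5⟩ := List.append_inj' h3 rfl
      have e : y :: ((Q ++ P) ++ [x]) = (y :: Q) ++ (P ++ [x]) := by simp
      have e2 : P ++ x :: y :: Q = (P ++ [x]) ++ (y :: Q) := by simp
      refine ⟨x, y, Q ++ P, ?_, ?_, h2⟩
      · rw [h4, e, e2]; exact List.perm_append_comm
      · rw [h4, e, e2]; exact cg_comm G _ _

theorem pigeon (p q : V → Bool) (L : List V) (a z : V)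
    (h : L.length + 1 < (a :: L).countP p + (L ++ [z]).countP q) :
    ∃ A x y B, a :: (L ++ [z]) = A ++ x :: y :: B ∧ p x ∧ q y := by
  induction L generalizing a with
  | nil =>
    refine ⟨[], a, z, [], rfl, ?_⟩
    by_cases h1 : p a <;> by_cases h2 : q z <;> simp_all
  | cons b L ih =>
    by_cases hc : p a ∧ q b
    · exact ⟨[], a, b, L ++ [z], rfl, hc⟩
    · obtain ⟨A, x, y, B, h1, h2⟩ := ih b (by
        simp only [List.cons_append, List.countP_cons, List.length_cons] at h ⊢
        by_cases h1 : p a <;> by_cases h2 : q b <;> simp_all <;> omega)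
      exact ⟨a :: A, x, y, B, by simp [← h1], h2⟩

theorem step (l : List V) (hl : 2 ≤ l.length)
    (hd : ∀ x ∈ l, l.length ≤ 2 * l.countP (fun y => decide (G.Adj x y)))
    (h : cg G l ≠ 0) : ∃ l', l.Perm l' ∧ cg G l' < cg G l := by
  obtain ⟨x, y, T, hp, hc, hxy⟩ := cg_pos G l hl h
  have hx := hd x (hp.mem_iff.2 (by simp))
  have hy := hd y (hp.mem_iff.2 (by simp))
  rw [hp.countP_eq, hp.length_eq] at hx hy
  have e : y :: (T ++ [x]) = (y :: T) ++ [x] := rfl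
  have hx' : (y :: (T ++ [x])).countP (fun z => decide (G.Adj x z))
      = (y :: T).countP (fun z => decide (G.Adj x z)) := by
    rw [e, List.countP_append]; simp
  have hy' : (y :: (T ++ [x])).countP (fun z => decide (G.Adj y z))
      = (T ++ [x]).countP (fun z => decide (G.Adj y z)) := by
    rw [List.countP_cons]; simp
  rw [hx'] at hx
  rw [hy'] at hy
  obtain ⟨A, s, t, B, hs, h1, h2⟩ := pigeon (fun z => decide (G.Adj x z))
    (fun z => decide (G.Adj y z)) T y x (by simp at hx hy ⊢; omega)
  simp only [decide_eq_true_eq] at h1 h2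
  refine ⟨(A ++ [s]) ++ (t :: B).reverse, hp.trans ?_, ?_⟩
  · rw [hs]
    have : A ++ s :: t :: B = (A ++ [s]) ++ (t :: B) := by simp
    rw [this]
    exact List.Perm.append_left _ (List.reverse_perm _).symm
  · rw [← hc]
    -- B' with last x, A with head y
    obtain ⟨B', hB⟩ : ∃ B', t :: B = B' ++ [x] := by
      refine ⟨(t :: B).dropLast, ?_⟩
      have := congrArg List.getLast? hs
      rw [List.getLast?_cons_of_ne_nil (by simp)] at this
      simp at this
      have h3 := List.dropLast_append_getLast (l := t :: B) (by simp)
      rw [List.getLast?_eq_some_getLast (l := t :: B) (by simp)] at *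
      grind
    obtain ⟨A', hA⟩ : ∃ A', A ++ [s] = y :: A' := by
      cases A with
      | nil => simp at hs; exact ⟨[], by simp [hs.1]⟩
      | cons a A => simp at hs; exact ⟨A ++ [s], by simp [hs.1]⟩
    have n1 : cg G (y :: (T ++ [x])) = gap G (A ++ [s]) + (if G.Adj s t then 0 else 1)
        + gap G (t :: B) + 1 := by
      have e1 : y :: (T ++ [x]) ++ [y] = A ++ s :: t :: (B ++ [y]) := by rw [hs]; simp
      have e2 : t :: (B ++ [y]) = B' ++ x :: y :: [] := by
        rw [← List.cons_append, hB]; simp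
      simp only [cg, List.head?_cons, Option.toList_some]
      rw [e1, gap_split2, e2, gap_split2, hB]
      simp [hxy, gap]; omega
    have n2 : cg G ((A ++ [s]) ++ (t :: B).reverse) = gap G (A ++ [s]) + gap G (t :: B) := by
      have e1 : ((A ++ [s]) ++ (t :: B).reverse).head?.toList = [y] := by rw [hA]; rfl
      have e2 : (A ++ [s]) ++ (t :: B).reverse ++ [y] = A ++ s :: x :: (B'.reverse ++ [y]) := by
        rw [hB]; simp
      have e3 : x :: (B'.reverse ++ [y]) = B.reverse ++ t :: y :: [] := by
        have := congrArg List.reverse hB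
        simp at this
        rw [← List.cons_append, ← this]; simp
      have sx : G.Adj s x := h1.symm
      have ty : G.Adj t y := h2.symm
      rw [cg, e1, e2, gap_split2, e3, gap_split2, ← gap_reverse G (t :: B)]
      simp [sx, ty, gap]
    omega

theorem ore (l : List V) (hl : 2 ≤ l.length)
    (hd : ∀ x ∈ l, l.length ≤ 2 * l.countP (fun y => decide (G.Adj x y))) :
    ∃ l', l.Perm l' ∧ cg G l' = 0 := by
  induction hk : cg G l using Nat.strong_induction_on generalizing l with
  | _ k ih =>
    by_cases h0 : cg G l = 0
    · exact ⟨l, List.Perm.refl _, h0⟩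
    · obtain ⟨l1, hp, hlt⟩ := step G l hl hd h0
      obtain ⟨l2, hp2, h2⟩ := ih _ (hk ▸ hlt) l1 (by rw [← hp.length_eq]; exact hl) (by
        intro x hx
        rw [← hp.length_eq, ← hp.countP_eq]
        exact hd x (hp.mem_iff.2 hx)) rfl
      exact ⟨l2, hp.trans hp2, h2⟩

theorem gap_zero (l : List V) (h : gap G l = 0) (i : ℕ) (hi : i + 1 < l.length) :
    G.Adj l[i] l[i+1] := by
  induction l generalizing i with
  | nil => simp at hi
  | cons a l ih =>
    cases l with
    | nil => simp at hi
    | cons b l =>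
      simp only [gap, Nat.add_eq_zero_iff] at h
      cases i with
      | zero => simpa using h.1
      | succ i => exact ih h.2 i (by simpa using hi)

/-- alternating path list -/
def Good (c : Sym2 V → ℕ) (l : List V) : Prop :=
  ∃ k, ∀ i (hi : i + 1 < l.length), G.Adj l[i] l[i+1] ∧ c s(l[i], l[i+1]) = (i + k) % 2

theorem getmid (A B C : List V) (i : ℕ) (hi : i < B.length) :
    (A ++ B ++ C)[A.length + i]'(by simp; omega) = B[i] := by grind

theorem good_infix (c : Sym2 V → ℕ) (A B C : List V) (h : Good G c (A ++ B ++ C)) :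
    Good G c B := by
  obtain ⟨k, h⟩ := h
  refine ⟨A.length + k, fun i hi => ?_⟩
  have := h (A.length + i) (by simp; omega)
  have e1 : (A ++ B ++ C)[A.length + i]'(by simp; omega) = B[i] :=
    getmid A B C i (by omega)
  have e2 : (A ++ B ++ C)[A.length + i + 1]'(by simp; omega) = B[i+1] :=
    getmid A B C (i+1) hi
  rw [e1, e2] at this
  refine ⟨this.1, this.2.trans ?_⟩
  congr 1; omega

theorem good_walk (c : Sym2 V → ℕ) (t : List V) (u v : V) (k : ℕ)
    (h : ∀ i (hi : i + 1 < (u :: (t ++ [v])).length),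
      G.Adj (u :: (t ++ [v]))[i] (u :: (t ++ [v]))[i+1] ∧
      c s((u :: (t ++ [v]))[i], (u :: (t ++ [v]))[i+1]) = (i + k) % 2) :
    ∃ W : G.Walk u v, W.support = u :: (t ++ [v]) ∧ ProperWalk c W ∧
      ∀ e ∈ W.edges.head?, c e = k % 2 := by
  induction t generalizing u k with
  | nil =>
    have h0 := h 0 (by simp)
    simp at h0
    refine ⟨.cons h0.1 .nil, by simp, ?_, by simp [h0.2]⟩
    exact List.isChain_singleton _
  | cons a t ih =>
    obtain ⟨W, h1, h2, h3⟩ := ih a (k + 1) (fun i hi => by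
      have := h (i + 1) (by simpa using hi)
      refine ⟨this.1, this.2.trans ?_⟩
      congr 1; omega)
    have h0 := h 0 (by simp)
    simp at h0
    refine ⟨.cons h0.1 W, by simp [h1], ?_, by simp [h0.2]⟩
    unfold ProperWalk at h2 ⊢
    rw [SimpleGraph.Walk.edges_cons]
    refine List.isChain_cons.2 ⟨fun e he => ?_, h2⟩
    rw [h3 e he, h0.2]; omega

theorem two_paths (c : Sym2 V → ℕ) (X Y : List V) (u v : V)
    (h1 : Good G c (u :: (X ++ [v]))) (h2 : Good G c (v :: (Y ++ [u])))
    (hn : (u :: (X ++ v :: Y)).Nodup) (hne : X ++ Y ≠ []) :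
    ∃ p q : G.Walk u v, p.IsPath ∧ q.IsPath ∧
    ProperWalk c p ∧ ProperWalk c q ∧ p ≠ q ∧
    ∀ x, x ∈ p.support → x ∈ q.support → x = u ∨ x = v := by
  obtain ⟨k1, h1⟩ := h1
  obtain ⟨k2, h2⟩ := h2
  obtain ⟨p, hp, hp', -⟩ := good_walk G c X u v k1 h1
  obtain ⟨q, hq, hq', -⟩ := good_walk G c Y v u k2 h2
  have hdis : ∀ x, x ∈ p.support → x ∈ q.reverse.support → x = u ∨ x = v := by
    intro x hx hx'
    rw [SimpleGraph.Walk.support_reverse, List.mem_reverse] at hx'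
    rw [hp] at hx
    rw [hq] at hx'
    grind
  refine ⟨p, q.reverse, ?_, ?_, hp', ?_, ?_, hdis⟩
  · rw [SimpleGraph.Walk.isPath_def, hp]; grind
  · rw [SimpleGraph.Walk.isPath_reverse_iff, SimpleGraph.Walk.isPath_def, hq]; grind
  · unfold ProperWalk at hq' ⊢
    rw [SimpleGraph.Walk.edges_reverse]
    refine List.isChain_reverse.2 (hq'.imp fun a b hab => hab.symm)
  · intro he
    obtain ⟨x, hx⟩ := List.exists_mem_of_ne_nil _ hne
    have hmem : x ∈ p.support ∧ x ∈ q.reverse.support := by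
      rcases List.mem_append.1 hx with h | h
      · have : x ∈ p.support := by rw [hp]; simp [h]
        exact ⟨this, he ▸ this⟩
      · have : x ∈ q.reverse.support := by
          rw [SimpleGraph.Walk.support_reverse, List.mem_reverse, hq]; simp [h]
        exact ⟨he ▸ this, this⟩
    have := hdis x hmem.1 hmem.2
    grind

open Classical in
/-- the matching coloring -/
noncomputable def col (l : List V) (e : Sym2 V) : ℕ :=
  if ∃ j, ∃ h : 2 * j + 1 < l.length, e = s(l[2*j], l[2*j+1]) then 0 else 1

theorem col_lt (l : List V) (e : Sym2 V) : col l e < 2 := by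
  unfold col; split_ifs <;> simp

theorem col_edge (l : List V) (hn : l.Nodup) (i : ℕ) (hi : i + 1 < l.length) :
    col l s(l[i], l[i+1]) = i % 2 := by
  unfold col
  split_ifs with h
  · obtain ⟨j, hj, he⟩ := h
    rw [Sym2.eq_iff, hn.getElem_inj_iff, hn.getElem_inj_iff, hn.getElem_inj_iff,
      hn.getElem_inj_iff] at he
    omega
  · by_contra hc
    apply h
    have : i = 2 * (i / 2) := by omega
    exact ⟨i / 2, by omega, by simp only [← this]⟩

theorem col_last (l : List V) (hn : l.Nodup) (m : ℕ) (hm : l.length = 2 * m) (h4 : 4 ≤ l.length) :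
    col l s(l[l.length - 1], l[0]) = 1 := by
  unfold col
  rw [if_neg]
  rintro ⟨j, hj, he⟩
  rw [Sym2.eq_iff, hn.getElem_inj_iff, hn.getElem_inj_iff, hn.getElem_inj_iff,
      hn.getElem_inj_iff] at he
  omega

theorem col_out (l : List V) (w x : V) (hw : w ∉ l) : col l s(w, x) = 1 := by
  unfold col
  rw [if_neg]
  rintro ⟨j, hj, he⟩
  rw [Sym2.eq_iff] at he
  apply hw
  rcases he with h | h <;> rw [h.1] <;> exact List.getElem_mem _

theorem good_cycle (l : List V) (hn : l.Nodup) (m : ℕ) (hm : l.length = 2 * m)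
    (h4 : 4 ≤ l.length) (hc : cg G l = 0) : Good G (col l) (l ++ l) := by
  have hlast : G.Adj l[l.length - 1] l[0] := by
    have h := gap_zero G _ hc (l.length - 1) (by
      cases l <;> simp at h4 ⊢)
    cases l with
    | nil => simp at h4
    | cons a l =>
      rw [List.getElem_append_left (by simp), List.getElem_append_right (by simp)] at h
      simpa using h
  have hadj : ∀ i (hi : i + 1 < l.length), G.Adj l[i] l[i+1] := by
    intro i hi
    have h := gap_zero G _ hc i (by simp; omega)
    rwa [List.getElem_append_left (by omega), List.getElem_append_left (by omega)] at h
  refine ⟨0, fun i hi => ?_⟩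
  simp only [List.length_append] at hi
  rcases lt_trichotomy (i + 1) l.length with h | h | h
  · rw [List.getElem_append_left (by omega), List.getElem_append_left (by omega)]
    exact ⟨hadj i h, by simpa using col_edge l hn i h⟩
  · have e1 : (l ++ l)[i]'(by simp; omega) = l[l.length - 1] := by grind
    have e2 : (l ++ l)[i+1]'(by simp; omega) = l[0] := by grind
    rw [e1, e2]
    exact ⟨hlast, (col_last l hn m hm h4).trans (by omega)⟩
  · have e1 : (l ++ l)[i]'(by simp; omega) = l[i - l.length] := by grind
    have e2 : (l ++ l)[i+1]'(by simp; omega) = l[i - l.length + 1] := by grind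
    rw [e1, e2]
    exact ⟨hadj _ (by omega), (col_edge l hn _ (by omega)).trans (by omega)⟩

theorem cycle_conn (l : List V) (hn : l.Nodup) (m : ℕ) (hm : l.length = 2 * m)
    (h4 : 4 ≤ l.length) (hc : cg G l = 0) (u v : V) (hu : u ∈ l) (hv : v ∈ l) (huv : u ≠ v) :
    ∃ p q : G.Walk u v, p.IsPath ∧ q.IsPath ∧
    ProperWalk (col l) p ∧ ProperWalk (col l) q ∧ p ≠ q ∧
    ∀ x, x ∈ p.support → x ∈ q.support → x = u ∨ x = v := by
  have hg := good_cycle G l hn m hm h4 hc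
  have key : ∀ A B C a b, l = A ++ a :: (B ++ b :: C) →
      Good G (col l) (a :: (B ++ [b])) ∧ Good G (col l) (b :: ((C ++ A) ++ [a])) ∧
      (a :: (B ++ b :: (C ++ A))).Nodup ∧ B ++ (C ++ A) ≠ [] := by
    intro A B C a b hl
    refine ⟨good_infix G _ A _ (C ++ l) ?_, good_infix G _ (A ++ a :: B) _ (B ++ b :: C) ?_, ?_, ?_⟩
    · have : A ++ a :: (B ++ [b]) ++ (C ++ l) = l ++ l := by
        nth_rw 2 [hl]; simp
      rwa [this]
    · have : A ++ a :: B ++ b :: (C ++ A ++ [a]) ++ (B ++ b :: C) = l ++ l := by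
        rw [hl]; simp
      rwa [this]
    · have e : a :: (B ++ b :: (C ++ A)) = (a :: (B ++ b :: C)) ++ A := by simp
      rw [e, List.perm_append_comm.nodup_iff, ← hl]; exact hn
    · intro h
      simp at h
      rw [hl] at h4
      simp [h] at h4
  obtain ⟨A, D, hA⟩ := List.append_of_mem hu
  rw [hA, List.mem_append, List.mem_cons] at hv
  rcases hv with hv | hv | hv
  · obtain ⟨A1, A2, rfl⟩ := List.append_of_mem hv
    obtain ⟨k1, k2, k3, k4⟩ := key A1 A2 D v u (by rw [hA]; simp)
    refine two_paths G _ _ _ u v k2 k1 ?_ ?_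
    · have hh : ((v :: A2) ++ (u :: (D ++ A1))).Nodup := k3
      rw [List.perm_append_comm.nodup_iff] at hh
      exact hh
    · intro h
      apply k4
      simp at h ⊢
      tauto
  · exact absurd hv.symm huv
  · obtain ⟨B, C, rfl⟩ := List.append_of_mem hv
    obtain ⟨k1, k2, k3, k4⟩ := key A B C u v hA
    exact two_paths G _ _ _ u v k1 k2 k3 k4

theorem apex_conn (l : List V) (hn : l.Nodup) (m : ℕ) (hm : l.length = 2 * m)
    (h4 : 4 ≤ l.length) (hc : cg G l = 0) (w u : V) (hw : w ∉ l) (hu : u ∈ l)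
    (h0 : G.Adj w l[0]) (h1 : G.Adj w l[l.length - 1]) :
    Good G (col l) (w :: (l ++ [w])) := by
  obtain ⟨k, hg⟩ := good_infix G _ [] l l (good_cycle G l hn m hm h4 hc)
  refine ⟨1, fun i hi => ?_⟩
  simp only [List.length_append, List.length_cons, List.length_nil] at hi
  rcases Nat.eq_zero_or_pos i with rfl | h
  · have e2 : (w :: (l ++ [w]))[0+1]'(by simp) = l[0] := by grind
    rw [e2]
    exact ⟨h0, col_out l _ _ hw⟩
  · rcases Nat.lt_or_ge i l.length with h' | h'
    · have e1 : (w :: (l ++ [w]))[i]'(by simp; omega) = l[i-1] := by grind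
      have e2 : (w :: (l ++ [w]))[i+1]'(by simp; omega) = l[i-1+1] := by grind
      rw [e1, e2]
      exact ⟨(hg _ (by omega)).1, (col_edge l hn _ (by omega)).trans (by omega)⟩
    · have e1 : (w :: (l ++ [w]))[i]'(by simp; omega) = l[l.length-1] := by grind
      have e2 : (w :: (l ++ [w]))[i+1]'(by simp; omega) = w := by grind
      rw [e1, e2, Sym2.eq_swap]
      exact ⟨h1.symm, (col_out l _ _ hw).trans (by omega)⟩

theorem countP_degree [Fintype V] (x : V) :
    (Finset.univ : Finset V).toList.countP (fun y => decide (G.Adj x y)) = G.degree x := by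
  rw [← G.card_neighborFinset_eq_degree, SimpleGraph.neighborFinset_eq_filter, Finset.card_def,
    Finset.filter_val, ← Multiset.countP_eq_card_filter, ← Multiset.coe_countP, Finset.coe_toList]

theorem upper [Fintype V] [DecidableEq V] (hn : 4 ≤ Fintype.card V)
    (hd : ∀ x, Fintype.card V ≤ 2 * G.degree x) :
    ∃ c : Sym2 V → ℕ, (∀ e ∈ G.edgeSet, c e < 2) ∧ Is2ProperConnected G c := by
  have hlen : (Finset.univ : Finset V).toList.length = Fintype.card V := by simp
  rcases Nat.even_or_odd' (Fintype.card V) with ⟨m, hm | hm⟩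
  · obtain ⟨l, hp, hc⟩ := ore G (Finset.univ : Finset V).toList (by omega)
      (fun x _ => by rw [countP_degree, hlen]; exact hd x)
    have hl : l.length = Fintype.card V := by rw [← hp.length_eq, hlen]
    have hnd : l.Nodup := hp.nodup_iff.1 (Finset.nodup_toList _)
    have hmem : ∀ x, x ∈ l := fun x => hp.mem_iff.1 (by simp)
    exact ⟨col l, fun e _ => col_lt l e, fun u v huv =>
      cycle_conn G l hnd m (by omega) (by omega) hc u v (hmem u) (hmem v) huv⟩
  · obtain ⟨w⟩ : Nonempty V := Fintype.card_pos_iff.1 (by omega)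
    have hw : (Finset.univ : Finset V).toList.Perm
      (w :: (Finset.univ : Finset V).toList.erase w) := List.perm_cons_erase (by simp)
    generalize (Finset.univ : Finset V).toList.erase w = r at hw
    have hr : r.length = 2 * m := by
      have := hw.length_eq
      rw [List.length_cons] at this; omega
    have hcount : ∀ x, G.degree x = r.countP (fun y => decide (G.Adj x y)) +
        if G.Adj x w then 1 else 0 := by
      intro x
      rw [← countP_degree, hw.countP_eq, List.countP_cons]; simp
    obtain ⟨l, hp, hc⟩ := ore G r (by omega) (fun x _ => by
      have h1 := hd x
      have h2 := hcount x
      split_ifs at h2 <;> omega)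
    have hwl : m + 1 ≤ l.countP (fun y => decide (G.Adj w y)) := by
      have h1 := hd w
      have h2 := hcount w
      simp at h2
      rw [← hp.countP_eq]; omega
    have hll : l.length = 2 * m := by rw [← hp.length_eq, hr]
    -- rotate
    obtain ⟨P, x, y, Q, hl, hx, hy⟩ : ∃ P x y Q, l = P ++ x :: y :: Q ∧ G.Adj w x ∧ G.Adj w y := by
      match l, hll with
      | [], h => simp at h; omega
      | a :: t, h =>
        rcases List.eq_nil_or_concat t with rfl | ⟨L, z, rfl⟩
        · simp at h; omega
        · obtain ⟨A, x, y, B, h1, h2, h3⟩ := pigeon (fun y => decide (G.Adj w y))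
            (fun y => decide (G.Adj w y)) L a z (by
              simp only [List.countP_cons, List.countP_append, List.length_cons,
                List.length_append, List.countP_nil, List.length_nil, List.concat_eq_append]
                at hwl h ⊢
              split_ifs at hwl ⊢ <;> omega)
          exact ⟨A, x, y, B, by simpa using h1, by simpa using h2, by simpa using h3⟩
    have e2 : P ++ x :: y :: Q = (P ++ [x]) ++ (y :: Q) := by simp
    rw [hl, e2] at hp
    rw [hl, e2, cg_comm] at hc
    replace hp := hp.trans List.perm_append_comm
    obtain ⟨l', hl'⟩ : ∃ l', l' = y :: Q ++ (P ++ [x]) := ⟨_, rfl⟩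
    rw [← hl'] at hp hc
    have hl2 : l'.length = 2 * m := by rw [← hp.length_eq, hr]
    have h0 : G.Adj w (l'[0]'(by omega)) := by
      have : l'[0]'(by omega) = y := by grind
      rw [this]; exact hy
    have h1 : G.Adj w (l'[l'.length - 1]'(by omega)) := by
      have : l'[l'.length - 1]'(by omega) = x := by grind
      rw [this]; exact hx
    have hp' := hw.trans (hp.cons w)
    have hnd' : (w :: l').Nodup := hp'.nodup_iff.1 (Finset.nodup_toList _)
    have hmem : ∀ x, x ∈ w :: l' := fun x => hp'.mem_iff.1 (by simp)
    obtain ⟨hwn, hnd⟩ := List.nodup_cons.1 hnd'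
    have hg := apex_conn G l' hnd m hl2 (by omega) hc w w hwn
    have key : ∀ u ∈ l', ∃ A B, l' = A ++ u :: B ∧ Good G (col l') (w :: (A ++ [u])) ∧
        Good G (col l') (u :: (B ++ [w])) ∧ A ++ B ≠ [] := by
      intro u hu
      have hg := apex_conn G l' hnd m hl2 (by omega) hc w u hwn hu h0 h1
      obtain ⟨A, B, hAB⟩ := List.append_of_mem hu
      refine ⟨A, B, hAB, good_infix G _ [] _ (B ++ [w]) ?_, good_infix G _ (w :: A) _ [] ?_, ?_⟩
      · have : [] ++ w :: (A ++ [u]) ++ (B ++ [w]) = w :: (l' ++ [w]) := by rw [hAB]; simp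
        rwa [this]
      · have : w :: A ++ u :: (B ++ [w]) ++ [] = w :: (l' ++ [w]) := by rw [hAB]; simp
        rwa [this]
      · intro h
        simp at h
        rw [hAB] at hl2
        simp [h] at hl2
        omega
    refine ⟨col l', fun e _ => col_lt l' e, fun u v huv => ?_⟩
    rcases List.mem_cons.1 (hmem u) with rfl | hu
    · obtain ⟨A, B, hAB, k1, k2, k3⟩ := key v ((List.mem_cons.1 (hmem v)).resolve_left huv.symm)
      exact two_paths G _ A B u v k1 k2 (by rw [← hAB]; exact hnd') k3
    · rcases List.mem_cons.1 (hmem v) with rfl | hv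
      · obtain ⟨A, B, hAB, k1, k2, k3⟩ := key u hu
        refine two_paths G _ B A u v k2 k1 ?_ ?_
        · rw [hAB] at hnd'; grind
        · grind
      · exact cycle_conn G l' hnd m hl2 (by omega) hc u v hu hv huv

theorem short (c : Sym2 V → ℕ) (hc : ∀ e ∈ G.edgeSet, c e < 1) (u v : V) (huv : u ≠ v)
    (p : G.Walk u v) (hp : ProperWalk c p) : p.support = [u, v] := by
  match p with
  | .nil => exact absurd rfl huv
  | .cons h .nil => simp
  | .cons h (.cons h' q) =>
    unfold ProperWalk at hp
    simp only [SimpleGraph.Walk.edges_cons] at hp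
    have := (List.isChain_cons_cons.1 hp).1
    have a1 := hc _ (G.mem_edgeSet.2 h)
    have a2 := hc _ (G.mem_edgeSet.2 h')
    omega

end Ore

theorem stmt9 {V : Type*} [Fintype V] [DecidableEq V] (G : SimpleGraph V)
    [DecidableRel G.Adj] (hconn : G.Connected)
    (hn : 4 ≤ Fintype.card V)
    (hδ : (Fintype.card V : ℝ) / 2 ≤ (G.minDegree : ℝ)) :
    pc2 G = 2 := by
  have hd : ∀ x, Fintype.card V ≤ 2 * G.degree x := by
    intro x
    have h1 := G.minDegree_le_degree x
    have h2 : (Fintype.card V : ℝ) ≤ 2 * (G.minDegree : ℝ) := by linarith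
    have h3 : Fintype.card V ≤ 2 * G.minDegree := by exact_mod_cast h2
    omega
  have hup := Ore.upper G hn hd
  unfold pc2
  apply le_antisymm
  · exact Nat.sInf_le hup
  · refine le_csInf ⟨2, hup⟩ ?_
    rintro k ⟨c, hc, h2⟩
    by_contra hk
    have hc' : ∀ e ∈ G.edgeSet, c e < 1 := fun e he => by have := hc e he; omega
    obtain ⟨u, v, huv⟩ := Fintype.exists_pair_of_one_lt_card (by omega : 1 < Fintype.card V)
    obtain ⟨p, q, -, -, hp, hq, hpq, -⟩ := h2 u v huv
    apply hpq
    apply SimpleGraph.Walk.ext_support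
    rw [Ore.short G c hc' u v huv p hp, Ore.short G c hc' u v huv q hq]
end

section
/- Let G be a simple graph on n ≥ 4 vertices in which the degree sum of any two nonadjacent vertices is at least n. Then pc_2(G) = 2. -/
/-- two internally disjoint proper paths -/
def TP {V : Type*} (G : SimpleGraph V) (c : Sym2 V → ℕ) (u v : V) : Prop :=
  ∃ p q : G.Walk u v, p.IsPath ∧ q.IsPath ∧
    ProperWalk c p ∧ ProperWalk c q ∧ p ≠ q ∧
    ∀ x, x ∈ p.support → x ∈ q.support → x = u ∨ x = v

theorem TP.symm {V : Type*} {G : SimpleGraph V} {c : Sym2 V → ℕ} {u v : V}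
    (h : TP G c u v) : TP G c v u := by
  obtain ⟨p, q, hp, hq, pp, pq, hne, hd⟩ := h
  refine ⟨p.reverse, q.reverse, hp.reverse, hq.reverse, ?_, ?_, ?_, ?_⟩
  · unfold ProperWalk at *
    rw [SimpleGraph.Walk.edges_reverse]
    unfold List.Chain' at *
    rw [List.isChain_reverse]
    exact pp.imp fun a b h => h.symm
  · unfold ProperWalk at *
    rw [SimpleGraph.Walk.edges_reverse]
    unfold List.Chain' at *
    rw [List.isChain_reverse]
    exact pq.imp fun a b h => h.symm
  · intro h
    apply hne
    have := congrArg SimpleGraph.Walk.reverse h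
    simpa using this
  · intro x hx hy
    rw [SimpleGraph.Walk.support_reverse, List.mem_reverse] at hx hy
    exact (hd x hx hy).symm

theorem mkpath {V : Type*} {G : SimpleGraph V} {c : Sym2 V → ℕ} (k : ℕ) :
    ∀ (g : ℕ → V), (∀ i < k, G.Adj (g i) (g (i+1))) →
    (∀ i j, i < j → j ≤ k → g i ≠ g j) →
    (∀ i, i + 2 ≤ k → c s(g i, g (i+1)) ≠ c s(g (i+1), g (i+2))) →
    ∃ p : G.Walk (g 0) (g k), p.IsPath ∧ ProperWalk c p ∧ p.length = k ∧
      (∀ e, p.edges.head? = some e → e = s(g 0, g 1)) ∧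
      (∀ x, x ∈ p.support → ∃ i ≤ k, g i = x) := by
  induction k with
  | zero =>
    intro g _ _ _
    refine ⟨SimpleGraph.Walk.nil, by simp, by simp [ProperWalk, List.Chain'], by simp, by simp, ?_⟩
    intro x hx
    exact ⟨0, le_rfl, by simp at hx; exact hx.symm⟩
  | succ k ih =>
    intro g ha hi hc
    obtain ⟨p, h1, h2, h3, h4, h5⟩ := ih (fun i => g (i+1)) (fun i hik => ha (i+1) (by omega))
      (fun i j hij hj => hi (i+1) (j+1) (by omega) (by omega))
      (fun i hik => hc (i+1) (by omega))
    refine ⟨SimpleGraph.Walk.cons (ha 0 (by omega)) p, ?_, ?_, ?_, ?_, ?_⟩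
    · rw [SimpleGraph.Walk.cons_isPath_iff]
      refine ⟨h1, fun hm => ?_⟩
      obtain ⟨i, hik, e⟩ := h5 _ hm
      exact hi 0 (i+1) (by omega) (by omega) e.symm
    · unfold ProperWalk at *
      unfold List.Chain' at *
      rw [SimpleGraph.Walk.edges_cons, List.isChain_cons]
      refine ⟨?_, h2⟩
      intro e he
      have he' := h4 e he
      subst he'
      have hk : 1 ≤ k := by
        by_contra hk
        have : p.edges.length = 0 := by rw [SimpleGraph.Walk.length_edges]; omega
        rw [List.length_eq_zero_iff] at this
        rw [this] at he
        simp at he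
      exact hc 0 (by omega)
    · simp [h3]
    · intro e he
      simpa using he.symm
    · intro x hx
      rw [SimpleGraph.Walk.support_cons, List.mem_cons] at hx
      rcases hx with rfl | hx
      · exact ⟨0, by omega, rfl⟩
      · obtain ⟨i, hik, e⟩ := h5 _ hx
        exact ⟨i+1, by omega, e⟩

theorem mkTP {V : Type*} {G : SimpleGraph V} {c : Sym2 V → ℕ} {u v : V} (k l : ℕ)
    (g h : ℕ → V) (hg0 : g 0 = u) (hh0 : h 0 = u) (hgk : g k = v) (hhl : h l = v)
    (hkl : 3 ≤ k + l)
    (ga : ∀ i < k, G.Adj (g i) (g (i+1)))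
    (gi : ∀ i j, i < j → j ≤ k → g i ≠ g j)
    (gc : ∀ i, i + 2 ≤ k → c s(g i, g (i+1)) ≠ c s(g (i+1), g (i+2)))
    (ha : ∀ i < l, G.Adj (h i) (h (i+1)))
    (hi : ∀ i j, i < j → j ≤ l → h i ≠ h j)
    (hc : ∀ i, i + 2 ≤ l → c s(h i, h (i+1)) ≠ c s(h (i+1), h (i+2)))
    (hd : ∀ i j, 0 < i → i < k → 0 < j → j < l → g i ≠ h j) : TP G c u v := by
  subst hg0 hgk
  obtain ⟨p, p1, p2, p3, -, p5⟩ := mkpath k g ga gi gc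
  obtain ⟨q', q1, q2, q3, -, q5⟩ := mkpath l h ha hi hc
  obtain ⟨q, q1, q2, q3, q5⟩ : ∃ q : G.Walk (g 0) (g k), q.IsPath ∧ ProperWalk c q ∧
    q.length = l ∧ (∀ x, x ∈ q.support → ∃ i ≤ l, h i = x) := by
    rw [← hh0, ← hhl]; exact ⟨q', q1, q2, q3, q5⟩
  have hdis : ∀ x, x ∈ p.support → x ∈ q.support → x = g 0 ∨ x = g k := by
    intro x hx hy
    obtain ⟨i, hik, rfl⟩ := p5 x hx
    obtain ⟨j, hjl, e⟩ := q5 _ hy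
    rcases Nat.eq_zero_or_pos i with rfl | hi0
    · exact Or.inl rfl
    rcases Nat.eq_zero_or_pos j with rfl | hj0
    · left; rw [← e, hh0]
    rcases hik.eq_or_lt with rfl | hik
    · exact Or.inr rfl
    rcases hjl.eq_or_lt with rfl | hjl
    · right; rw [← e, hhl]
    exact absurd e.symm (hd i j hi0 hik hj0 hjl)
  refine ⟨p, q, p1, q1, p2, q2, ?_, hdis⟩
  intro hpq
  have hkl' : k = l := by rw [← p3, ← q3, hpq]
  have h1 : p.getVert 1 ∈ p.support := p.getVert_mem_support 1
  have h2 := hdis _ h1 (hpq ▸ h1)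
  have e0 : p.getVert 0 = g 0 := p.getVert_zero
  have ek : p.getVert k = g k := by
    have := p.getVert_length
    rwa [p3] at this
  have inj := p1.getVert_injOn
  rcases h2 with h2 | h2
  · have := inj (by simp; omega) (by simp) (h2.trans e0.symm)
    omega
  · have := inj (by simp; omega) (by simp; omega) (h2.trans ek.symm)
    omega

/-- periodic description of a cycle of length `m` -/
structure Cyc {V : Type*} (G : SimpleGraph V) (m : ℕ) (f : ℕ → V) : Prop where
  per : ∀ i, f (i + m) = f i
  inj : ∀ i j, i < j → j < i + m → f i ≠ f j
  adj : ∀ i, G.Adj (f i) (f (i+1))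

theorem Cyc.of_path {V : Type*} {G : SimpleGraph V} {m : ℕ} {g : ℕ → V} (hm : 0 < m)
    (hi : ∀ i j, i < j → j < m → g i ≠ g j)
    (ha : ∀ i, i + 1 < m → G.Adj (g i) (g (i+1))) (hl : G.Adj (g (m-1)) (g 0)) :
    Cyc G m (fun i => g (i % m)) := by
  refine ⟨fun i => by simp, ?_, ?_⟩
  · intro i j hij hj he
    have h1 : i % m ≠ j % m := by
      intro h
      have h2 : m ∣ j - i := (Nat.modEq_iff_dvd' hij.le).1 h
      have := Nat.le_of_dvd (by omega) h2
      omega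
    have h3 := Nat.mod_lt i hm
    have h4 := Nat.mod_lt j hm
    rcases lt_or_gt_of_ne h1 with h | h
    · exact hi _ _ h h4 he
    · exact hi _ _ h h3 he.symm
  · intro i
    have h3 := Nat.mod_lt i hm
    show G.Adj (g (i % m)) (g ((i+1) % m))
    by_cases h : i % m + 1 < m
    · have : (i+1) % m = i % m + 1 := by
        rw [Nat.add_mod, Nat.mod_eq_of_lt (a := 1) (by omega), Nat.mod_eq_of_lt h]
      rw [this]; exact ha _ h
    · have h5 : i % m = m - 1 := by omega
      have : (i+1) % m = 0 := by
        rw [← Nat.mod_add_mod, h5, Nat.sub_add_cancel hm, Nat.mod_self]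
      rw [this, h5]; exact hl

theorem Cyc.shift {V : Type*} {G : SimpleGraph V} {m : ℕ} {f : ℕ → V} (h : Cyc G m f) (k : ℕ) :
    Cyc G m (fun i => f (k + i)) :=
  ⟨fun i => by rw [← add_assoc]; exact h.per _,
   fun i j hij hj => h.inj _ _ (by omega) (by omega), fun i => h.adj _⟩

theorem Cyc.exists_lt {V : Type*} {G : SimpleGraph V} {m : ℕ} {f : ℕ → V} (h : Cyc G m f)
    (hm : 0 < m) (i : ℕ) : ∃ j < m, f j = f i ∧ (Even m → j % 2 = i % 2) := by
  induction i using Nat.strong_induction_on with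
  | _ i ih =>
    by_cases hi : i < m
    · exact ⟨i, hi, rfl, fun _ => rfl⟩
    · obtain ⟨j, hj, e, he⟩ := ih (i - m) (by omega)
      refine ⟨j, hj, ?_, ?_⟩
      · rw [e, ← h.per, Nat.sub_add_cancel (by omega)]
      · intro hev
        rw [he hev]
        obtain ⟨r, rfl⟩ := hev
        omega

open Classical in
theorem exists_col {V : Type*} {G : SimpleGraph V} {m : ℕ} {f : ℕ → V} (h : Cyc G m f)
    (hm : 4 ≤ m) (he : Even m) (κ : ℕ → ℕ) :
    ∃ c : Sym2 V → ℕ, (∀ e, c e < 2) ∧ (∀ i, c s(f i, f (i+1)) = i % 2) ∧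
      ∀ v, (∀ i, f i ≠ v) → ∀ i < m, c s(v, f i) = κ i % 2 := by
  refine ⟨fun e => if (∃ i, i % 2 = 0 ∧ e = s(f i, f (i+1))) ∨
    (∃ v i, (∀ i, f i ≠ v) ∧ i < m ∧ κ i % 2 = 0 ∧ e = s(v, f i)) then 0 else 1, ?_, ?_, ?_⟩
  · intro e; dsimp only; split_ifs <;> omega
  · intro i
    dsimp only
    split_ifs with hh
    · rcases hh with ⟨j, hj, e⟩ | ⟨v, j, hv, _, _, e⟩
      · by_contra hi
        rw [Sym2.eq_iff] at e
        obtain ⟨i', hi', ei, pi⟩ := h.exists_lt (by omega) i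
        obtain ⟨j', hj', ej, pj⟩ := h.exists_lt (by omega) j
        have pi := pi he
        have pj := pj he
        rcases e with ⟨e, _⟩ | ⟨e1, e2⟩
        · rw [← ei, ← ej] at e
          rcases lt_trichotomy i' j' with hl | hl | hl
          · exact h.inj _ _ hl (by omega) e
          · omega
          · exact h.inj _ _ hl (by omega) e.symm
        · obtain ⟨k, hk, ek, pk⟩ := h.exists_lt (by omega) (j'+2)
          have n1 : f (i+1) = f (i'+1) := by
            have h1 := h.adj
            rcases lt_trichotomy i i' with hl | hl | hl
            · by_contra; 
              by_cases hh : i' < i + m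
              · exact h.inj _ _ hl hh ei.symm
              · omega
            · rw [hl]
            · -- i = i' + k m
              have key : ∀ a b, f a = f b → a < m → f (a+1) = f (b+1) := by
                intro a b
                induction b using Nat.strong_induction_on with
                | _ b ih =>
                  intro hab ha
                  by_cases hb : b < m
                  · rcases lt_trichotomy a b with hl | hl | hl
                    · exact absurd hab (h.inj _ _ hl (by omega))
                    · rw [hl]
                    · exact absurd hab.symm (h.inj _ _ hl (by omega))
                  · have e3 : f (b - m) = f b := by
                      rw [← h.per, Nat.sub_add_cancel (by omega)]
                    rw [ih (b-m) (by omega) (hab.trans e3.symm) ha, ← h.per]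
                    congr 1; omega
              exact (key i' i ei hi').symm
          have n2 : f (i'+1) = f j' := by rw [← n1, e2, ej]
          have : f i' = f (j'+1) := by
            have key : ∀ a b, f a = f b → a < m → f (a+1) = f (b+1) := by
                intro a b
                induction b using Nat.strong_induction_on with
                | _ b ih =>
                  intro hab ha
                  by_cases hb : b < m
                  · rcases lt_trichotomy a b with hl | hl | hl
                    · exact absurd hab (h.inj _ _ hl (by omega))
                    · rw [hl]
                    · exact absurd hab.symm (h.inj _ _ hl (by omega))
                  · have e3 : f (b - m) = f b := by
                      rw [← h.per, Nat.sub_add_cancel (by omega)]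
                    rw [ih (b-m) (by omega) (hab.trans e3.symm) ha, ← h.per]
                    congr 1; omega
            rw [key j' j ej hj', ei, e1]
          have hp := h.per i'
          rcases lt_trichotomy (i'+1) j' with hl | hl | hl
          · exact h.inj _ _ hl (by omega) n2
          · exact h.inj i' (j'+1) (by omega) (by omega) this
          · by_cases hh : i' + 1 < j' + m
            · exact h.inj _ _ hl hh n2.symm
            · exact h.inj (j'+1) i' (by omega) (by omega) this.symm
      · rw [Sym2.eq_iff] at e
        rcases e with ⟨e, _⟩ | ⟨_, e⟩
        · exact absurd e (hv _)
        · exact absurd e (hv _)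
    · have : i % 2 ≠ 0 := fun h0 => hh (Or.inl ⟨i, h0, rfl⟩)
      omega
  · intro v hv i hi
    dsimp only
    split_ifs with hh
    · rcases hh with ⟨j, hj, e⟩ | ⟨w, j, hw, hj, hκ, e⟩
      · rw [Sym2.eq_iff] at e
        rcases e with ⟨e, _⟩ | ⟨e, _⟩
        · exact absurd e.symm (hv _)
        · exact absurd e.symm (hv _)
      · rw [Sym2.eq_iff] at e
        rcases e with ⟨_, e⟩ | ⟨e, _⟩
        · rcases lt_trichotomy i j with hl | hl | hl
          · exact absurd e (h.inj _ _ hl (by omega))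
          · rw [hl, hκ]
          · exact absurd e.symm (h.inj _ _ hl (by omega))
        · exact absurd e.symm (hv _)
    · have : κ i % 2 ≠ 0 := fun h0 => hh (Or.inr ⟨v, i, hv, hi, h0, rfl⟩)
      omega

theorem TP_cyc {V : Type*} {G : SimpleGraph V} {m : ℕ} {f : ℕ → V} {c : Sym2 V → ℕ}
    (h : Cyc G m f) (hm : 4 ≤ m) (he : Even m) (hc : ∀ i, c s(f i, f (i+1)) = i % 2)
    (i j : ℕ) (hij : i < j) (hj : j < i + m) : TP G c (f i) (f j) := by
  refine mkTP (j - i) (i + m - j) (fun k => f (i + k)) (fun k => f (i + m - k))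
    rfl (h.per i) (by congr 1; omega) (by congr 1; omega) (by omega)
    (fun k _ => h.adj _) (fun a b hab hb => h.inj _ _ (by omega) (by omega)) ?_ ?_ ?_ ?_ ?_
  · intro k hk
    rw [← add_assoc, ← add_assoc, hc, hc (i+k+1)]
    omega
  · intro k hk
    have := h.adj (i + m - (k+1))
    rw [show i + m - (k+1) + 1 = i + m - k by omega] at this
    exact this.symm
  · intro a b hab hb
    exact (h.inj _ _ (by omega) (by omega)).symm
  · intro k hk
    have h1 := hc (i + m - (k+1))
    have h2 := hc (i + m - (k+2))
    rw [show i + m - (k+1) + 1 = i + m - k by omega, Sym2.eq_swap] at h1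
    rw [show i + m - (k+2) + 1 = i + m - (k+1) by omega, Sym2.eq_swap] at h2
    rw [h1, h2]; omega
  · intro a b ha ha' hb hb'
    exact h.inj _ _ (by omega) (by omega)

theorem TP_spoke {V : Type*} {G : SimpleGraph V} {m : ℕ} {f : ℕ → V} {c : Sym2 V → ℕ}
    (h : Cyc G m f) (hc : ∀ i, c s(f i, f (i+1)) = i % 2)
    (v : V) (hv : ∀ i, f i ≠ v) (p t q : ℕ) (hpt : p ≤ t) (htq : t ≤ q) (hpq : p < q)
    (hqp : q < p + m) (ap : G.Adj v (f p)) (aq : G.Adj v (f q))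
    (cp : c s(v, f p) = (p + 1) % 2) (cq : c s(v, f q) = q % 2) : TP G c v (f t) := by
  refine mkTP (t - p + 1) (q - t + 1) (fun k => if k = 0 then v else f (p + (k - 1)))
    (fun k => if k = 0 then v else f (q - (k - 1)))
    (by simp) (by simp) (by simp; congr 1; omega) (by simp; congr 1; omega) (by omega)
    ?_ ?_ ?_ ?_ ?_ ?_ ?_
  · intro k hk
    rcases k with _ | k
    · simpa using ap
    · simpa [add_assoc] using h.adj (p + k)
  · intro a b hab hb
    rcases b with _ | b
    · omega
    rcases a with _ | a
    · simpa using (hv _).symm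
    · simpa using h.inj (p+a) (p+b) (by omega) (by omega)
  · intro k hk
    rcases k with _ | k
    · have := hc p
      simp [cp, this]; omega
    · have h1 := hc (p + k)
      have h2 := hc (p + (k+1))
      simp only [Nat.add_eq_zero_iff, one_ne_zero, and_false, false_and, if_false, Nat.add_sub_cancel]
      rw [show k + 1 + 2 - 1 = k + 1 + 1 by omega]
      rw [show p + (k + 1 + 1) = p + (k+1) + 1 by omega, h2, ← add_assoc, h1]
      omega
  · intro k hk
    rcases k with _ | k
    · simpa using aq
    · have := h.adj (q - (k+1))
      rw [show q - (k+1) + 1 = q - k by omega] at this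
      simpa using this.symm
  · intro a b hab hb
    rcases b with _ | b
    · omega
    rcases a with _ | a
    · simpa using (hv _).symm
    · simpa using (h.inj (q-b) (q-a) (by omega) (by omega)).symm
  · intro k hk
    rcases k with _ | k
    · have := hc (q-1)
      rw [show q - 1 + 1 = q by omega, Sym2.eq_swap] at this
      simp [cq, this]; omega
    · have h1 := hc (q - (k+1))
      have h2 := hc (q - (k+2))
      rw [show q - (k+1) + 1 = q - k by omega, Sym2.eq_swap] at h1
      rw [show q - (k+2) + 1 = q - (k+1) by omega, Sym2.eq_swap] at h2
      simp only [Nat.add_eq_zero_iff, one_ne_zero, and_false, false_and, if_false, Nat.add_sub_cancel]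
      rw [show k + 1 + 2 - 1 = k + 2 by omega]
      rw [h1, h2]
      omega
  · intro a b ha ha' hb hb'
    rw [if_neg (by omega), if_neg (by omega)]
    exact h.inj _ _ (by omega) (by omega)

theorem even_case {V : Type*} {G : SimpleGraph V} {m : ℕ} {f : ℕ → V}
    (h : Cyc G m f) (hm : 4 ≤ m) (he : Even m) (hs : ∀ x, ∃ i < m, f i = x) :
    ∃ c : Sym2 V → ℕ, (∀ e, c e < 2) ∧ Is2ProperConnected G c := by
  obtain ⟨c, h1, h2, -⟩ := exists_col h hm he (fun _ => 0)
  refine ⟨c, h1, fun u v huv => ?_⟩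
  change TP G c u v
  obtain ⟨i, hi, rfl⟩ := hs u
  obtain ⟨j, hj, rfl⟩ := hs v
  rcases lt_trichotomy i j with hl | hl | hl
  · exact TP_cyc h hm he h2 _ _ hl (by omega)
  · exact absurd (by rw [hl]) huv
  · exact (TP_cyc h hm he h2 _ _ hl (by omega)).symm

theorem odd_case {V : Type*} {G : SimpleGraph V} {m : ℕ} {f : ℕ → V}
    (h : Cyc G m f) (hm : 4 ≤ m) (he : Even m) (v : V) (hv : ∀ i, f i ≠ v)
    (hs : ∀ x, x ≠ v → ∃ i < m, f i = x)
    (p₁ p₂ p₃ p₄ : ℕ) (h12 : p₁ < p₂) (h23 : p₂ < p₃) (h34 : p₃ < p₄) (h4 : p₄ < m)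
    (a1 : G.Adj v (f p₁)) (a2 : G.Adj v (f p₂)) (a3 : G.Adj v (f p₃)) (a4 : G.Adj v (f p₄)) :
    ∃ c : Sym2 V → ℕ, (∀ e, c e < 2) ∧ Is2ProperConnected G c := by
  obtain ⟨c, h1, h2, h3⟩ := exists_col h hm he (fun i => if i = p₁ ∨ i = p₃ then i + 1 else i)
  have h3 := h3 v hv
  have c1 := h3 p₁ (by omega)
  have c2 := h3 p₂ (by omega)
  have c3 := h3 p₃ (by omega)
  have c4 := h3 p₄ (by omega)
  rw [if_pos (by omega)] at c1 c3
  rw [if_neg (by omega)] at c2 c4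
  have key : ∀ t < m, TP G c v (f t) := by
    intro t ht
    have hwrap : ∀ t, p₄ ≤ t → t ≤ p₁ + m → TP G c v (f t) := by
      intro t ht1 ht2
      refine TP_spoke h h2 v hv p₃ t (p₂ + m) (by omega) (by omega) (by omega) (by omega) a3
        (by rwa [h.per]) c3 ?_
      rw [h.per, c2]
      obtain ⟨r, rfl⟩ := he
      omega
    rcases le_or_gt p₄ t with q4 | q4
    · exact hwrap t q4 (by omega)
    rcases le_or_gt p₃ t with q3 | q3
    · exact TP_spoke h h2 v hv p₃ t p₄ (by omega) (by omega) (by omega) (by omega) a3 a4 c3 c4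
    rcases le_or_gt p₂ t with q2 | q2
    · exact TP_spoke h h2 v hv p₁ t p₄ (by omega) (by omega) (by omega) (by omega) a1 a4 c1 c4
    rcases le_or_gt p₁ t with q1 | q1
    · exact TP_spoke h h2 v hv p₁ t p₂ (by omega) (by omega) (by omega) (by omega) a1 a2 c1 c2
    · rw [← h.per]
      exact hwrap _ (by omega) (by omega)
  refine ⟨c, h1, fun u w huv => ?_⟩
  change TP G c u w
  by_cases hu : u = v
  · subst hu
    obtain ⟨j, hj, rfl⟩ := hs w huv.symm
    exact key j hj
  by_cases hw : w = v
  · subst hw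
    obtain ⟨j, hj, rfl⟩ := hs u huv
    exact (key j hj).symm
  obtain ⟨i, hi, rfl⟩ := hs u hu
  obtain ⟨j, hj, rfl⟩ := hs w hw
  rcases lt_trichotomy i j with hl | hl | hl
  · exact TP_cyc h hm he h2 _ _ hl (by omega)
  · exact absurd (by rw [hl]) huv
  · exact (TP_cyc h hm he h2 _ _ hl (by omega)).symm

theorem deg_eq {V : Type*} [Fintype V] {G : SimpleGraph V} [DecidableRel G.Adj] (g : ℕ → V)
    (m : ℕ) (hi : ∀ i j, i < j → j < m → g i ≠ g j) (u : V)
    (hs : ∀ x, G.Adj u x → ∃ i < m, g i = x) :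
    G.degree u = ((Finset.range m).filter (fun i => G.Adj u (g i))).card := by
  classical
  rw [← SimpleGraph.card_neighborFinset_eq_degree]
  symm
  refine Finset.card_bij (fun i _ => g i) ?_ ?_ ?_
  · intro i h
    simpa using (Finset.mem_filter.1 h).2
  · intro i h j h' e
    have h1 := Finset.mem_range.1 (Finset.mem_filter.1 h).1
    have h2 := Finset.mem_range.1 (Finset.mem_filter.1 h').1
    rcases lt_trichotomy i j with hl | hl | hl
    · exact absurd e (hi _ _ hl h2)
    · exact hl
    · exact absurd e.symm (hi _ _ hl h1)
  · intro x hx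
    rw [SimpleGraph.mem_neighborFinset] at hx
    obtain ⟨i, him, rfl⟩ := hs x hx
    exact ⟨i, by simp [him, hx], rfl⟩

theorem crossing {V : Type*} [Fintype V] {G : SimpleGraph V} [DecidableRel G.Adj] (g : ℕ → V)
    (n s : ℕ) (hs1 : 1 ≤ s) (hn : 2 ≤ n) (hi : ∀ i j, i < j → j < n → g i ≠ g j)
    (hs : ∀ x, ∃ i < n, g i = x)
    (hd : n + s ≤ G.degree (g 0) + G.degree (g (n-1)) + 1) :
    ∃ a, a + s < n ∧ G.Adj (g 0) (g (a + s)) ∧ G.Adj (g (n-1)) (g a) := by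
  classical
  by_contra hcon
  push Not at hcon
  rw [deg_eq g n hi _ (fun x _ => hs x), deg_eq g n hi (g (n-1)) (fun x _ => hs x)] at hd
  set S := (Finset.range n).filter (fun i => G.Adj (g 0) (g i)) with hS
  set T := (Finset.range n).filter (fun i => G.Adj (g (n-1)) (g i)) with hT
  have hT' : (T.image (· + s)).card = T.card :=
    Finset.card_image_of_injective _ (add_left_injective s)
  have hdis : Disjoint S (T.image (· + s)) := by
    rw [Finset.disjoint_left]
    intro k hk hk'
    obtain ⟨a, ha, rfl⟩ := Finset.mem_image.1 hk'
    rw [hS, Finset.mem_filter, Finset.mem_range] at hk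
    rw [hT, Finset.mem_filter] at ha
    exact hcon a hk.1 hk.2 ha.2
  have hsub : S ∪ T.image (· + s) ⊆ Finset.Icc 1 (n - 2 + s) := by
    intro k hk
    rw [Finset.mem_Icc]
    rcases Finset.mem_union.1 hk with hk | hk
    · rw [hS, Finset.mem_filter, Finset.mem_range] at hk
      have : k ≠ 0 := by rintro rfl; exact G.loopless.irrefl _ hk.2
      omega
    · obtain ⟨a, ha, rfl⟩ := Finset.mem_image.1 hk
      rw [hT, Finset.mem_filter, Finset.mem_range] at ha
      have : a ≠ n - 1 := by rintro rfl; exact G.loopless.irrefl _ ha.2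
      omega
  have := Finset.card_le_card hsub
  rw [Finset.card_union_of_disjoint hdis, hT', Nat.card_Icc] at this
  omega

theorem reroute {V : Type*} {G : SimpleGraph V} (g : ℕ → V)
    (n a k : ℕ) (hak : a < k) (hk : k < n) (hi : ∀ i j, i < j → j < n → g i ≠ g j)
    (ha : ∀ i, i + 1 < n → G.Adj (g i) (g (i+1)))
    (h0 : G.Adj (g 0) (g k)) (h1 : G.Adj (g (n-1)) (g a)) :
    ∃ f, Cyc G (a + 1 + (n - k)) f ∧ ∀ x, a < x → x < k → ∀ i, f i ≠ g x := by
  have hi' : ∀ i j, i ≠ j → i < n → j < n → g i ≠ g j := by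
    intro i j hij h2 h3
    rcases lt_or_gt_of_ne hij with h | h
    · exact hi _ _ h h3
    · exact (hi _ _ h h2).symm
  refine ⟨_, Cyc.of_path (g := fun j => if j ≤ a then g j else g (n + a - j)) (by omega) ?_ ?_ ?_, ?_⟩
  · intro i j hij hj
    split_ifs <;> exact hi' _ _ (by omega) (by omega) (by omega)
  · intro i him
    split_ifs with q1 q2 q2
    · exact ha _ (by omega)
    · have : i = a := by omega
      subst this
      rw [show n + i - (i+1) = n - 1 by omega]
      exact h1.symm
    · omega
    · have := ha (n + a - (i+1)) (by omega)
      rw [show n + a - (i+1) + 1 = n + a - i by omega] at this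
      exact this.symm
  · simp only [Nat.zero_le, if_true]
    rw [if_neg (by omega), show n + a - (a + 1 + (n-k) - 1) = k by omega]
    exact h0.symm
  · intro x hx hxk i
    have := Nat.mod_lt i (show 0 < a + 1 + (n-k) by omega)
    generalize i % (a + 1 + (n-k)) = j at *
    split_ifs <;> exact hi' _ _ (by omega) (by omega) (by omega)

theorem Cyc.surj {V : Type*} [Fintype V] {G : SimpleGraph V} {f : ℕ → V} {m : ℕ} (h : Cyc G m f)
    (s : Finset V) (hs : ∀ i, f i ∈ s) (hc : s.card ≤ m) : ∀ x ∈ s, ∃ i < m, f i = x := by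
  classical
  intro x hx
  have h1 : ((Finset.range m).image f).card = m := by
    rw [Finset.card_image_of_injOn, Finset.card_range]
    intro i hi j hj e
    have hi := Finset.mem_range.1 hi
    have hj := Finset.mem_range.1 hj
    rcases lt_trichotomy i j with hl | hl | hl
    · exact absurd e (h.inj _ _ hl (by omega))
    · exact hl
    · exact absurd e.symm (h.inj _ _ hl (by omega))
  have h2 : (Finset.range m).image f = s := by
    apply Finset.eq_of_subset_of_card_le
    · intro y hy
      obtain ⟨i, _, rfl⟩ := Finset.mem_image.1 hy
      exact hs i
    · omega
  rw [← h2] at hx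
  obtain ⟨i, hi, e⟩ := Finset.mem_image.1 hx
  exact ⟨i, Finset.mem_range.1 hi, e⟩

open Classical in
theorem closure_ham {V : Type*} [Fintype V] (hn : 3 ≤ Fintype.card V) (G : SimpleGraph V) :
    (∀ H : SimpleGraph V, G ≤ H → H ≠ ⊤ → ∃ u v, u ≠ v ∧ ¬ H.Adj u v ∧
      Fintype.card V ≤ H.degree u + H.degree v) → ∃ f, Cyc G (Fintype.card V) f := by
  have : Finite (SimpleGraph V) := inferInstance
  induction G using WellFoundedGT.induction with
  | _ G ih =>
  intro hG
  by_cases ht : G = ⊤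
  · subst ht
    obtain e := (Fintype.equivFin V).symm
    set n := Fintype.card V with hnn
    refine ⟨_, Cyc.of_path (g := fun i => if hi : i < n then e ⟨i, hi⟩ else e ⟨0, by omega⟩)
      (by omega) ?_ ?_ ?_⟩
    · intro i j hij hj
      rw [dif_pos (by omega), dif_pos hj]
      intro h
      have := e.injective h
      simp at this
      omega
    · intro i hi
      rw [dif_pos (by omega), dif_pos hi, SimpleGraph.top_adj]
      intro h
      have := e.injective h
      simp at this
    · rw [dif_pos (by omega), dif_pos (by omega), SimpleGraph.top_adj]
      intro h
      have := e.injective h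
      simp at this
      omega
  obtain ⟨u, v, huv, hna, hd⟩ := hG G le_rfl ht
  have hadj : ∀ x y, (G ⊔ SimpleGraph.edge u v).Adj x y → ¬ G.Adj x y → s(x,y) = s(u,v) := by
    intro x y h h'
    rw [SimpleGraph.sup_adj, SimpleGraph.edge_adj] at h
    rw [Sym2.eq_iff]
    tauto
  have hlt : G < G ⊔ SimpleGraph.edge u v := by
    refine lt_of_le_of_ne le_sup_left ?_
    intro h
    apply hna
    rw [h, SimpleGraph.sup_adj, SimpleGraph.edge_adj]
    right
    exact ⟨Or.inl ⟨rfl, rfl⟩, huv⟩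
  obtain ⟨f, hf⟩ := ih _ hlt (fun H hH => hG H (hlt.le.trans hH))
  by_cases hall : ∀ i, G.Adj (f i) (f (i+1))
  · exact ⟨f, hf.per, hf.inj, hall⟩
  push Not at hall
  obtain ⟨i, hi⟩ := hall
  have he := hadj _ _ (hf.adj i) hi
  set n := Fintype.card V with hnn
  have hg := hf.shift (i+1)
  set g := fun j => f (i + 1 + j) with hgd
  have hl : g (n-1) = f i := by
    rw [← hf.per i, hgd]; dsimp only; congr 1; omega
  have h0 : g 0 = f (i+1) := rfl
  have hinj : ∀ i j, i < j → j < n → g i ≠ g j := fun i j hij hj => hg.inj i j hij (by omega)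
  have hpath : ∀ j, j + 1 < n → G.Adj (g j) (g (j+1)) := by
    intro j hj
    by_contra hcon
    have := hadj _ _ (hg.adj j) hcon
    rw [← he, ← hl, ← h0, Sym2.eq_iff] at this
    rcases this with ⟨e, _⟩ | ⟨e1, e2⟩
    · exact hinj _ _ (by omega) (by omega) e
    · by_cases hj0 : j = 0
      · subst hj0
        exact hinj _ _ (by omega) (by omega) e2
      · exact hinj 0 j (by omega) (by omega) e1.symm
  have hsurj : ∀ x, ∃ i < n, g i = x := fun x =>
    hg.surj Finset.univ (fun _ => Finset.mem_univ _) (by simp [hnn]) x (Finset.mem_univ _)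
  have hd' : n + 1 ≤ G.degree (g 0) + G.degree (g (n-1)) + 1 := by
    rw [hl, h0]
    rw [Sym2.eq_iff] at he
    rcases he with ⟨e1, e2⟩ | ⟨e1, e2⟩ <;> rw [e1, e2] <;> omega
  obtain ⟨a, ha, c1, c2⟩ := crossing g n 1 le_rfl (by omega) hinj hsurj hd'
  obtain ⟨f', hf', -⟩ := reroute g n a (a+1) (by omega) ha hinj hpath c1 c2
  refine ⟨f', ?_⟩
  rwa [show a + 1 + (n - (a+1)) = n by omega] at hf'

theorem ore {V : Type*} [Fintype V] (G : SimpleGraph V)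
    [DecidableRel G.Adj] (hn : 3 ≤ Fintype.card V)
    (hdeg : ∀ u v : V, u ≠ v → ¬ G.Adj u v →
      Fintype.card V ≤ G.degree u + G.degree v) : ∃ f, Cyc G (Fintype.card V) f := by
  classical
  apply closure_ham hn
  intro H hGH hH
  have : ∃ u v, u ≠ v ∧ ¬ H.Adj u v := by
    by_contra hcon
    push Not at hcon
    apply hH
    ext u v
    rw [SimpleGraph.top_adj]
    exact ⟨fun h => h.ne, hcon u v⟩
  obtain ⟨u, v, huv, h⟩ := this
  refine ⟨u, v, huv, h, ?_⟩
  have h1 := hdeg u v huv (fun h' => h (hGH h'))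
  have h2 : G.degree u ≤ H.degree u := SimpleGraph.degree_le_of_le hGH
  have h3 : G.degree v ≤ H.degree v := SimpleGraph.degree_le_of_le hGH
  omega

theorem bondy {V : Type*} [Fintype V] (G : SimpleGraph V)
    [DecidableRel G.Adj] (hn : 4 ≤ Fintype.card V) (hodd : Odd (Fintype.card V))
    (hdeg : ∀ u v : V, u ≠ v → ¬ G.Adj u v →
      Fintype.card V ≤ G.degree u + G.degree v) :
    ∃ f v, Cyc G (Fintype.card V - 1) f ∧ ∀ i, f i ≠ v := by
  obtain ⟨f, hf⟩ := ore G (by omega) hdeg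
  set n := Fintype.card V with hnn
  by_cases hch : ∃ i, G.Adj (f i) (f (i+2))
  · obtain ⟨i, hi⟩ := hch
    refine ⟨_, f (i+1), Cyc.of_path (g := fun j => f (i + 2 + j)) (by omega) ?_ ?_ ?_, ?_⟩
    · intro a b hab hb
      exact hf.inj _ _ (by omega) (by omega)
    · intro a _
      exact hf.adj _
    · rw [show i + 2 + (n - 1 - 1) = i + n by omega, hf.per]
      exact hi
    · intro j
      have := Nat.mod_lt j (show 0 < n - 1 by omega)
      exact (hf.inj _ _ (by omega) (by omega)).symm
  push Not at hch
  have h1 : ∀ i, n ≤ G.degree (f i) + G.degree (f (i+2)) := fun i =>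
    hdeg _ _ (hf.inj _ _ (by omega) (by omega)) (hch i)
  have h2 : ∃ i, n + 1 ≤ G.degree (f i) + G.degree (f (i+1)) := by
    by_contra hcon
    push Not at hcon
    have hm : Monotone (fun i => G.degree (f (i+1))) := by
      apply monotone_nat_of_le_succ
      intro i
      have := h1 i
      have := hcon i
      change G.degree (f (i+1)) ≤ G.degree (f (i+2))
      omega
    have e1 : G.degree (f 1) ≤ G.degree (f 2) := hm (show 0 ≤ 1 by omega)
    have e2 : G.degree (f 2) ≤ G.degree (f (0 + n + 1)) := hm (show 1 ≤ 0 + n by omega)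
    have e4 : G.degree (f 3) ≤ G.degree (f (0 + n + 1)) := hm (show 2 ≤ 0 + n by omega)
    rw [show 0 + n + 1 = 1 + n by omega, hf.per] at e2 e4
    have e5 : n ≤ G.degree (f 1) + G.degree (f 3) := h1 1
    have e6 : G.degree (f 1) + G.degree (f 2) < n + 1 := hcon 1
    obtain ⟨r, hr⟩ := hodd
    omega
  obtain ⟨i, hi⟩ := h2
  have hg := hf.shift (i+1)
  set g := fun j => f (i + 1 + j) with hgd
  have hl : g (n-1) = f i := by
    rw [← hf.per i, hgd]; dsimp only; congr 1; omega
  have h0 : g 0 = f (i+1) := rfl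
  have hinj : ∀ i j, i < j → j < n → g i ≠ g j := fun i j hij hj => hg.inj i j hij (by omega)
  have hsurj : ∀ x, ∃ i < n, g i = x := fun x =>
    hg.surj Finset.univ (fun _ => Finset.mem_univ _) (by simp [hnn]) x (Finset.mem_univ _)
  obtain ⟨a, ha, c1, c2⟩ := crossing (G := G) g n 2 (by omega) (by omega) hinj hsurj (by
    rw [hl, h0]; omega)
  obtain ⟨f', hf', hx⟩ := reroute g n a (a+2) (by omega) ha hinj (fun i _ => hg.adj i) c1 c2
  refine ⟨f', g (a+1), ?_, hx _ (by omega) (by omega)⟩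
  rwa [show a + 1 + (n - (a+2)) = n - 1 by omega] at hf'

theorem deg_ge {V : Type*} [Fintype V] (x : V) (H : SimpleGraph {y : V // y ≠ x})
    [Fintype {y : V // y ≠ x}]
    [DecidableRel H.Adj] (w : {y : V // y ≠ x}) (s : Finset V)
    (hs : ∀ y ∈ s, ∃ hy : y ≠ x, H.Adj w ⟨y, hy⟩) : s.card ≤ H.degree w := by
  classical
  have : s ⊆ (H.neighborFinset w).image Subtype.val := by
    intro y hy
    obtain ⟨h1, h2⟩ := hs y hy
    rw [Finset.mem_image]
    exact ⟨⟨y, h1⟩, by simpa using h2, rfl⟩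
  exact (Finset.card_le_card this).trans Finset.card_image_le

theorem lowdeg {V : Type*} [Fintype V] [DecidableEq V] (G : SimpleGraph V)
    [DecidableRel G.Adj] (hn : 7 ≤ Fintype.card V)
    (hdeg : ∀ u v : V, u ≠ v → ¬ G.Adj u v →
      Fintype.card V ≤ G.degree u + G.degree v) (v : V) (hmin : ∀ u, G.degree v ≤ G.degree u)
    (hv : G.degree v ≤ 3) :
    ∃ f x, Cyc G (Fintype.card V - 1) f ∧ (∀ i, f i ≠ x) ∧ 4 ≤ G.degree x := by
  set n := Fintype.card V with hnn
  have hx : ∃ x, x ≠ v ∧ ¬ G.Adj v x := by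
    by_contra hcon
    push Not at hcon
    have : Finset.univ.erase v ⊆ G.neighborFinset v := by
      intro y hy
      simpa using hcon y (Finset.ne_of_mem_erase hy)
    have := Finset.card_le_card this
    rw [Finset.card_erase_of_mem (Finset.mem_univ _), Finset.card_univ,
      SimpleGraph.card_neighborFinset_eq_degree] at this
    omega
  obtain ⟨x, hxv, hvx⟩ := hx
  have hnon : ∀ y, y ≠ v → ¬ G.Adj v y → n ≤ G.degree v + G.degree y := fun y h1 h2 =>
    hdeg v y h1.symm h2
  have hcard : Fintype.card {y : V // y ≠ x} = n - 1 := by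
    rw [Fintype.card_subtype_compl, Fintype.card_subtype_eq]
  have herase : ∀ y, G.degree y ≤ ((G.neighborFinset y).erase x).card + 1 := by
    intro y
    rw [← SimpleGraph.card_neighborFinset_eq_degree]
    have := Finset.pred_card_le_card_erase (s := G.neighborFinset y) (a := x)
    omega
  obtain ⟨f, hf⟩ := closure_ham (by omega) (G.comap (Subtype.val : {y : V // y ≠ x} → V)) (by
    classical
    intro H hGH hH
    by_contra hcon
    push Not at hcon
    rw [hcard] at hcon
    apply hH
    have hGH' : ∀ (w : {y : V // y ≠ x}) y, (hy : y ≠ x) → G.Adj w y → H.Adj w ⟨y, hy⟩ :=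
      fun w y hy h => hGH h
    have e1 : ∀ w : {y : V // y ≠ x}, G.degree w ≤ H.degree w + 1 := by
      intro w
      refine (herase w).trans (Nat.add_le_add_right ?_ 1)
      convert deg_ge x H w _ ?_
      intro y hy
      rw [Finset.mem_erase, SimpleGraph.mem_neighborFinset] at hy
      exact ⟨hy.1, hGH' w y hy.1 hy.2⟩
    have ev : G.degree v ≤ H.degree ⟨v, hxv.symm⟩ := by
      rw [← SimpleGraph.card_neighborFinset_eq_degree]
      convert deg_ge x H ⟨v, hxv.symm⟩ _ ?_
      intro y hy
      rw [SimpleGraph.mem_neighborFinset] at hy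
      have hyx : y ≠ x := by rintro rfl; exact hvx hy
      exact ⟨hyx, hGH' _ y hyx hy⟩
    have uv : ∀ w : {y : V // y ≠ x}, ⟨v, hxv.symm⟩ ≠ w → H.Adj ⟨v, hxv.symm⟩ w := by
      intro w hw
      by_contra hna
      have h1 := hcon _ _ hw hna
      have h2 := hnon w (fun h => hw (Subtype.ext h.symm)) (fun h => hna (hGH' _ _ w.2 h))
      have h3 := e1 w
      omega
    have uy : ∀ y : {y : V // y ≠ x}, (y : V) ≠ v → ¬ G.Adj v y → ∀ w, y ≠ w → H.Adj y w := by
      intro y hyv hy w hyw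
      by_contra hna
      have h1 := hcon _ _ hyw hna
      have h2 := hnon y hyv hy
      have h3 := e1 w
      have h4 := hmin w
      have h5 : (insert v ((G.neighborFinset (y : V)).erase x)).card ≤ H.degree y := by
        convert deg_ge x H y _ ?_
        intro z hz
        rw [Finset.mem_insert, Finset.mem_erase, SimpleGraph.mem_neighborFinset] at hz
        rcases hz with rfl | hz
        · exact ⟨hxv.symm, (uv y (fun h => hyv (by rw [← h]))).symm⟩
        · exact ⟨hz.1, hGH' y z hz.1 hz.2⟩
      rw [Finset.card_insert_of_notMem (by
        rw [Finset.mem_erase, SimpleGraph.mem_neighborFinset]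
        exact fun h => hy h.2.symm)] at h5
      have h6 := herase y
      omega
    have da : ∀ a : {y : V // y ≠ x}, G.Adj v a → n ≤ H.degree a + G.degree v + 1 := by
      intro a hva
      have h5 : ((G.neighborFinset v)ᶜ.erase x).card ≤ H.degree a := by
        convert deg_ge x H a _ ?_
        intro z hz
        rw [Finset.mem_erase, Finset.mem_compl, SimpleGraph.mem_neighborFinset] at hz
        refine ⟨hz.1, ?_⟩
        have hne : (⟨z, hz.1⟩ : {y : V // y ≠ x}) ≠ a := by
          intro h
          apply hz.2
          rw [← h] at hva
          exact hva
        by_cases hzv : z = v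
        · subst hzv
          exact (uv a hne).symm
        · exact (uy ⟨z, hz.1⟩ hzv hz.2 a hne).symm
      rw [Finset.card_erase_of_mem (by simpa using hvx), Finset.card_compl,
        SimpleGraph.card_neighborFinset_eq_degree] at h5
      omega
    ext a b
    rw [SimpleGraph.top_adj]
    refine ⟨fun h => h.ne, fun hab => ?_⟩
    by_cases hav : (a : V) = v
    · have : a = ⟨v, hxv.symm⟩ := Subtype.ext hav
      subst this
      exact uv b hab
    by_cases hbv : (b : V) = v
    · have : b = ⟨v, hxv.symm⟩ := Subtype.ext hbv
      subst this
      exact (uv a hab.symm).symm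
    by_cases hva : G.Adj v a
    · by_cases hvb : G.Adj v b
      · by_contra hna
        have h1 := hcon _ _ hab hna
        have h2 := da a hva
        have h3 := da b hvb
        omega
      · exact (uy b hbv hvb a hab.symm).symm
    · exact uy a hav hva b hab)
  rw [hcard] at hf
  refine ⟨fun i => (f i : V), x, ⟨fun i => by rw [hf.per], ?_, fun i => hf.adj i⟩,
    fun i => (f i).2, ?_⟩
  · intro i j hij hj h
    exact hf.inj i j hij hj (Subtype.ext h)
  · have := hnon x hxv hvx
    omega

theorem wheel_case {V : Type*} [Fintype V] [DecidableEq V] (G : SimpleGraph V)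
    [DecidableRel G.Adj] (hn : 5 ≤ Fintype.card V) (hodd : Odd (Fintype.card V))
    (f : ℕ → V) (x : V) (hf : Cyc G (Fintype.card V - 1) f) (hx : ∀ i, f i ≠ x)
    (hd : 4 ≤ G.degree x) :
    ∃ c : Sym2 V → ℕ, (∀ e, c e < 2) ∧ Is2ProperConnected G c := by
  have hs : ∀ y, y ≠ x → ∃ i < Fintype.card V - 1, f i = y := by
    intro y hy
    refine hf.surj (Finset.univ.erase x) (fun i => by simpa using hx i) ?_ y (by simpa using hy)
    rw [Finset.card_erase_of_mem (Finset.mem_univ _), Finset.card_univ]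
  rw [deg_eq f (Fintype.card V - 1) (fun i j h1 h2 => hf.inj i j h1 (by omega)) x
    (fun y hy => hs y hy.ne')] at hd
  set S := (Finset.range (Fintype.card V - 1)).filter (fun i => G.Adj x (f i)) with hS
  let e := S.orderEmbOfCardLe hd
  have he : ∀ i, e i ∈ S := fun i => Finset.orderEmbOfCardLe_mem S hd i
  have he1 : ∀ i, e i < Fintype.card V - 1 := fun i =>
    Finset.mem_range.1 (Finset.mem_filter.1 (he i)).1
  have he2 : ∀ i, G.Adj x (f (e i)) := fun i => (Finset.mem_filter.1 (he i)).2
  refine odd_case hf (by omega) ?_ x hx hs (e 0) (e 1) (e 2) (e 3)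
    (e.strictMono (by decide)) (e.strictMono (by decide)) (e.strictMono (by decide)) (he1 3)
    (he2 0) (he2 1) (he2 2) (he2 3)
  obtain ⟨r, hr⟩ := hodd
  exact ⟨r, by omega⟩

open Classical in
theorem five_col {V : Type*} (G : SimpleGraph V) (a b y z w : V)
    (hab : a ≠ b) (hyz : y ≠ z) (hyw : y ≠ w) (hzw : z ≠ w)
    (ay : G.Adj a y) (az : G.Adj a z) (aw : G.Adj a w)
    (by' : G.Adj b y) (bz : G.Adj b z) (bw : G.Adj b w) (yz : G.Adj y z)
    (hcov : ∀ x, x = a ∨ x = b ∨ x = y ∨ x = z ∨ x = w) :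
    ∃ c : Sym2 V → ℕ, (∀ e, c e < 2) ∧ Is2ProperConnected G c := by
  have nay := ay.ne
  have naz := az.ne
  have naw := aw.ne
  have nby := by'.ne
  have nbz := bz.ne
  have nbw := bw.ne
  obtain ⟨c, hc2, c1, c2, c3, c4, c5, c6, c7⟩ : ∃ c : Sym2 V → ℕ, (∀ e, c e < 2) ∧
      c s(a,y) = 0 ∧ c s(a,z) = 0 ∧ c s(a,w) = 1 ∧ c s(b,y) = 1 ∧ c s(b,z) = 1 ∧ c s(b,w) = 0 ∧
      c s(y,z) = 0 := by
    refine ⟨fun e => if e = s(a,y) ∨ e = s(a,z) ∨ e = s(b,w) ∨ e = s(y,z) then 0 else 1,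
      ?_, ?_, ?_, ?_, ?_, ?_, ?_, ?_⟩
    · intro e; dsimp only; split_ifs <;> omega
    all_goals simp [*, Ne.symm, hab.symm, hyz.symm, hyw.symm, hzw.symm, nay.symm, naz.symm,
      naw.symm, nby.symm, nbz.symm, nbw.symm]
  have c1' : c s(y,a) = 0 := by rw [Sym2.eq_swap, c1]
  have c2' : c s(z,a) = 0 := by rw [Sym2.eq_swap, c2]
  have c3' : c s(w,a) = 1 := by rw [Sym2.eq_swap, c3]
  have c4' : c s(y,b) = 1 := by rw [Sym2.eq_swap, c4]
  have c5' : c s(z,b) = 1 := by rw [Sym2.eq_swap, c5]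
  have c6' : c s(w,b) = 0 := by rw [Sym2.eq_swap, c6]
  have c7' : c s(z,y) = 0 := by rw [Sym2.eq_swap, c7]
  have t_ab : TP G c a b := by
    refine ⟨.cons ay (.cons by'.symm .nil), .cons az (.cons bz.symm .nil), ?_, ?_, ?_, ?_,
      fun h => ?_, ?_⟩
    pick_goal 5
    · have := congrArg SimpleGraph.Walk.support h
      simp at this; grind
    all_goals simp [ProperWalk, List.Chain', *]
    all_goals grind
  have t_ay : TP G c a y := by
    refine ⟨.cons ay .nil, .cons aw (.cons bw.symm (.cons by' .nil)), ?_, ?_, ?_, ?_,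
      fun h => ?_, ?_⟩
    pick_goal 5
    · have := congrArg SimpleGraph.Walk.support h
      simp at this
    all_goals simp [ProperWalk, List.Chain', *]
    all_goals grind
  have t_az : TP G c a z := by
    refine ⟨.cons az .nil, .cons aw (.cons bw.symm (.cons bz .nil)), ?_, ?_, ?_, ?_,
      fun h => ?_, ?_⟩
    pick_goal 5
    · have := congrArg SimpleGraph.Walk.support h
      simp at this
    all_goals simp [ProperWalk, List.Chain', *]
    all_goals grind
  have t_aw : TP G c a w := by
    refine ⟨.cons aw .nil, .cons ay (.cons by'.symm (.cons bw .nil)), ?_, ?_, ?_, ?_,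
      fun h => ?_, ?_⟩
    pick_goal 5
    · have := congrArg SimpleGraph.Walk.support h
      simp at this
    all_goals simp [ProperWalk, List.Chain', *]
    all_goals grind
  have t_by : TP G c b y := by
    refine ⟨.cons by' .nil, .cons bz (.cons yz.symm .nil), ?_, ?_, ?_, ?_,
      fun h => ?_, ?_⟩
    pick_goal 5
    · have := congrArg SimpleGraph.Walk.support h
      simp at this
    all_goals simp [ProperWalk, List.Chain', *]
    all_goals grind
  have t_bz : TP G c b z := by
    refine ⟨.cons bz .nil, .cons by' (.cons yz .nil), ?_, ?_, ?_, ?_,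
      fun h => ?_, ?_⟩
    pick_goal 5
    · have := congrArg SimpleGraph.Walk.support h
      simp at this
    all_goals simp [ProperWalk, List.Chain', *]
    all_goals grind
  have t_bw : TP G c b w := by
    refine ⟨.cons bw .nil, .cons by' (.cons ay.symm (.cons aw .nil)), ?_, ?_, ?_, ?_,
      fun h => ?_, ?_⟩
    pick_goal 5
    · have := congrArg SimpleGraph.Walk.support h
      simp at this
    all_goals simp [ProperWalk, List.Chain', *]
    all_goals grind
  have t_yz : TP G c y z := by
    refine ⟨.cons yz .nil, .cons ay.symm (.cons aw (.cons bw.symm (.cons bz .nil))), ?_, ?_, ?_, ?_,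
      fun h => ?_, ?_⟩
    pick_goal 5
    · have := congrArg SimpleGraph.Walk.support h
      simp at this
    all_goals simp [ProperWalk, List.Chain', *]
    all_goals grind
  have t_yw : TP G c y w := by
    refine ⟨.cons ay.symm (.cons aw .nil), .cons by'.symm (.cons bw .nil), ?_, ?_, ?_, ?_,
      fun h => ?_, ?_⟩
    pick_goal 5
    · have := congrArg SimpleGraph.Walk.support h
      simp at this; grind
    all_goals simp [ProperWalk, List.Chain', *]
    all_goals grind
  have t_zw : TP G c z w := by
    refine ⟨.cons az.symm (.cons aw .nil), .cons bz.symm (.cons bw .nil), ?_, ?_, ?_, ?_,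
      fun h => ?_, ?_⟩
    pick_goal 5
    · have := congrArg SimpleGraph.Walk.support h
      simp at this; grind
    all_goals simp [ProperWalk, List.Chain', *]
    all_goals grind
  refine ⟨c, hc2, fun u v huv => ?_⟩
  change TP G c u v
  rcases hcov u with rfl | rfl | rfl | rfl | rfl <;>
  rcases hcov v with rfl | rfl | rfl | rfl | rfl <;>
  first
  | exact absurd rfl huv
  | assumption
  | (apply TP.symm; assumption)

theorem cover5 {V : Type*} [Fintype V] [DecidableEq V] (hn : Fintype.card V = 5) (a b y z w : V)
    (hab : a ≠ b) (hyz : y ≠ z) (hyw : y ≠ w) (hzw : z ≠ w) (hay : a ≠ y) (haz : a ≠ z)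
    (haw : a ≠ w) (hby : b ≠ y) (hbz : b ≠ z) (hbw : b ≠ w) :
    ∀ x, x = a ∨ x = b ∨ x = y ∨ x = z ∨ x = w := by
  intro x
  have : ({a, b, y, z, w} : Finset V) = Finset.univ := by
    apply Finset.eq_univ_of_card
    rw [hn]
    simp [*]
  have hx := Finset.mem_univ x
  rw [← this] at hx
  simpa using hx

theorem five {V : Type*} [Fintype V] [DecidableEq V] (G : SimpleGraph V)
    [DecidableRel G.Adj] (hn : Fintype.card V = 5)
    (hdeg : ∀ u v : V, u ≠ v → ¬ G.Adj u v →
      Fintype.card V ≤ G.degree u + G.degree v) :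
    ∃ c : Sym2 V → ℕ, (∀ e, c e < 2) ∧ Is2ProperConnected G c := by
  obtain ⟨f, v, hf, hv⟩ := bondy G (by omega) (by rw [hn]; decide) hdeg
  rw [hn] at hdeg hf
  norm_num at hf
  by_cases hd : 3 ≤ G.degree v
  · have hs : ∀ y, y ≠ v → ∃ i < 4, f i = y := by
      intro y hy
      refine hf.surj (Finset.univ.erase v) (fun i => by simpa using hv i) ?_ y (by simpa using hy)
      rw [Finset.card_erase_of_mem (Finset.mem_univ _), Finset.card_univ, hn]
    rw [deg_eq f 4 (fun i j h1 h2 => hf.inj i j h1 (by omega)) v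
      (fun y hy => hs y hy.ne')] at hd
    have hk : ∃ k, G.Adj v (f k) ∧ G.Adj v (f (k+1)) ∧ G.Adj v (f (k+2)) := by
      have p0 := hf.per 0
      have p1 := hf.per 1
      norm_num at p0 p1
      rw [show Finset.range 4 = {0,1,2,3} by decide] at hd
      by_cases q0 : G.Adj v (f 0) <;> by_cases q1 : G.Adj v (f 1) <;>
      by_cases q2 : G.Adj v (f 2) <;> by_cases q3 : G.Adj v (f 3) <;>
      first
      | exact ⟨0, q0, q1, q2⟩
      | exact ⟨1, q1, q2, q3⟩
      | exact ⟨2, q2, q3, by rw [p0]; exact q0⟩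
      | exact ⟨3, q3, by rw [p0]; exact q0, by rw [p1]; exact q1⟩
      | (exfalso; simp [Finset.filter_insert, Finset.filter_singleton, q0, q1, q2, q3] at hd)
    obtain ⟨k, k0, k1, k2⟩ := hk
    have n01 := hf.inj k (k+1) (by omega) (by omega)
    have n02 := hf.inj k (k+2) (by omega) (by omega)
    have n03 := hf.inj k (k+3) (by omega) (by omega)
    have n12 := hf.inj (k+1) (k+2) (by omega) (by omega)
    have n13 := hf.inj (k+1) (k+3) (by omega) (by omega)
    have n23 := hf.inj (k+2) (k+3) (by omega) (by omega)
    have a30 := hf.adj (k+3)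
    rw [hf.per k] at a30
    exact five_col G (f k) (f (k+2)) (f (k+1)) v (f (k+3)) n02 (hv _) n13 (hv _).symm
      (hf.adj k) k0.symm a30.symm (hf.adj (k+1)).symm k2.symm (hf.adj (k+2)) k1.symm
      (cover5 hn _ _ _ _ _ n02 (hv _) n13 (hv _).symm n01 (hv _) n03 n12.symm (hv _) n23)
  · have hN : (G.neighborFinset v).card ≤ 2 := by
      rw [SimpleGraph.card_neighborFinset_eq_degree]; omega
    have hY : 1 < ((Finset.univ.erase v) \ G.neighborFinset v).card := by
      have := Finset.le_card_sdiff (G.neighborFinset v) (Finset.univ.erase v)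
      rw [Finset.card_erase_of_mem (Finset.mem_univ _), Finset.card_univ, hn] at this
      omega
    obtain ⟨y, hy, z, hz, hyz⟩ := Finset.one_lt_card.1 hY
    have key : ∀ y, y ∈ (Finset.univ.erase v) \ G.neighborFinset v → y ≠ v ∧ ¬ G.Adj v y ∧
        2 ≤ G.degree v ∧ ∀ u, u ≠ v → u ≠ y → G.Adj y u := by
      intro y hy
      rw [Finset.mem_sdiff, SimpleGraph.mem_neighborFinset] at hy
      have hyv := Finset.ne_of_mem_erase hy.1
      have h1 := hdeg v y hyv.symm hy.2
      have hsub : G.neighborFinset y ⊆ (Finset.univ.erase v).erase y := by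
        intro u hu
        rw [SimpleGraph.mem_neighborFinset] at hu
        rw [Finset.mem_erase, Finset.mem_erase]
        refine ⟨hu.ne', ?_, Finset.mem_univ _⟩
        rintro rfl
        exact hy.2 hu.symm
      have hc : ((Finset.univ.erase v).erase y).card = 3 := by
        rw [Finset.card_erase_of_mem hy.1, Finset.card_erase_of_mem (Finset.mem_univ _),
          Finset.card_univ, hn]
      have h2 := Finset.card_le_card hsub
      rw [hc, SimpleGraph.card_neighborFinset_eq_degree] at h2
      refine ⟨hyv, hy.2, by omega, ?_⟩
      have heq := Finset.eq_of_subset_of_card_le hsub (by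
        rw [hc, SimpleGraph.card_neighborFinset_eq_degree]; omega)
      intro u hu hu'
      rw [← SimpleGraph.mem_neighborFinset, heq]
      simp [hu, hu']
    obtain ⟨y1, y2, y3, y4⟩ := key y hy
    obtain ⟨z1, z2, -, z4⟩ := key z hz
    obtain ⟨a, b, hab, hNab⟩ := Finset.card_eq_two.1 (show (G.neighborFinset v).card = 2 by
      rw [SimpleGraph.card_neighborFinset_eq_degree] at *; omega)
    have va : G.Adj v a := by rw [← SimpleGraph.mem_neighborFinset, hNab]; simp
    have vb : G.Adj v b := by rw [← SimpleGraph.mem_neighborFinset, hNab]; simp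
    have nay : a ≠ y := by rintro rfl; exact y2 va
    have naz : a ≠ z := by rintro rfl; exact z2 va
    have nby : b ≠ y := by rintro rfl; exact y2 vb
    have nbz : b ≠ z := by rintro rfl; exact z2 vb
    exact five_col G a b y z v hab hyz y1 z1 (y4 a va.ne' nay).symm (z4 a va.ne' naz).symm va.symm
      (y4 b vb.ne' nby).symm (z4 b vb.ne' nbz).symm vb.symm (y4 z z1 hyz.symm)
      (cover5 hn _ _ _ _ _ hab hyz y1 z1 nay naz va.ne' nby nbz vb.ne')

theorem lower {V : Type*} [Fintype V] (G : SimpleGraph V) (hn : 4 ≤ Fintype.card V)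
    (c : Sym2 V → ℕ) (k : ℕ) (hk : k < 2) (hc : ∀ e ∈ G.edgeSet, c e < k)
    (h : Is2ProperConnected G c) : False := by
  obtain ⟨u, v, huv⟩ := Fintype.exists_pair_of_one_lt_card (show 1 < Fintype.card V by omega)
  have key : ∀ p : G.Walk u v, ProperWalk c p → ∃ h : G.Adj u v, p = .cons h .nil := by
    intro p hp
    rcases p with _ | ⟨h1, p⟩
    · exact absurd rfl huv
    rcases p with _ | ⟨h2, p⟩
    · exact ⟨h1, rfl⟩
    exfalso
    simp [ProperWalk, List.Chain'] at hp
    have e1 := hc _ ((SimpleGraph.mem_edgeSet G).2 h1)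
    have e2 := hc _ ((SimpleGraph.mem_edgeSet G).2 h2)
    apply hp.1
    omega
  obtain ⟨p, q, -, -, hp, hq, hne, -⟩ := h u v huv
  obtain ⟨h1, e1⟩ := key p hp
  obtain ⟨h2, e2⟩ := key q hq
  exact hne (e1.trans e2.symm)

theorem stmt10 {V : Type*} [Fintype V] [DecidableEq V] (G : SimpleGraph V)
    [DecidableRel G.Adj] (hn : 4 ≤ Fintype.card V)
    (hdeg : ∀ u v : V, u ≠ v → ¬ G.Adj u v →
      Fintype.card V ≤ G.degree u + G.degree v) :
    pc2 G = 2 := by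
  have main : ∃ c : Sym2 V → ℕ, (∀ e, c e < 2) ∧ Is2ProperConnected G c := by
    rcases Nat.even_or_odd (Fintype.card V) with hev | hodd
    · obtain ⟨f, hf⟩ := ore G (by omega) hdeg
      exact even_case hf hn hev (fun x => hf.surj Finset.univ (fun _ => Finset.mem_univ _)
        (by simp) x (Finset.mem_univ _))
    by_cases h5 : Fintype.card V = 5
    · exact five G h5 hdeg
    have h7 : 7 ≤ Fintype.card V := by
      obtain ⟨r, hr⟩ := hodd
      omega
    by_cases hlow : ∃ u, G.degree u ≤ 3
    · obtain ⟨u, hu⟩ := hlow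
      obtain ⟨v, -, hv⟩ := Finset.exists_min_image Finset.univ (fun v => G.degree v)
        ⟨u, Finset.mem_univ u⟩
      obtain ⟨f, x, hf, hx, hd⟩ := lowdeg G h7 hdeg v (fun w => hv w (Finset.mem_univ _))
        ((hv u (Finset.mem_univ _)).trans hu)
      exact wheel_case G (by omega) hodd f x hf hx hd
    · push Not at hlow
      obtain ⟨f, x, hf, hx⟩ := bondy G hn hodd hdeg
      exact wheel_case G (by omega) hodd f x hf hx (hlow x)
  obtain ⟨c, hc, h2⟩ := main
  have hmem : 2 ∈ {k | ∃ c : Sym2 V → ℕ, (∀ e ∈ G.edgeSet, c e < k) ∧ Is2ProperConnected G c} :=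
    ⟨c, fun e _ => hc e, h2⟩
  unfold pc2
  apply le_antisymm
  · exact Nat.sInf_le hmem
  · apply le_csInf ⟨2, hmem⟩
    rintro k ⟨c', hc', h2'⟩
    by_contra hk
    exact lower G hn c' k (by omega) hc' h2'
end

section
/- Let G be a simple graph with n ≥ 6 vertices and at least C(n−1, 2) + 3 edges. Then for any two distinct vertices u, v of G, there is a 2-connected bipartite spanning subgraph of G in which u and v lie in the same part of the bipartition. -/
/-- A graph is 2-connected if it has at least 3 vertices and deleting any single vertex
leaves a connected graph. -/
def TwoConnected {V : Type*} (G : SimpleGraph V) : Prop :=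
  3 ≤ Nat.card V ∧ ∀ v : V, (G.induce {w : V | w ≠ v}).Connected

open Classical in
noncomputable def nonadjF {V : Type*} (G : SimpleGraph V) (x y : V) : ℕ :=
  if x ≠ y ∧ ¬ G.Adj x y then 1 else 0

def stepR {V : Type*} (G : SimpleGraph V) (s : Set V) (S : Finset V) (z x y : V) : Prop :=
  x ∈ S ∧ y ∈ S ∧ x ≠ z ∧ y ≠ z ∧ G.Adj x y ∧ (x ∈ s ↔ y ∉ s)

theorem stepR_symm {V : Type*} {G : SimpleGraph V} {s : Set V} {S : Finset V} {z x y : V}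
    (h : stepR G s S z x y) : stepR G s S z y x := by
  obtain ⟨h1, h2, h3, h4, h5, h6⟩ := h
  exact ⟨h2, h1, h4, h3, h5.symm, by tauto⟩

theorem stepR_hub {V : Type*} {G : SimpleGraph V} {s : Set V} {S : Finset V} {z h : V}
    (H : ∀ a ∈ S, a ≠ z → Relation.ReflTransGen (stepR G s S z) a h) :
    ∀ a ∈ S, ∀ b ∈ S, a ≠ z → b ≠ z → Relation.ReflTransGen (stepR G s S z) a b := by
  intro a ha b hb haz hbz
  haveI : Std.Symm (stepR G s S z) := ⟨fun _ _ h => stepR_symm h⟩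
  exact (H a ha haz).trans
    (Relation.ReflTransGen.stdSymm.symm _ _ (H b hb hbz))

open Classical in
theorem nonadj_insert {V : Type*} (G : SimpleGraph V) (w : V) (T : Finset V) (hw : w ∉ T) :
    ∑ x ∈ insert w T, ∑ y ∈ insert w T, nonadjF G x y
      = 2 * (∑ y ∈ T, nonadjF G w y) + ∑ x ∈ T, ∑ y ∈ T, nonadjF G x y := by
  have hs : ∀ x, nonadjF G x w = nonadjF G w x := by
    intro x; simp [nonadjF, G.adj_comm, ne_comm]
  have h0 : nonadjF G w w = 0 := by simp [nonadjF]
  rw [Finset.sum_insert hw, Finset.sum_insert hw, h0]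
  simp only [Finset.sum_insert hw, hs, Finset.sum_add_distrib]
  ring

open Classical in
theorem main_ind {V : Type*} (G : SimpleGraph V) (u v : V) (huv : u ≠ v) (n : ℕ) :
    ∀ S : Finset V, S.card = n → 4 ≤ S.card → u ∈ S → v ∈ S →
      (∑ x ∈ S, ∑ y ∈ S, nonadjF G x y) + 8 ≤ 2 * S.card →
      ∃ s : Set V, (u ∈ s ↔ v ∈ s) ∧ ∀ z, ∀ a ∈ S, ∀ b ∈ S, a ≠ z → b ≠ z →
        Relation.ReflTransGen (stepR G s S z) a b := by
  induction n with
  | zero => intro S h1 h2; omega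
  | succ n ih =>
    intro S hS h4 hu hv hM
    by_cases hbase : ∀ w ∈ S, w ≠ u → w ≠ v → ∀ x ∈ S, w ≠ x → G.Adj w x
    · have hc : 1 < ((S.erase u).erase v).card := by
        rw [Finset.card_erase_of_mem (by simp [hv, huv.symm]), Finset.card_erase_of_mem hu]
        omega
      obtain ⟨p, hp, q, hq, hpq⟩ := Finset.one_lt_card.1 hc
      simp only [Finset.mem_erase] at hp hq
      refine ⟨{x | x ≠ p ∧ x ≠ q}, by simp; tauto, ?_⟩
      intro z
      have hh : ∃ h, h ≠ z ∧ (h = p ∨ h = q) := by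
        by_cases h : p = z
        · exact ⟨q, by rintro rfl; exact hpq h, Or.inr rfl⟩
        · exact ⟨p, h, Or.inl rfl⟩
      have hk : ∃ k, k ≠ z ∧ (k = u ∨ k = v) := by
        by_cases h : u = z
        · exact ⟨v, by rintro rfl; exact huv h, Or.inr rfl⟩
        · exact ⟨u, h, Or.inl rfl⟩
      obtain ⟨h, hhz, hh⟩ := hh
      obtain ⟨k, hkz, hk⟩ := hk
      have hhS : h ∈ S := by rcases hh with rfl | rfl <;> tauto
      have hkS : k ∈ S := by rcases hk with rfl | rfl <;> tauto
      have key : ∀ a ∈ S, a ≠ z → ∀ c ∈ S, c ≠ z → (c = p ∨ c = q) → (a ≠ p ∧ a ≠ q) →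
          stepR G {x | x ≠ p ∧ x ≠ q} S z a c := by
        intro a ha haz c hcS hcz hc hap
        refine ⟨ha, hcS, haz, hcz, (hbase c hcS ?_ ?_ a ha ?_).symm, ?_⟩
        · rcases hc with rfl | rfl <;> tauto
        · rcases hc with rfl | rfl <;> tauto
        · rcases hc with rfl | rfl <;> [exact hap.1.symm; exact hap.2.symm]
        · simp only [Set.mem_ofPred_eq]; tauto
      have hkp : k ≠ p ∧ k ≠ q := by
        rcases hk with rfl | rfl
        · exact ⟨fun e => hp.2.1 e.symm, fun e => hq.2.1 e.symm⟩
        · exact ⟨fun e => hp.1 e.symm, fun e => hq.1 e.symm⟩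
      apply stepR_hub (h := h)
      intro a ha haz
      by_cases hap : a ≠ p ∧ a ≠ q
      · exact Relation.ReflTransGen.single (key a ha haz h hhS hhz hh hap)
      · exact (Relation.ReflTransGen.single
          (stepR_symm (key k hkS hkz a ha haz (by tauto) hkp))).tail
          (key k hkS hkz h hhS hhz hh hkp)
    · push Not at hbase
      obtain ⟨w, hwS, hwu, hwv, x0, hx0S, hwx0, hnadj⟩ := hbase
      obtain ⟨T, hwT, rfl⟩ : ∃ T, w ∉ T ∧ S = insert w T :=
        ⟨S.erase w, by simp, (Finset.insert_erase hwS).symm⟩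
      rw [nonadj_insert G w T hwT] at hM
      rw [Finset.card_insert_of_notMem hwT] at hM hS h4
      have hx0T : x0 ∈ T := (Finset.mem_insert.1 hx0S).resolve_left hwx0.symm
      have hd : 1 ≤ ∑ y ∈ T, nonadjF G w y := by
        have := Finset.single_le_sum (f := fun y => nonadjF G w y) (fun _ _ => Nat.zero_le _) hx0T
        have h1 : nonadjF G w x0 = 1 := by simp [nonadjF, hwx0, hnadj]
        simp only [h1] at this
        exact this
      have hcard : (∑ y ∈ T, nonadjF G w y) + (T.filter (fun y => G.Adj w y)).card = T.card := by
        rw [Finset.card_filter, ← Finset.sum_add_distrib, Finset.card_eq_sum_ones]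
        apply Finset.sum_congr rfl
        intro y hy
        have : w ≠ y := by rintro rfl; exact hwT hy
        by_cases h : G.Adj w y <;> simp [nonadjF, h, this]
      have huT : u ∈ T := (Finset.mem_insert.1 hu).resolve_left hwu.symm
      have hvT : v ∈ T := (Finset.mem_insert.1 hv).resolve_left hwv.symm
      obtain ⟨s, hs, hconn⟩ := ih T (by omega) (by omega) huT hvT (by omega)
      have h3 : 2 < (T.filter (fun y => G.Adj w y)).card := by omega
      obtain ⟨x, y, hx, hy, hxy, hxys⟩ : ∃ x y, (x ∈ T ∧ G.Adj w x) ∧ (y ∈ T ∧ G.Adj w y) ∧ x ≠ y ∧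
          (x ∈ s ↔ y ∈ s) := by
        obtain ⟨a, ha, b, hb, c, hc, hab, hac, hbc⟩ := Finset.two_lt_card.1 h3
        simp only [Finset.mem_filter] at ha hb hc
        by_cases h1 : a ∈ s ↔ b ∈ s
        · exact ⟨a, b, ha, hb, hab, h1⟩
        by_cases h2 : a ∈ s ↔ c ∈ s
        · exact ⟨a, c, ha, hc, hac, h2⟩
        · exact ⟨b, c, hb, hc, hbc, by tauto⟩
      have hmem : ∀ t, t ≠ w → (t ∈ {t | if t = w then x ∉ s else t ∈ s} ↔ t ∈ s) := by
        intro t ht; simp [ht]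
      have hmemw : w ∈ {t | if t = w then x ∉ s else t ∈ s} ↔ x ∉ s := by simp
      have hT : ∀ t ∈ T, t ≠ w := by rintro t ht rfl; exact hwT ht
      refine ⟨{t | if t = w then x ∉ s else t ∈ s}, ?_, ?_⟩
      · rw [hmem u hwu.symm, hmem v hwv.symm]; exact hs
      · generalize {t | if t = w then x ∉ s else t ∈ s} = s' at hmem hmemw ⊢
        intro z
        have lift : ∀ a ∈ T, ∀ b ∈ T, a ≠ z → b ≠ z →
            Relation.ReflTransGen (stepR G s' (insert w T) z) a b := by
          intro a ha b hb haz hbz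
          refine Relation.ReflTransGen.mono ?_ _ _ (hconn z a ha b hb haz hbz)
          rintro c d ⟨h1, h2, h3, h4, h5, h6⟩
          refine ⟨Finset.mem_insert_of_mem h1, Finset.mem_insert_of_mem h2, h3, h4, h5, ?_⟩
          rw [hmem c (hT c h1), hmem d (hT d h2)]; exact h6
        obtain ⟨g, hgT, hgw, hgz, hgs⟩ : ∃ g, g ∈ T ∧ G.Adj w g ∧ g ≠ z ∧ (x ∈ s ↔ g ∈ s) := by
          by_cases h : x = z
          · exact ⟨y, hy.1, hy.2, fun e => hxy (h.trans e.symm), hxys⟩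
          · exact ⟨x, hx.1, hx.2, h, Iff.rfl⟩
        apply stepR_hub (h := g)
        intro a ha haz
        rcases Finset.mem_insert.1 ha with rfl | haT
        · refine Relation.ReflTransGen.single ⟨ha, Finset.mem_insert_of_mem hgT, haz, hgz, hgw, ?_⟩
          rw [hmemw, hmem g (hT g hgT), hgs]
        · exact lift a haT g hgT haz hgz

open Classical in
theorem nonadj_univ {V : Type*} [Fintype V] (G : SimpleGraph V)
    (hn : 6 ≤ Fintype.card V)
    (hm : Nat.choose (Fintype.card V - 1) 2 + 3 ≤ G.edgeSet.ncard) :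
    (∑ x : V, ∑ y : V, nonadjF G x y) + 8 ≤ 2 * Fintype.card V := by
  have h1 : ∀ x : V, (∑ y : V, nonadjF G x y) + G.degree x + 1 = Fintype.card V := by
    intro x
    have e1 : G.degree x = ∑ y : V, if G.Adj x y then 1 else 0 := by
      rw [← Finset.card_filter, ← G.card_neighborFinset_eq_degree, G.neighborFinset_eq_filter]
    have e2 : (1 : ℕ) = ∑ y : V, if x = y then 1 else 0 := by simp
    have e3 : Fintype.card V = ∑ y : V, 1 := by simp
    rw [e1, e3]
    conv_lhs => rw [e2]
    rw [← Finset.sum_add_distrib, ← Finset.sum_add_distrib]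
    apply Finset.sum_congr rfl
    intro y _
    by_cases h : x = y
    · subst h; simp [nonadjF]
    · by_cases h' : G.Adj x y <;> simp [nonadjF, h, h']
  have h2 : (∑ x : V, ∑ y : V, nonadjF G x y) + 2 * G.edgeFinset.card + Fintype.card V
      = Fintype.card V * Fintype.card V := by
    rw [← G.sum_degrees_eq_twice_card_edges]
    have := Finset.sum_congr (rfl : (Finset.univ : Finset V) = Finset.univ) (fun x _ => h1 x)
    simpa [Finset.sum_add_distrib] using this
  have h3 : G.edgeSet.ncard = G.edgeFinset.card := by
    rw [← SimpleGraph.coe_edgeFinset, Set.ncard_coe_finset]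
  rw [h3] at hm
  obtain ⟨k, hk⟩ : ∃ k, Fintype.card V = k + 2 := ⟨Fintype.card V - 2, by omega⟩
  rw [hk] at hm h2 ⊢
  have h4 : 2 * Nat.choose (k + 1) 2 = (k + 1) * k := by
    rw [Nat.choose_two_right, Nat.add_sub_cancel]
    exact Nat.mul_div_cancel' (by rw [mul_comm]; exact (Nat.even_mul_succ_self k).two_dvd)
  have h5 : k + 2 - 1 = k + 1 := by omega
  rw [h5] at hm
  nlinarith

theorem stmt13 {V : Type*} [Fintype V] (G : SimpleGraph V)
    (hn : 6 ≤ Fintype.card V)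
    (hm : Nat.choose (Fintype.card V - 1) 2 + 3 ≤ G.edgeSet.ncard) :
    ∀ u v : V, u ≠ v →
      ∃ H : SimpleGraph V, H ≤ G ∧ TwoConnected H ∧
        ∃ s : Set V, (∀ a b : V, H.Adj a b → (a ∈ s ↔ b ∉ s)) ∧ (u ∈ s ↔ v ∈ s) := by
  intro u v huv
  obtain ⟨s, hs, hconn⟩ := main_ind G u v huv _ Finset.univ rfl
    (by rw [Finset.card_univ]; omega) (Finset.mem_univ _) (Finset.mem_univ _)
    (by rw [Finset.card_univ]; exact nonadj_univ G hn hm)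
  refine ⟨{ Adj := fun a b => G.Adj a b ∧ (a ∈ s ↔ b ∉ s)
            symm := ⟨fun a b h => ⟨h.1.symm, by tauto⟩⟩
            loopless := ⟨fun a h => G.loopless.irrefl a h.1⟩ }, fun a b h => h.1, ⟨?_, ?_⟩, s,
          fun a b h => h.2, hs⟩
  · rw [Nat.card_eq_fintype_card]; omega
  · intro z
    rw [SimpleGraph.connected_iff]
    constructor
    · rintro ⟨a, ha⟩ ⟨b, hb⟩
      have h := hconn z a (Finset.mem_univ _) b (Finset.mem_univ _) ha hb
      induction h with
      | refl => exact SimpleGraph.Reachable.refl _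
      | tail _ hst ih =>
        obtain ⟨-, -, h3, h4, h5, h6⟩ := hst
        refine (ih h3).trans (SimpleGraph.Adj.reachable ?_)
        exact ⟨h5, h6⟩
    · by_cases h : u = z
      · exact ⟨⟨v, fun e => huv (h.trans e.symm)⟩⟩
      · exact ⟨⟨u, h⟩⟩
end
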